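/- Let c > 0. If Mⁿ ⊂ ℝ^{n+1} is a closed, smooth, strictly convex hypersurface with support function h (no sign assumption on h) and Gauss curvature 𝒦 satisfying e^{|Dh|²/2} 𝒦 = c on 𝕊ⁿ, then Mⁿ is a rescaling of 𝕊ⁿ. No assumption is made on the size of the constant c. -/

import Mathlib

/-!
We work with the unit sphere `𝕊ⁿ = sphere 0 1 ⊆ ℝ^{n+1}`.  A `C²` function `u` on `𝕊ⁿ` is
represented by its positively 1-homogeneous extension `u : ℝ^{n+1} → ℝ` (which is `C²` away
from the origin).  For such an extension, the ambient Euclidean Hessian `D²u(x)` at a point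
`x ∈ 𝕊ⁿ` annihilates the radial direction `x` and its restriction to the tangent space
`x^⊥ = T_x𝕊ⁿ` coincides with the spherical bilinear form `∇̄²u + ḡ u`.  Consequently:

* the eigenvalues of `∇̄²u + ḡ u` w.r.t. `ḡ` are the eigenvalues of the ambient Hessian
  matrix other than the trivial zero radial one, so for `0 ≤ k ≤ n` the elementary symmetric
  function `σ_k(∇̄²u + ḡ u, ḡ)` equals the `k`-th elementary symmetric function of all the
  eigenvalues of the ambient Hessian matrix, which is `(-1)^k` times the coefficient of
  `t^{n+1-k}` in its characteristic polynomial (`sigmaElem` below);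
* the spherical gradient `Du(x)` is the tangential part `∇u(x) - u(x)x` of the ambient
  gradient (`sphGrad` below);
* `u` is convex (resp. the hypersurface with support function `u` is strictly convex) iff the
  Hessian form is positive semidefinite (resp. positive definite on `x^⊥`) at every `x ∈ 𝕊ⁿ`.

The spherical Lebesgue measure `μ` is the `n`-dimensional Hausdorff measure `μH[n]`.
-/

open MeasureTheory Metric
open scoped RealInnerProductSpace

noncomputable section

/-- The ambient Euclidean space `ℝ^{n+1}`. -/
abbrev Esp (n : ℕ) := EuclideanSpace ℝ (Fin (n + 1))

/-- The ambient Hessian bilinear form `D²u(x)(v,w)` of `u : ℝ^{n+1} → ℝ`. -/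
def hessForm (n : ℕ) (u : Esp n → ℝ) (x v w : Esp n) : ℝ :=
  fderiv ℝ (fun y => fderiv ℝ u y w) x v

/-- The ambient Hessian matrix of `u` at `x` in the standard orthonormal coordinates. -/
def hessMatrix (n : ℕ) (u : Esp n → ℝ) (x : Esp n) : Matrix (Fin (n + 1)) (Fin (n + 1)) ℝ :=
  Matrix.of fun i j => hessForm n u x (EuclideanSpace.single i 1) (EuclideanSpace.single j 1)

/-- For a positively 1-homogeneous `u` and `x ∈ 𝕊ⁿ`, `k ≤ n`, this is
`σ_k(∇̄²u + ḡ u, ḡ)(x)`, the `k`-th elementary symmetric function of the eigenvalues of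
`∇̄²u + ḡ u` w.r.t. `ḡ`, computed from the characteristic polynomial of the ambient Hessian. -/
def sigmaElem (n k : ℕ) (u : Esp n → ℝ) (x : Esp n) : ℝ :=
  (-1 : ℝ) ^ k * ((hessMatrix n u x).charpoly.coeff (n + 1 - k))

/-- The spherical gradient `Du(x)` at `x ∈ 𝕊ⁿ`: the tangential part of the ambient gradient. -/
def sphGrad (n : ℕ) (u : Esp n → ℝ) (x : Esp n) : Esp n :=
  gradient u x - u x • x

/-- `u` is positively 1-homogeneous (i.e. it is the canonical extension of `u|_{𝕊ⁿ}`). -/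
def PosHom (n : ℕ) (u : Esp n → ℝ) : Prop :=
  ∀ r : ℝ, 0 < r → ∀ x : Esp n, u (r • x) = r * u x

/-- The spherical Lebesgue measure on `ℝ^{n+1}` (to be restricted to `𝕊ⁿ`):
the `n`-dimensional Hausdorff measure. -/
def sphMeasure (n : ℕ) : Measure (Esp n) := μH[(n : ℝ)]

open scoped ContDiff

/-- trace of an operator -/
def tr {m : ℕ} (A : EuclideanSpace ℝ (Fin m) →L[ℝ] EuclideanSpace ℝ (Fin m)) : ℝ :=
  LinearMap.trace ℝ _ (A : EuclideanSpace ℝ (Fin m) →ₗ[ℝ] EuclideanSpace ℝ (Fin m))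

/-- determinant of an operator -/
def dt {m : ℕ} (A : EuclideanSpace ℝ (Fin m) →L[ℝ] EuclideanSpace ℝ (Fin m)) : ℝ :=
  LinearMap.det (A : EuclideanSpace ℝ (Fin m) →ₗ[ℝ] EuclideanSpace ℝ (Fin m))

/-- matrix of an operator -/
def mat {m : ℕ} (A : EuclideanSpace ℝ (Fin m) →L[ℝ] EuclideanSpace ℝ (Fin m)) :
    Matrix (Fin m) (Fin m) ℝ :=
  LinearMap.toMatrix (EuclideanSpace.basisFun (Fin m) ℝ).toBasis
    (EuclideanSpace.basisFun (Fin m) ℝ).toBasis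
    (A : EuclideanSpace ℝ (Fin m) →ₗ[ℝ] EuclideanSpace ℝ (Fin m))

/-- rank one operator `u ↦ ⟪v,u⟫ w` -/
def outer {m : ℕ} (v w : EuclideanSpace ℝ (Fin m)) :
    EuclideanSpace ℝ (Fin m) →L[ℝ] EuclideanSpace ℝ (Fin m) :=
  (innerSL ℝ v).smulRight w

section LA
variable {m : ℕ}

local notation "EE" => EuclideanSpace ℝ (Fin m)

@[simp] lemma outer_apply (v w u : EE) : outer v w u = ⟪v, u⟫ • w := by
  simp [outer]

lemma tr_eq_mat (A : EE →L[ℝ] EE) : tr A = (mat A).trace := by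
  rw [tr, mat, LinearMap.trace_eq_matrix_trace ℝ (EuclideanSpace.basisFun (Fin m) ℝ).toBasis]

lemma dt_eq_mat (A : EE →L[ℝ] EE) : dt A = (mat A).det := by
  rw [dt, mat, LinearMap.det_toMatrix]

lemma mat_apply (A : EE →L[ℝ] EE) (i j : Fin m) :
    mat A i j = ⟪EuclideanSpace.single i 1, A (EuclideanSpace.single j 1)⟫ := by
  simp [mat, LinearMap.toMatrix_apply, EuclideanSpace.inner_single_left]

lemma mat_mul (A B : EE →L[ℝ] EE) : mat (A * B) = mat A * mat B := by
  rw [mat, mat, mat, ← LinearMap.toMatrix_mul]; rfl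

@[simp] lemma mat_one : mat (1 : EE →L[ℝ] EE) = 1 := by
  rw [mat]; exact LinearMap.toMatrix_one _

@[simp] lemma mat_add (A B : EE →L[ℝ] EE) : mat (A + B) = mat A + mat B := by
  ext i j; simp [mat_apply, inner_add_right]

@[simp] lemma mat_smul (r : ℝ) (A : EE →L[ℝ] EE) : mat (r • A) = r • mat A := by
  ext i j; simp [mat_apply, real_inner_smul_right]

lemma mat_mulVec (A : EE →L[ℝ] EE) (v : EE) : (mat A).mulVec v.ofLp = (A v).ofLp := by
  have := LinearMap.toMatrix_mulVec_repr (EuclideanSpace.basisFun (Fin m) ℝ).toBasis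
    (EuclideanSpace.basisFun (Fin m) ℝ).toBasis (A : EE →ₗ[ℝ] EE) v
  exact this

lemma tr_add (A B : EE →L[ℝ] EE) : tr (A + B) = tr A + tr B := by
  simp [tr_eq_mat]
lemma tr_smul (r : ℝ) (A : EE →L[ℝ] EE) : tr (r • A) = r * tr A := by
  simp [tr_eq_mat]
lemma tr_sub (A B : EE →L[ℝ] EE) : tr (A - B) = tr A - tr B := by
  have : A - B = A + (-1 : ℝ) • B := by ext; simp [sub_eq_add_neg]
  rw [this, tr_add, tr_smul]; ring
lemma tr_mul_comm (A B : EE →L[ℝ] EE) : tr (A * B) = tr (B * A) := by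
  rw [tr_eq_mat, tr_eq_mat, mat_mul, mat_mul, Matrix.trace_mul_comm]
@[simp] lemma tr_one : tr (1 : EE →L[ℝ] EE) = m := by
  simp [tr_eq_mat]
lemma tr_eq_sum (A : EE →L[ℝ] EE) :
    tr A = ∑ i, ⟪EuclideanSpace.single i (1 : ℝ), A (EuclideanSpace.single i 1)⟫ := by
  rw [tr_eq_mat, Matrix.trace]; simp only [Matrix.diag, mat_apply]
lemma tr_eq_sum_onb (b : OrthonormalBasis (Fin m) ℝ EE) (A : EE →L[ℝ] EE) :
    tr A = ∑ i, ⟪b i, A (b i)⟫ := by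
  rw [tr, LinearMap.trace_eq_sum_inner _ b]; rfl
lemma tr_outer (v w : EE) : tr (outer v w) = ⟪v, w⟫ := by
  rw [tr_eq_sum]
  simp only [outer_apply, inner_smul_right]
  have := (EuclideanSpace.basisFun (Fin m) ℝ).sum_inner_mul_inner v w
  simpa using this
lemma mul_outer (A : EE →L[ℝ] EE) (v w : EE) : A * outer v w = outer v (A w) := by
  ext1 u; simp
lemma tr_mul_outer (A : EE →L[ℝ] EE) (v w : EE) : tr (A * outer v w) = ⟪v, A w⟫ := by
  rw [mul_outer, tr_outer]

/-- symmetric positive definite -/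
def SPD (A : EE →L[ℝ] EE) : Prop :=
  (∀ v w, ⟪A v, w⟫ = ⟪v, A w⟫) ∧ ∀ v, v ≠ 0 → 0 < ⟪A v, v⟫

lemma SPD.posDef {A : EE →L[ℝ] EE} (hA : SPD A) : (mat A).PosDef := by
  apply Matrix.PosDef.of_dotProduct_mulVec_pos
  · ext i j
    rw [Matrix.conjTranspose_apply, mat_apply, mat_apply, ← hA.1, star_trivial, real_inner_comm]
  · intro x hx
    have h := hA.2 (WithLp.toLp 2 x) (by simpa using hx)
    have h2 := mat_mulVec A (WithLp.toLp 2 x)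
    simp only at h2
    rw [h2]
    rw [real_inner_comm] at h
    simpa [PiLp.inner_apply, dotProduct, mul_comm] using h

lemma posDef_log {N : Matrix (Fin m) (Fin m) ℝ} (hN : N.PosDef) :
    m + Real.log N.det ≤ N.trace := by
  rw [hN.1.det_eq_prod_eigenvalues, hN.1.trace_eq_sum_eigenvalues]
  simp only [RCLike.ofReal_real_eq_id, id]
  rw [Real.log_prod (fun i _ => (hN.eigenvalues_pos i).ne')]
  have : (m : ℝ) = ∑ i : Fin m, (1 : ℝ) := by simp
  rw [this, ← Finset.sum_add_distrib]
  apply Finset.sum_le_sum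
  intro i _
  linarith [Real.log_le_sub_one_of_pos (hN.eigenvalues_pos i)]

open scoped MatrixOrder in
lemma exists_factor {A : Matrix (Fin m) (Fin m) ℝ} (hA : A.PosDef) :
    ∃ B : Matrix (Fin m) (Fin m) ℝ, A = B.conjTranspose * B := by
  obtain ⟨B, hB⟩ := CStarAlgebra.nonneg_iff_eq_star_mul_self.mp hA.posSemidef.nonneg
  exact ⟨B, hB⟩

lemma trace_ineq_mat {A T a : Matrix (Fin m) (Fin m) ℝ} (hA : A.PosDef) (hT : T.PosDef)
    (ha : a * A = 1) : m + Real.log T.det - Real.log A.det ≤ (a * T).trace := by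
  obtain ⟨B, hB⟩ := exists_factor hA
  have hdA : 0 < A.det := hA.det_pos
  have hdB : B.det ≠ 0 := by
    intro h0; rw [hB, Matrix.det_mul, h0] at hdA; simp at hdA
  have hu : IsUnit B.det := isUnit_iff_ne_zero.mpr hdB
  have haa : a = B⁻¹ * (B⁻¹).conjTranspose := by
    have hAa : A * a = 1 := mul_eq_one_comm.mp ha
    have : (B⁻¹ * (B⁻¹).conjTranspose) * A = 1 := by
      have e1 : (B⁻¹).conjTranspose * B.conjTranspose = 1 := by
        rw [← Matrix.conjTranspose_mul, Matrix.mul_nonsing_inv _ hu, Matrix.conjTranspose_one]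
      rw [hB, Matrix.mul_assoc, ← Matrix.mul_assoc (B⁻¹).conjTranspose, e1, Matrix.one_mul,
        Matrix.nonsing_inv_mul _ hu]
    calc a = ((B⁻¹ * (B⁻¹).conjTranspose) * A) * a := by rw [this, Matrix.one_mul]
      _ = _ := by rw [Matrix.mul_assoc, hAa, Matrix.mul_one]
  have hN : ((B⁻¹).conjTranspose * T * B⁻¹).PosDef := by
    apply hT.conjTranspose_mul_mul_same
    have hiu : IsUnit (B⁻¹) := by
      rw [Matrix.isUnit_nonsing_inv_iff, Matrix.isUnit_iff_isUnit_det]; exact hu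
    exact Matrix.mulVec_injective_of_isUnit hiu
  have h1 := posDef_log hN
  have htr : ((B⁻¹).conjTranspose * T * B⁻¹).trace = (a * T).trace := by
    rw [Matrix.trace_mul_comm, haa, Matrix.mul_assoc]
  have hdet : ((B⁻¹).conjTranspose * T * B⁻¹).det = T.det / A.det := by
    rw [Matrix.det_mul, Matrix.det_mul, Matrix.det_conjTranspose, hB, Matrix.det_mul,
      Matrix.det_conjTranspose, Matrix.det_nonsing_inv]
    simp only [star_trivial, Ring.inverse_eq_inv']
    field_simp
  rw [htr, hdet, Real.log_div hT.det_pos.ne' hdA.ne'] at h1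
  linarith

/-- tangent-plane inequality for log det -/
lemma trace_ineq {A T a : EE →L[ℝ] EE} (hA : SPD A) (hT : SPD T) (ha : a * A = 1) :
    m + Real.log (dt T) - Real.log (dt A) ≤ tr (a * T) := by
  rw [dt_eq_mat, dt_eq_mat, tr_eq_mat, mat_mul]
  exact trace_ineq_mat hA.posDef hT.posDef (by rw [← mat_mul, ha, mat_one])

lemma SPD.dt_pos {A : EE →L[ℝ] EE} (hA : SPD A) : 0 < dt A := by
  rw [dt_eq_mat]; exact hA.posDef.det_pos

lemma SPD.isUnit {A : EE →L[ℝ] EE} (hA : SPD A) : IsUnit A := by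
  have hinj : Function.Injective A := by
    rw [injective_iff_map_eq_zero]
    intro v hv
    by_contra h0
    have := hA.2 v h0
    rw [hv] at this; simp at this
  have hk : LinearMap.ker (A : EE →ₗ[ℝ] EE) = ⊥ := LinearMap.ker_eq_bot.mpr hinj
  have hu : IsUnit (A : EE →ₗ[ℝ] EE) := by
    rw [LinearMap.isUnit_iff_ker_eq_bot]; exact hk
  obtain ⟨e, he⟩ := (Module.End.isUnit_iff _).mp hu |> fun hb =>
    (⟨LinearEquiv.ofBijective (A : EE →ₗ[ℝ] EE) hb, rfl⟩ :
      ∃ e : EE ≃ₗ[ℝ] EE, e = LinearEquiv.ofBijective (A : EE →ₗ[ℝ] EE) hb)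
  rw [isUnit_iff_exists]
  refine ⟨LinearMap.toContinuousLinearMap (e.symm : EE →ₗ[ℝ] EE), ?_, ?_⟩
  · ext1 v
    have h1 : e (e.symm v) = v := e.apply_symm_apply v
    have h2 : ∀ w, e w = A w := fun w => by rw [he]; rfl
    have h2 := h2 (e.symm v)
    exact h2.symm.trans h1
  · ext1 v
    have : e.symm (e v) = v := e.symm_apply_apply v
    have h2 : e v = A v := by rw [he]; rfl
    rw [h2] at this
    simpa using this

lemma dt_mul (A B : EE →L[ℝ] EE) : dt (A * B) = dt A * dt B := by
  rw [dt_eq_mat, dt_eq_mat, dt_eq_mat, mat_mul, Matrix.det_mul]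

lemma dt_smul (r : ℝ) (A : EE →L[ℝ] EE) : dt (r • A) = r ^ m * dt A := by
  rw [dt_eq_mat, dt_eq_mat, mat_smul, Matrix.det_smul]; simp

lemma mat_outer (v w : EE) : mat (outer v w) = Matrix.vecMulVec w.ofLp v.ofLp := by
  ext i j
  simp [mat_apply, Matrix.vecMulVec_apply, EuclideanSpace.inner_single_left,
    EuclideanSpace.inner_single_right, mul_comm]

lemma dot_self (v : EE) : v.ofLp ⬝ᵥ v.ofLp = ⟪v, v⟫ := by
  rw [PiLp.inner_apply]; simp [dotProduct, sq]

lemma cadd (A B : EE →L[ℝ] EE) (u : EE) : (A + B) u = A u + B u := rfl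
lemma csub (A B : EE →L[ℝ] EE) (u : EE) : (A - B) u = A u - B u := rfl
lemma csmul (r : ℝ) (B : EE →L[ℝ] EE) (u : EE) : (r • B) u = r • B u := rfl
lemma cmul (A B : EE →L[ℝ] EE) (u : EE) : (A * B) u = A (B u) := rfl
lemma cone (u : EE) : (1 : EE →L[ℝ] EE) u = u := rfl

lemma cmul_smul (A B : EE →L[ℝ] EE) (r : ℝ) : A * (r • B) = r • (A * B) := by
  ext1 u; rw [cmul, csmul, csmul, cmul, map_smul]
lemma csmul_mul (A B : EE →L[ℝ] EE) (r : ℝ) : (r • A) * B = r • (A * B) := by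
  ext1 u; rw [cmul, csmul, csmul, cmul]

lemma dt_one_add (γ : ℝ) (v : EE) : dt (1 + γ • outer v v) = 1 + γ * ⟪v, v⟫ := by
  have := Matrix.det_one_add_replicateCol_mul_replicateRow (ι := Unit) (γ • v.ofLp) v.ofLp
  rw [dt_eq_mat, mat_add, mat_one, mat_smul, mat_outer, ← Matrix.smul_vecMulVec,
    Matrix.vecMulVec_eq Unit, this]
  rw [dotProduct_smul, smul_eq_mul, dot_self]

lemma outer_mul_outer (a b c d : EE) : outer a b * outer c d = ⟪a, d⟫ • outer c b := by
  ext1 u; simp [real_inner_smul_right, smul_smul, mul_comm]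

lemma dt_outer2 (x p : EE) (q α β : ℝ) (hq : q ≠ 0) (hx : ⟪x, x⟫ = 1) (hp : ⟪p, x⟫ = 0) :
    dt (q • (1 : EE →L[ℝ] EE) + α • outer p p + β • outer x x)
      = q ^ m * (1 + α / q * ⟪p, p⟫) * (1 + β / q) := by
  have : q • (1 : EE →L[ℝ] EE) + α • outer p p + β • outer x x
      = (q • (1 + (α / q) • outer p p)) * (1 + (β / q) • outer x x) := by
    ext1 u
    simp only [cadd, csmul, cmul, cone, outer_apply, smul_add,
      inner_add_right, real_inner_smul_right, hp, smul_smul, mul_zero, add_zero]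
    rw [show q * (β / q * ⟪x, u⟫) = β * ⟪x, u⟫ by field_simp,
      show q * (α / q) * ⟪p, u⟫ = α * ⟪p, u⟫ by field_simp]
    abel
  rw [this, dt_mul, dt_smul, dt_one_add, dt_one_add, hx, mul_one]

lemma dt_tau (A : EE →L[ℝ] EE) (x : EE) (τ : ℝ) (hx : ⟪x, x⟫ = 1) (hA : A x = 0) :
    dt (A + τ • outer x x) = τ * dt (A + outer x x) := by
  have : A + τ • outer x x = (A + outer x x) * (1 + (τ - 1) • outer x x) := by
    ext1 u
    simp only [cadd, csmul, cmul, cone, outer_apply, map_add,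
      map_smul, hA, smul_zero, add_zero, inner_add_right, real_inner_smul_right, hx, mul_one]
    module
  rw [this, dt_mul, dt_one_add, hx]; ring

end LA

open Polynomial in
lemma sigma_eq_det {n : ℕ} (A : Esp n →L[ℝ] Esp n) (x : Esp n) (hx : ⟪x, x⟫ = 1)
    (hA : A x = 0) : (-1 : ℝ) ^ n * ((mat A).charpoly.coeff 1) = dt (A + outer x x) := by
  set N := mat A with hN
  set P := Matrix.vecMulVec x.ofLp x.ofLp with hP
  have hNP : N * P = 0 := by
    rw [hN, hP, Matrix.mul_vecMulVec, mat_mulVec, hA]; simp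
  have hdet : dt (A + outer x x) = (N + P).det := by
    rw [dt_eq_mat, mat_add, mat_outer]
  have hcm : N.charmatrix * P.charmatrix = (X : ℝ[X]) • (N + P).charmatrix := by
    have hmap : (Polynomial.C.mapMatrix N) * (Polynomial.C.mapMatrix P) = 0 := by
      rw [← map_mul, hNP, map_zero]
    have hsc : ((X : ℝ[X]) • (1 : Matrix (Fin (n+1)) (Fin (n+1)) ℝ[X])) = Matrix.scalar _ X := by
      rw [Matrix.smul_one_eq_diagonal]; rfl
    simp only [Matrix.charmatrix, map_add]
    rw [sub_mul, mul_sub, mul_sub, hmap, ← hsc]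
    simp only [smul_mul_assoc, mul_smul_comm, one_mul, mul_one, smul_sub, smul_add]
    abel
  have h1 := congrArg Matrix.det hcm
  rw [Matrix.det_mul, Matrix.det_smul] at h1
  change N.charpoly * P.charpoly = X ^ _ * (N + P).charpoly at h1
  have hxx : x.ofLp ⬝ᵥ x.ofLp = 1 := by
    rw [← hx]; exact dot_self x
  rw [hP, Matrix.charpoly_vecMulVec, hxx] at h1
  simp only [Fintype.card_fin, add_tsub_cancel_right, one_smul] at h1
  have h2 : N.charpoly * (X - 1) = X * (N + P).charpoly := by
    have h3 : (X : ℝ[X]) ^ n ≠ 0 := pow_ne_zero _ X_ne_zero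
    apply mul_left_cancel₀ h3
    calc _ = N.charpoly * (X ^ (n+1) - X ^ n) := by ring
      _ = _ := by rw [h1, hP]; ring
  have c0 := congrArg (fun p => coeff p 0) h2
  have c1 := congrArg (fun p => coeff p 1) h2
  simp only [mul_sub, mul_one, coeff_sub, coeff_X_mul_zero, coeff_mul_X_zero] at c0
  rw [mul_sub, mul_one, coeff_sub] at c1
  erw [coeff_mul_X _ 0, coeff_X_mul _ 0] at c1
  have c2 := Matrix.det_eq_sign_charpoly_coeff (N + P)
  rw [hdet, c2, ← c1]
  simp only [Fintype.card_fin, zero_add] at c0 ⊢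
  rw [pow_succ]
  linear_combination -(-1 : ℝ) ^ n * c0



lemma two_le_inf : minSmoothness ℝ 2 ≤ ∞ := by
  rw [minSmoothness_of_isRCLikeNormedField]; exact ENat.LEInfty.out

/-- Hessian operator -/
def hM {n : ℕ} (h : Esp n → ℝ) (y : Esp n) : Esp n →L[ℝ] Esp n := fderiv ℝ (gradient h) y

/-- smooth homogeneous function -/
structure SH (n : ℕ) (h : Esp n → ℝ) : Prop where
  sm : ContDiffOn ℝ ∞ h {(0 : Esp n)}ᶜ
  hom : PosHom n h

namespace SH
variable {n : ℕ} {h : Esp n → ℝ}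

lemma cd (H : SH n h) {y : Esp n} (hy : y ≠ 0) : ContDiffAt ℝ ∞ h y :=
  H.sm.contDiffAt (isOpen_compl_singleton.mem_nhds hy)

lemma cdG (H : SH n h) {y : Esp n} (hy : y ≠ 0) : ContDiffAt ℝ ∞ (gradient h) y := by
  have h1 : ContDiffAt ℝ ∞ (fderiv ℝ h) y := (H.cd hy).fderiv_right (m := ∞) (by simp)
  have h2 : ContDiff ℝ ∞ (InnerProductSpace.toDual ℝ (Esp n)).symm :=
    (InnerProductSpace.toDual ℝ (Esp n)).symm.contDiff
  exact h2.contDiffAt.comp y h1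

lemma cdM (H : SH n h) {y : Esp n} (hy : y ≠ 0) : ContDiffAt ℝ ∞ (hM h) y :=
  (H.cdG hy).fderiv_right (m := ∞) (by simp)

lemma dh (H : SH n h) {y : Esp n} (hy : y ≠ 0) : HasFDerivAt h (innerSL ℝ (gradient h y)) y := by
  have := ((H.cd hy).differentiableAt (by simp)).hasGradientAt
  exact this.hasFDerivAt

lemma dG (H : SH n h) {y : Esp n} (hy : y ≠ 0) : HasFDerivAt (gradient h) (hM h y) y :=
  ((H.cdG hy).differentiableAt (by simp)).hasFDerivAt

lemma dM (H : SH n h) {y : Esp n} (hy : y ≠ 0) : HasFDerivAt (hM h) (fderiv ℝ (hM h) y) y :=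
  ((H.cdM hy).differentiableAt (by simp)).hasFDerivAt

lemma euler (H : SH n h) {y : Esp n} (hy : y ≠ 0) : ⟪gradient h y, y⟫ = h y := by
  have h1 : HasDerivAt (fun r : ℝ => r • y) y 1 := by
    simpa using (hasDerivAt_id (1 : ℝ)).smul_const y
  have h2 : HasDerivAt (fun r : ℝ => h (r • y)) ⟪gradient h y, y⟫ 1 := by
    have := (show HasFDerivAt h (innerSL ℝ (gradient h y)) ((1 : ℝ) • y) by
      rw [one_smul]; exact H.dh hy).comp_hasDerivAt (1 : ℝ) h1
    exact this
  have h3 : HasDerivAt (fun r : ℝ => h (r • y)) (h y) 1 := by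
    have h4 : HasDerivAt (fun r : ℝ => r * h y) (h y) 1 := by
      simpa using (hasDerivAt_id (1 : ℝ)).mul_const (h y)
    apply h4.congr_of_eventuallyEq
    filter_upwards [lt_mem_nhds (show (0 : ℝ) < 1 by norm_num)] with r hr
    exact H.hom r hr y
  exact h2.unique h3

lemma Ghom (H : SH n h) {y : Esp n} (hy : y ≠ 0) {r : ℝ} (hr : 0 < r) : gradient h (r • y) = gradient h y := by
  have hry : r • y ≠ 0 := smul_ne_zero hr.ne' hy
  have h1 : HasFDerivAt (fun z => h (r • z)) (r • innerSL ℝ (gradient h (r • y))) y := by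
    have := (H.dh hry).comp y ((hasFDerivAt_id y).const_smul r)
    refine HasFDerivAt.congr_fderiv (f' := _) this ?_
    ext v; simp
  have h2 : HasFDerivAt (fun z => h (r • z)) (r • innerSL ℝ (gradient h y)) y := by
    have : (fun z => h (r • z)) = fun z => r • h z := by
      ext z; exact H.hom r hr z
    rw [this]
    exact (H.dh hy).const_smul r
  have h3 := h1.unique h2
  have h4 := smul_right_injective _ hr.ne' h3
  exact (innerSL_inj (𝕜 := ℝ)).mp h4

lemma My (H : SH n h) {y : Esp n} (hy : y ≠ 0) : hM h y y = 0 := by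
  have h1 : HasDerivAt (fun r : ℝ => r • y) y 1 := by
    simpa using (hasDerivAt_id (1 : ℝ)).smul_const y
  have h2 : HasDerivAt (fun r : ℝ => gradient h (r • y)) (hM h y y) 1 := by
    exact (show HasFDerivAt (gradient h) (hM h y) ((1 : ℝ) • y) by
      rw [one_smul]; exact H.dG hy).comp_hasDerivAt (1 : ℝ) h1
  have h3 : HasDerivAt (fun r : ℝ => gradient h (r • y)) 0 1 := by
    apply (hasDerivAt_const (1 : ℝ) (gradient h y)).congr_of_eventuallyEq
    filter_upwards [lt_mem_nhds (show (0 : ℝ) < 1 by norm_num)] with r hr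
    exact H.Ghom hy hr
  exact h2.unique h3

lemma Mhom (H : SH n h) {y : Esp n} (hy : y ≠ 0) {r : ℝ} (hr : 0 < r) : hM h (r • y) = r⁻¹ • hM h y := by
  have hry : r • y ≠ 0 := smul_ne_zero hr.ne' hy
  have h1 : HasFDerivAt (fun z => gradient h (r • z)) (r • hM h (r • y)) y := by
    have := (H.dG hry).comp y ((hasFDerivAt_id y).const_smul r)
    refine HasFDerivAt.congr_fderiv (f' := _) this ?_
    ext1 v; simp
  have h2 : HasFDerivAt (fun z => gradient h (r • z)) (hM h y) y := by
    apply (H.dG hy).congr_of_eventuallyEq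
    filter_upwards [isOpen_compl_singleton.mem_nhds hy] with z hz
    exact H.Ghom hz hr
  rw [← h1.unique h2, smul_smul, inv_mul_cancel₀ hr.ne', one_smul]

lemma hess (H : SH n h) {y : Esp n} (hy : y ≠ 0) (v w : Esp n) : hessForm n h y v w = ⟪hM h y v, w⟫ := by
  have h1 : HasFDerivAt (fun z => ⟪gradient h z, w⟫)
      ((innerSL ℝ w).comp (hM h y)) y := by
    have := (innerSL ℝ w).hasFDerivAt.comp y (H.dG hy)
    apply this.congr_of_eventuallyEq
    filter_upwards with z
    simp [real_inner_comm]
  have h2 : HasFDerivAt (fun z => fderiv ℝ h z w) ((innerSL ℝ w).comp (hM h y)) y := by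
    apply h1.congr_of_eventuallyEq
    filter_upwards [isOpen_compl_singleton.mem_nhds hy] with z hz
    rw [(H.dh hz).fderiv]; simp
  rw [hessForm, h2.fderiv]; simp [real_inner_comm]

lemma Msym (H : SH n h) {y : Esp n} (hy : y ≠ 0) (v w : Esp n) : ⟪hM h y v, w⟫ = ⟪v, hM h y w⟫ := by
  have h1 : IsSymmSndFDerivAt ℝ h y := (H.cd hy).isSymmSndFDerivAt two_le_inf
  have key : ∀ v w, fderiv ℝ (fderiv ℝ h) y v w = ⟪hM h y v, w⟫ := by
    intro v w
    rw [← H.hess hy, hessForm]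
    have hd : DifferentiableAt ℝ (fderiv ℝ h) y :=
      ((H.cd hy).fderiv_right (m := ∞) (by simp)).differentiableAt (by simp)
    rw [fderiv_clm_apply hd (differentiableAt_const w)]
    simp
  rw [← key, h1 v w, key, real_inner_comm]

lemma T_swap (H : SH n h) {y : Esp n} (hy : y ≠ 0) (v w : Esp n) :
    fderiv ℝ (hM h) y v w = fderiv ℝ (hM h) y w v := by
  have h1 : IsSymmSndFDerivAt ℝ (gradient h) y := (H.cdG hy).isSymmSndFDerivAt two_le_inf
  exact h1 v w

lemma dMv (H : SH n h) {y : Esp n} (hy : y ≠ 0) (w : Esp n) :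
    HasFDerivAt (fun z => hM h z w) ((fderiv ℝ (hM h) y).flip w) y := by
  have := (H.dM hy).clm_apply (hasFDerivAt_const w y)
  refine HasFDerivAt.congr_fderiv (f' := _) this ?_
  ext1 v; simp

lemma T_y (H : SH n h) {y : Esp n} (hy : y ≠ 0) (v : Esp n) : fderiv ℝ (hM h) y v y = - hM h y v := by
  have h1 := (H.dM hy).clm_apply (hasFDerivAt_id y)
  have h2 : HasFDerivAt (fun z => hM h z (id z)) (0 : Esp n →L[ℝ] Esp n) y := by
    apply (hasFDerivAt_const (0 : Esp n) y).congr_of_eventuallyEq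
    filter_upwards [isOpen_compl_singleton.mem_nhds hy] with z hz
    exact H.My hz
  have h3 := congrArg (fun A => A v) (h1.unique h2)
  simp at h3
  exact eq_neg_of_add_eq_zero_right h3

lemma T_sym (H : SH n h) {y : Esp n} (hy : y ≠ 0) (u v w : Esp n) :
    ⟪fderiv ℝ (hM h) y u v, w⟫ = ⟪v, fderiv ℝ (hM h) y u w⟫ := by
  have h1 : HasFDerivAt (fun z => ⟪hM h z v, w⟫)
      ((innerSL ℝ w).comp ((fderiv ℝ (hM h) y).flip v)) y := by
    apply ((innerSL ℝ w).hasFDerivAt.comp y (H.dMv hy v)).congr_of_eventuallyEq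
    filter_upwards with z
    simp [real_inner_comm]
  have h2 : HasFDerivAt (fun z => ⟪hM h z v, w⟫)
      ((innerSL ℝ v).comp ((fderiv ℝ (hM h) y).flip w)) y := by
    apply ((innerSL ℝ v).hasFDerivAt.comp y (H.dMv hy w)).congr_of_eventuallyEq
    filter_upwards [isOpen_compl_singleton.mem_nhds hy] with z hz
    simp [H.Msym hz v w]
  have h3 := congrArg (fun A => A u) (h1.unique h2)
  simpa [real_inner_comm] using h3

end SH

/-- smooth solution of the equation, with `C = 1/c` -/
structure Sol (n : ℕ) (C : ℝ) (h : Esp n → ℝ) : Prop extends SH n h where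
  spd : ∀ x : Esp n, ‖x‖ = 1 → SPD (hM h x + outer x x)
  eq : ∀ x : Esp n, ‖x‖ = 1 → dt (hM h x + outer x x)
    = C * Real.exp (‖gradient h x - h x • x‖ ^ 2 / 2)

lemma unit_ne {n : ℕ} {x : Esp n} (hx : ‖x‖ = 1) : x ≠ 0 := by
  rintro rfl; simp at hx

lemma inner_unit {n : ℕ} {x : Esp n} (hx : ‖x‖ = 1) : ⟪x, x⟫ = 1 := by
  rw [real_inner_self_eq_norm_sq, hx]; norm_num

lemma sol_of_hyp (n : ℕ) (c : ℝ) (hc : 0 < c)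
    (h 𝒦 : Esp n → ℝ)
    (hsm : ContDiffOn ℝ (⊤ : ℕ∞) h {(0 : Esp n)}ᶜ)
    (hhom : PosHom n h)
    (hconv : ∀ x ∈ sphere (0 : Esp n) 1, ∀ v : Esp n,
      ⟪v, x⟫ = 0 → v ≠ 0 → 0 < hessForm n h x v v)
    (hGauss : ∀ x ∈ sphere (0 : Esp n) 1, (𝒦 x)⁻¹ = sigmaElem n n h x)
    (heq : ∀ x ∈ sphere (0 : Esp n) 1,
      Real.exp (‖sphGrad n h x‖ ^ 2 / 2) * 𝒦 x = c) : Sol n c⁻¹ h := by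
  have H : SH n h := ⟨hsm, hhom⟩
  refine ⟨H, ?_, ?_⟩
  · intro x hx
    have hx0 := unit_ne hx
    have hxx := inner_unit hx
    refine ⟨fun v w => ?_, fun v hv => ?_⟩
    · simp only [cadd, outer_apply, inner_add_left, inner_add_right, H.Msym hx0,
        real_inner_smul_left, real_inner_smul_right]
      rw [real_inner_comm x v]; ring
    · set u := v - ⟪x, v⟫ • x with hu
      have hux : ⟪u, x⟫ = 0 := by
        rw [hu, inner_sub_left, real_inner_smul_left, hxx, real_inner_comm]; ring
      have hvu : v = u + ⟪x, v⟫ • x := by rw [hu]; abel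
      have hMv : hM h x v = hM h x u := by
        conv_lhs => rw [hvu]
        rw [map_add, map_smul, H.My hx0, smul_zero, add_zero]
      have e1 : ⟪(hM h x + outer x x) v, v⟫ = ⟪hM h x u, u⟫ + ⟪x, v⟫ ^ 2 := by
        rw [cadd, inner_add_left, H.Msym hx0, hMv, ← H.Msym hx0, hMv, outer_apply,
          real_inner_smul_left]
        ring
      rw [e1]
      by_cases h0 : u = 0
      · have : ⟪x, v⟫ ≠ 0 := by
          intro h1; rw [h1, h0] at hvu; simp at hvu; exact hv hvu
        rw [h0]; simp; positivity
      · have := hconv x (by simpa using hx) u hux h0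
        rw [H.hess hx0] at this
        positivity
  · intro x hx
    have hx0 := unit_ne hx
    have hmem : x ∈ sphere (0 : Esp n) 1 := by simpa using hx
    have h1 : hessMatrix n h x = mat (hM h x) := by
      ext i j
      rw [hessMatrix, Matrix.of_apply, H.hess hx0, mat_apply, H.Msym hx0]
    have h2 : sigmaElem n n h x = dt (hM h x + outer x x) := by
      rw [sigmaElem, h1, show n + 1 - n = 1 by omega, sigma_eq_det _ x (inner_unit hx) (H.My hx0)]
    rw [← h2, ← hGauss x hmem]
    have h3 := heq x hmem
    rw [sphGrad] at h3
    rw [← h3]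
    have : 𝒦 x ≠ 0 := by intro h0; rw [h0] at h3; simp at h3; exact hc.ne h3
    field_simp


section Sph
variable {n : ℕ}

/-- radial projection to the sphere -/
def nrm (y : Esp n) : Esp n := ‖y‖⁻¹ • y

lemma nrm_unit {x : Esp n} (hx : ‖x‖ = 1) : nrm x = x := by simp [nrm, hx]

lemma norm_nrm {y : Esp n} (hy : y ≠ 0) : ‖nrm y‖ = 1 := by
  rw [nrm, norm_smul, norm_inv, norm_norm, inv_mul_cancel₀ (norm_ne_zero_iff.mpr hy)]

lemma norm_smul_nrm {y : Esp n} (hy : y ≠ 0) : ‖y‖ • nrm y = y := by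
  rw [nrm, smul_smul, mul_inv_cancel₀ (norm_ne_zero_iff.mpr hy), one_smul]

lemma dnorm {y : Esp n} (hy : y ≠ 0) : HasFDerivAt (fun z : Esp n => ‖z‖) (innerSL ℝ (nrm y)) y := by
  have h0 : ‖y‖ ≠ 0 := norm_ne_zero_iff.mpr hy
  have h1 := ((hasStrictFDerivAt_norm_sq y).hasFDerivAt).sqrt (by positivity)
  have h2 : (fun z : Esp n => Real.sqrt (‖z‖ ^ 2)) = fun z => ‖z‖ := by
    ext z; exact Real.sqrt_sq (norm_nonneg z)
  rw [h2] at h1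
  refine h1.congr_fderiv ?_
  ext v
  rw [Real.sqrt_sq (norm_nonneg y)]
  simp [nrm, real_inner_smul_left]
  field_simp

lemma dnrm {y : Esp n} (hy : y ≠ 0) :
    HasFDerivAt (nrm : Esp n → Esp n) (‖y‖⁻¹ • (1 - outer (nrm y) (nrm y))) y := by
  have h0 : ‖y‖ ≠ 0 := norm_ne_zero_iff.mpr hy
  have h1 := (((hasDerivAt_inv h0).comp_hasFDerivAt y (dnorm hy)).smul (hasFDerivAt_id y))
  refine HasFDerivAt.congr_fderiv (f' := _) h1 ?_
  ext1 v
  simp [csub, csmul, cone, nrm, real_inner_smul_left, smul_smul, smul_sub]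
  rw [sub_eq_add_neg, ← neg_smul]
  congr 1
  rw [← neg_smul]
  congr 1
  field_simp

lemma cd_nrm {y : Esp n} (hy : y ≠ 0) {k : WithTop ℕ∞} : ContDiffAt ℝ k (nrm : Esp n → Esp n) y := by
  unfold nrm
  exact ((contDiffAt_norm ℝ hy).inv (norm_ne_zero_iff.mpr hy)).smul contDiffAt_id

/-- ambient expression of the spherical divergence -/
def sdiv (x : Esp n) (A : Esp n →L[ℝ] Esp n) : ℝ := tr A - ⟪x, A x⟫

lemma tr_smulRight (f : Esp n →L[ℝ] ℝ) (w : Esp n) : tr (f.smulRight w) = f w := by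
  have : f.smulRight w = outer ((InnerProductSpace.toDual ℝ (Esp n)).symm f) w := by
    ext1 v
    rw [outer_apply, InnerProductSpace.toDual_symm_apply]; rfl
  rw [this, tr_outer, InnerProductSpace.toDual_symm_apply]

lemma integral_div_zero (W : Esp n → Esp n) (hW : ContDiff ℝ 1 W) (hc : HasCompactSupport W) :
    ∫ y, tr (fderiv ℝ W y) = 0 := by
  have hcd : Continuous (fderiv ℝ W) := hW.continuous_fderiv (by simp)
  have hcs : HasCompactSupport (fderiv ℝ W) := hc.fderiv ℝ
  simp_rw [tr_eq_sum]
  rw [integral_finsetSum]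
  · apply Finset.sum_eq_zero
    intro i _
    set e : Esp n := EuclideanSpace.single i 1
    set g : Esp n → ℝ := fun y => ⟪e, W y⟫ with hg
    have hgf : ∀ y, HasFDerivAt g ((innerSL ℝ e).comp (fderiv ℝ W y)) y := fun y =>
      (innerSL ℝ e).hasFDerivAt.comp y ((hW.differentiable (by simp)) y).hasFDerivAt
    have hgc : HasCompactSupport g := by
      apply hc.comp_left (g := fun w => ⟪e, w⟫); simp
    have hgcont : Continuous g := by fun_prop
    have h1 : (fun y => fderiv ℝ g y e) = fun y => ⟪e, fderiv ℝ W y e⟫ := by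
      ext y; rw [(hgf y).fderiv]; simp
    have hInt : Integrable (fun y => ⟪e, fderiv ℝ W y e⟫) := by
      apply Continuous.integrable_of_hasCompactSupport
      · fun_prop
      · apply hcs.comp_left (g := fun A : Esp n →L[ℝ] Esp n => ⟪e, A e⟫); simp
    have h2 := integral_mul_fderiv_eq_neg_fderiv_mul_of_integrable (μ := volume)
      (f := fun _ : Esp n => (1 : ℝ)) (g := g) (v := e) (by simp)
      (by simp only [one_mul]; rw [h1]; exact hInt)
      (by simp only [one_mul]; exact hgcont.integrable_of_hasCompactSupport hgc)
      (fun x _ => differentiableAt_const _) (fun x _ => (hgf x).differentiableAt)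
    simp only [one_mul] at h2
    rw [h1] at h2
    rw [h2]; simp
  · intro i _
    apply Continuous.integrable_of_hasCompactSupport
    · fun_prop
    · apply hcs.comp_left (g := fun A : Esp n →L[ℝ] Esp n =>
        ⟪EuclideanSpace.single i (1 : ℝ), A (EuclideanSpace.single i 1)⟫); simp

lemma continuous_tr : Continuous (tr : (Esp n →L[ℝ] Esp n) → ℝ) := by
  have : (tr : (Esp n →L[ℝ] Esp n) → ℝ) = fun A =>
    ∑ i, ⟪EuclideanSpace.single i (1 : ℝ), A (EuclideanSpace.single i 1)⟫ := by
    ext A; exact tr_eq_sum A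
  rw [this]; fun_prop

/-- divergence theorem on the sphere, in the form we need -/
lemma sphere_div (V : Esp n → Esp n) (hV : ∀ x : Esp n, ‖x‖ = 1 → ContDiffAt ℝ 1 V x)
    (hT : ∀ x : Esp n, ‖x‖ = 1 → ⟪x, V x⟫ = 0)
    (hP : ∀ x : Esp n, ‖x‖ = 1 → 0 ≤ sdiv x (fderiv ℝ V x)) :
    ∀ x : Esp n, ‖x‖ = 1 → sdiv x (fderiv ℝ V x) = 0 := by
  let η : ContDiffBump (1 : ℝ) := ⟨1/4, 1/2, by norm_num, by norm_num⟩
  set W : Esp n → Esp n := fun y => η (‖y‖ ^ 2) • V (nrm y) with hWdef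
  have hηz : ∀ t : ℝ, t ≤ 1/2 → η t = 0 := by
    intro t ht
    apply η.zero_of_le_dist
    rw [Real.dist_eq, abs_of_nonpos (by linarith)]
    change (1/2 : ℝ) ≤ _
    linarith
  have hηz2 : ∀ t : ℝ, 2 ≤ t → η t = 0 := by
    intro t ht
    apply η.zero_of_le_dist
    rw [Real.dist_eq, abs_of_nonneg (by linarith)]
    change (1/2 : ℝ) ≤ _
    linarith
  have hη1 : η 1 = 1 := η.one_of_mem_closedBall (by simp [η.rIn_pos.le])
  have hW0 : ∀ᶠ y in nhds (0 : Esp n), W y = 0 := by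
    have : ContinuousAt (fun y : Esp n => ‖y‖ ^ 2) 0 := by fun_prop
    have := this.eventually (gt_mem_nhds (show ‖(0 : Esp n)‖ ^ 2 < 1/2 by simp))
    filter_upwards [this] with y hy
    rw [hWdef]; simp only; rw [hηz _ hy.le, zero_smul]
  have hW : ContDiff ℝ 1 W := by
    rw [contDiff_iff_contDiffAt]
    intro y
    by_cases hy : y = 0
    · subst hy
      exact (contDiffAt_const (c := (0 : Esp n))).congr_of_eventuallyEq hW0
    · have h1 : ContDiffAt ℝ 1 (fun y : Esp n => η (‖y‖ ^ 2)) y :=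
        (η.contDiff (n := 1)).contDiffAt.comp y (contDiff_norm_sq ℝ).contDiffAt
      exact h1.smul ((hV _ (norm_nrm hy)).comp y (cd_nrm hy))
  have hcW : HasCompactSupport W := by
    apply HasCompactSupport.intro (isCompact_closedBall (0 : Esp n) 2)
    intro y hy
    rw [hWdef]; simp only
    rw [hηz2, zero_smul]
    simp at hy
    nlinarith
  have hdiv0 : ∀ y, y ≠ 0 → tr (fderiv ℝ W y)
      = η (‖y‖ ^ 2) * ‖y‖⁻¹ * sdiv (nrm y) (fderiv ℝ V (nrm y)) := by
    intro y hy
    have hu := norm_nrm hy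
    have h1 : DifferentiableAt ℝ (fun y : Esp n => η (‖y‖ ^ 2)) y :=
      ((η.contDiff (n := 1)).contDiffAt.comp y
        (contDiff_norm_sq ℝ).contDiffAt).differentiableAt (by simp)
    have h1' : HasFDerivAt (fun y : Esp n => η (‖y‖ ^ 2))
        ((deriv η (‖y‖ ^ 2)) • (2 • innerSL ℝ y)) y := by
      have hd : HasDerivAt (fun t : ℝ => η t) (deriv η (‖y‖ ^ 2)) (‖y‖ ^ 2) :=
        (((η.contDiff (n := 1)).differentiable (by simp)) (‖y‖ ^ 2)).hasDerivAt
      exact HasDerivAt.comp_hasFDerivAt (h₂ := fun t : ℝ => η t) (f := fun z : Esp n => ‖z‖ ^ 2) y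
        hd (hasStrictFDerivAt_norm_sq y).hasFDerivAt
    have h2 := ((hV _ hu).differentiableAt (by simp)).hasFDerivAt.comp y (dnrm hy)
    have h3 := (h1'.smul h2).fderiv
    have h4 : fderiv ℝ W y = η (‖y‖ ^ 2) • ((fderiv ℝ V (nrm y)) *
        (‖y‖⁻¹ • (1 - outer (nrm y) (nrm y))))
        + ((deriv η (‖y‖ ^ 2)) • (2 • innerSL ℝ y)).smulRight (V (nrm y)) := h3
    rw [h4, tr_add, tr_smul, tr_smulRight, cmul_smul, tr_smul, mul_sub, mul_one, tr_sub,
      tr_mul_outer, sdiv]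
    have h5 : ⟪y, V (nrm y)⟫ = 0 := by
      conv_lhs => rw [← norm_smul_nrm hy]
      rw [real_inner_smul_left]
      have : nrm (‖y‖ • nrm y) = nrm y := by rw [norm_smul_nrm hy]
      rw [this, hT _ hu, mul_zero]
    simp [h5]
    ring
  have hnn : 0 ≤ fun y => tr (fderiv ℝ W y) := by
    intro y
    by_cases hy : y = 0
    · subst hy
      have : fderiv ℝ W 0 = 0 := by
        rw [Filter.EventuallyEq.fderiv_eq (f := fun _ => (0 : Esp n)) hW0]; simp
      simp only [this]
      simp [tr]
    · simp only [hdiv0 y hy]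
      have := hP _ (norm_nrm hy)
      have := η.nonneg' (‖y‖ ^ 2)
      simp only [Pi.zero_apply]
      positivity
  intro x hx
  by_contra hne
  have hcd : Continuous (fderiv ℝ W) := hW.continuous_fderiv (by simp)
  have hcs : HasCompactSupport (fderiv ℝ W) := hcW.fderiv ℝ
  have hpos := Continuous.integral_pos_of_hasCompactSupport_nonneg_nonzero (μ := volume) (x := x)
    (continuous_tr.comp hcd) (hcs.comp_left (g := tr) (by simp [tr])) hnn
    (by
      simp only [Function.comp]
      rw [hdiv0 x (unit_ne hx), nrm_unit hx, hx]
      simpa [hη1] using hne)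
  exact hpos.ne' (integral_div_zero W hW hcW)

end Sph


lemma tr_zero' {n : ℕ} : tr (0 : Esp n →L[ℝ] Esp n) = 0 := by simp [tr]

/-- shifted Hessian -/
def hS {n : ℕ} (h : Esp n → ℝ) (y : Esp n) : Esp n →L[ℝ] Esp n := hM h y + outer y y

/-- squared spherical gradient (on the sphere) -/
def s2 {n : ℕ} (h : Esp n → ℝ) (y : Esp n) : ℝ := ⟪gradient h y, gradient h y⟫ - h y ^ 2

lemma dOuter {n : ℕ} (y : Esp n) : ∃ L : Esp n →L[ℝ] (Esp n →L[ℝ] Esp n),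
    HasFDerivAt (fun z : Esp n => outer z z) L y ∧ ∀ v, L v = outer v y + outer y v := by
  have h1 : HasFDerivAt (fun z : Esp n => ContinuousLinearMap.smulRightL ℝ (Esp n) (Esp n) (innerSL ℝ z))
      ((ContinuousLinearMap.smulRightL ℝ (Esp n) (Esp n)).comp (innerSL ℝ)) y :=
    ((ContinuousLinearMap.smulRightL ℝ (Esp n) (Esp n)).comp (innerSL ℝ)).hasFDerivAt
  refine ⟨_, h1.clm_apply (hasFDerivAt_id y), fun v => ?_⟩
  ext1 w
  simp [add_comm]

lemma cdOuter {n : ℕ} (y : Esp n) {k : WithTop ℕ∞} : ContDiffAt ℝ k (fun z : Esp n => outer z z) y := by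
  let T : Esp n →L[ℝ] (Esp n →L[ℝ] (Esp n →L[ℝ] Esp n)) :=
    (ContinuousLinearMap.smulRightL ℝ (Esp n) (Esp n)).comp (innerSL ℝ)
  have h1 : ContDiff ℝ k T := by fun_prop
  exact (h1.clm_apply contDiff_id).contDiffAt

namespace Sol
variable {n : ℕ} {C : ℝ} {h : Esp n → ℝ}

lemma p_sq (H : Sol n C h) {x : Esp n} (hx : ‖x‖ = 1) : ‖gradient h x - h x • x‖ ^ 2 = s2 h x := by
  have hE := H.euler (unit_ne hx)
  rw [← real_inner_self_eq_norm_sq, s2, inner_sub_left, inner_sub_right, inner_sub_right,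
    real_inner_smul_left, real_inner_smul_left, real_inner_smul_right, real_inner_smul_right,
    inner_unit hx, real_inner_comm, hE]
  rw [real_inner_comm] at hE
  rw [hE]
  ring

lemma eqS (H : Sol n C h) {x : Esp n} (hx : ‖x‖ = 1) : dt (hS h x) = C * Real.exp (s2 h x / 2) := by
  rw [hS, H.eq x hx, H.p_sq hx]

lemma C_pos (H : Sol n C h) : 0 < C := by
  have hx : ‖(EuclideanSpace.single 0 1 : Esp n)‖ = 1 := by simp
  have := (H.spd _ hx).dt_pos
  rw [H.eq _ hx] at this
  exact pos_of_mul_pos_left this (Real.exp_pos _).le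

/-- inverse of the shifted Hessian -/
lemma exists_inv (H : Sol n C h) {x : Esp n} (hx : ‖x‖ = 1) : ∃ a : Esp n →L[ℝ] Esp n,
    a = Ring.inverse (hS h x) ∧ a * hS h x = 1 ∧ hS h x * a = 1 ∧
    (∀ v w, ⟪a v, w⟫ = ⟪v, a w⟫) ∧ a x = x ∧
    (∀ v, a (hM h x v) = v - ⟪x, v⟫ • x) ∧ (∀ v, hM h x (a v) = v - ⟪x, v⟫ • x) ∧
    tr (a * hM h x) = n := by
  have hx0 := unit_ne hx
  have hspd : SPD (hS h x) := H.spd x hx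
  have hu := hspd.isUnit
  have e1 : Ring.inverse (hS h x) * hS h x = 1 := Ring.inverse_mul_cancel _ hu
  have e2 : hS h x * Ring.inverse (hS h x) = 1 := Ring.mul_inverse_cancel _ hu
  set a := Ring.inverse (hS h x)
  have e1' : ∀ v, a (hS h x v) = v := fun v => by rw [← cmul, e1, cone]
  have e2' : ∀ v, hS h x (a v) = v := fun v => by rw [← cmul, e2, cone]
  have hsym : ∀ v w, ⟪a v, w⟫ = ⟪v, a w⟫ := by
    intro v w
    conv_lhs => rw [← e2' w]
    rw [← hspd.1, e2']
  have hSx : hS h x x = x := by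
    rw [hS, cadd, H.My hx0, outer_apply, inner_unit hx, one_smul, zero_add]
  have hax : a x = x := by
    conv_lhs => rw [← hSx]
    exact e1' x
  have hMs : ∀ v, hM h x v = hS h x v - ⟪x, v⟫ • x := by
    intro v; rw [hS, cadd, outer_apply]; abel
  have haM : ∀ v, a (hM h x v) = v - ⟪x, v⟫ • x := by
    intro v; rw [hMs, map_sub, e1', map_smul, hax]
  refine ⟨a, rfl, e1, e2, hsym, hax, haM, ?_, ?_⟩
  · intro v
    rw [hMs, e2', ← hsym, hax]
  · have : a * hM h x = 1 - outer x x := by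
      ext1 v; rw [cmul, haM, csub, cone, outer_apply]
    rw [this, tr_sub, tr_one, tr_outer, inner_unit hx]; push_cast; ring

lemma ds2 (H : Sol n C h) {x : Esp n} (hx : x ≠ 0) : HasFDerivAt (s2 h)
    (innerSL ℝ ((2 : ℝ) • hM h x (gradient h x) - (2 * h x) • gradient h x)) x := by
  have h1 := (H.dG hx).inner ℝ (H.dG hx)
  have h2 := (H.dh hx).pow 2
  refine HasFDerivAt.congr_fderiv (f' := _) (h1.sub h2) ?_
  ext v
  have e1 : ∀ u, fderiv ℝ h x u = ⟪gradient h x, u⟫ := fun u => by rw [(H.dh hx).fderiv]; rfl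
  simp [inner_sub_left, real_inner_smul_left, H.Msym hx]
  simp only [e1]
  rw [← H.Msym hx v, real_inner_comm]
  ring

/-- the differentiated equation -/
lemma dEq (H : Sol n C h) {x : Esp n} (hx : ‖x‖ = 1) (a : Esp n →L[ℝ] Esp n) (ha : a * hS h x = 1)
    (hax : a x = x) (hsym : ∀ v w, ⟪a v, w⟫ = ⟪v, a w⟫) (w : Esp n) (hw : ⟪x, w⟫ = 0) :
    tr (a * fderiv ℝ (hM h) x w) =
      ⟪hM h x (gradient h x), w⟫ - h x * ⟪gradient h x, w⟫ := by
  have hx0 := unit_ne hx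
  obtain ⟨L, hL, hLv⟩ := dOuter x
  have hdS : HasFDerivAt (hS h) (fderiv ℝ (hM h) x + L) x := (H.dM hx0).add hL
  -- trace as a continuous linear map
  let trL : (Esp n →L[ℝ] Esp n) →L[ℝ] ℝ :=
    ⟨{ toFun := fun A => tr (a * A)
       map_add' := fun A B => by rw [mul_add, tr_add]
       map_smul' := fun r A => by rw [cmul_smul, tr_smul]; rfl }, by
      change Continuous fun A => tr (a * A)
      exact continuous_tr.comp (continuous_const.mul continuous_id)⟩
  have htr : ∀ A, trL A = tr (a * A) := fun A => rfl
  have hN := dnrm hx0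
  rw [nrm_unit hx, hx, inv_one, one_smul] at hN
  have f1 : HasFDerivAt (fun y => trL (hS h (nrm y)))
      (trL.comp ((fderiv ℝ (hM h) x + L).comp (1 - outer x x))) x := by
    have hdS' : HasFDerivAt (hS h) (fderiv ℝ (hM h) x + L) (nrm x) := by
      rw [nrm_unit hx]; exact hdS
    exact trL.hasFDerivAt.comp x (hdS'.comp x hN)
  have f2 : HasFDerivAt (fun y => s2 h (nrm y))
      ((innerSL ℝ ((2 : ℝ) • hM h x (gradient h x) - (2 * h x) • gradient h x)).comp
        (1 - outer x x)) x := by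
    have hd' := H.ds2 hx0
    rw [← nrm_unit hx] at hd'
    have := hd'.comp x hN
    rw [nrm_unit hx] at this
    exact this
  have f3 := f1.sub (f2.const_smul (1/2 : ℝ))
  have hmin : IsLocalMin (fun y => trL (hS h (nrm y)) - (1/2 : ℝ) • s2 h (nrm y)) x := by
    filter_upwards [isOpen_compl_singleton.mem_nhds hx0] with y hy
    have hu := norm_nrm (n := n) hy
    have := trace_ineq (H.spd x hx) (H.spd _ hu) ha
    change _ + Real.log (dt (hS h (nrm y))) - Real.log (dt (hS h x)) ≤ tr (a * hS h (nrm y)) at this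
    rw [H.eqS hx, H.eqS hu, Real.log_mul H.C_pos.ne' (Real.exp_pos _).ne',
      Real.log_mul H.C_pos.ne' (Real.exp_pos _).ne', Real.log_exp, Real.log_exp] at this
    rw [nrm_unit hx, htr, htr, ha, tr_one, smul_eq_mul, smul_eq_mul]
    linarith
  have f4 := hmin.hasFDerivAt_eq_zero f3
  have f5 := congrArg (fun A => A w) f4
  have hPw : (1 - outer x x) w = w := by rw [csub, cone, outer_apply, hw, zero_smul, sub_zero]
  have f6 : trL ((fderiv ℝ (hM h) x + L) w) - (1/2 : ℝ) *
      ⟪(2 : ℝ) • hM h x (gradient h x) - (2 * h x) • gradient h x, w⟫ = 0 := by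
    conv_lhs => rw [← hPw]
    exact f5
  have f7 : (fderiv ℝ (hM h) x + L) w = fderiv ℝ (hM h) x w + L w := rfl
  rw [f7, hLv, htr, mul_add, mul_add, tr_add, tr_add, tr_mul_outer, tr_mul_outer, hax,
    ← hsym, hax, hw, real_inner_comm, hw, inner_sub_left, real_inner_smul_left,
    real_inner_smul_left] at f6
  linarith

end Sol


section
variable {n : ℕ}
lemma sdiv_add (x : Esp n) (A B : Esp n →L[ℝ] Esp n) : sdiv x (A + B) = sdiv x A + sdiv x B := by
  rw [sdiv, sdiv, sdiv, tr_add, cadd, inner_add_right]; ring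
lemma sdiv_sub (x : Esp n) (A B : Esp n →L[ℝ] Esp n) : sdiv x (A - B) = sdiv x A - sdiv x B := by
  rw [sdiv, sdiv, sdiv, tr_sub, csub, inner_sub_right]; ring
lemma sdivS (x : Esp n) (r : ℝ) (B : Esp n →L[ℝ] Esp n) : sdiv x (r • B) = r * sdiv x B := by
  rw [sdiv, sdiv, tr_smul, csmul, real_inner_smul_right]; ring
lemma sdiv_outer (x v w : Esp n) : sdiv x (outer v w) = ⟪v, w⟫ - ⟪v, x⟫ * ⟪x, w⟫ := by
  rw [sdiv, tr_outer, outer_apply, real_inner_smul_right]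
end

/-- inverse Hessian applied to gradient -/
def gA {n : ℕ} (h : Esp n → ℝ) (y : Esp n) : Esp n := Ring.inverse (hS h y) (gradient h y)

namespace Sol
variable {n : ℕ} {C : ℝ} {h : Esp n → ℝ}

lemma cd_inv (H : Sol n C h) {x : Esp n} (hx : ‖x‖ = 1) : ContDiffAt ℝ ∞ (fun y => Ring.inverse (hS h y)) x := by
  have hspd : SPD (hS h x) := H.spd x hx
  obtain ⟨u, hu⟩ := hspd.isUnit
  have h1 : ContDiffAt ℝ ∞ (hS h) x := (H.cdM (unit_ne hx)).add (cdOuter x)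
  have h2 : ContDiffAt ℝ ∞ (Ring.inverse : (Esp n →L[ℝ] Esp n) → _) (hS h x) := by
    rw [← hu]; exact contDiffAt_ringInverse ℝ u
  exact h2.comp x h1

lemma cd_gA (H : Sol n C h) {x : Esp n} (hx : ‖x‖ = 1) : ContDiffAt ℝ ∞ (gA h) x :=
  (H.cd_inv hx).clm_apply (H.cdG (unit_ne hx))

lemma d_gA (H : Sol n C h) {x : Esp n} (hx : ‖x‖ = 1) (a : Esp n →L[ℝ] Esp n) (haI : a = Ring.inverse (hS h x))
    (ha : a * hS h x = 1) (ha' : hS h x * a = 1)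
    (hax : a x = x) (hsym : ∀ v w, ⟪a v, w⟫ = ⟪v, a w⟫) :
    HasFDerivAt (gA h) (a * hM h x - a * fderiv ℝ (hM h) x (gA h x) - outer (gA h x) x - h x • a) x := by
  have hx0 := unit_ne hx
  obtain ⟨L, hL, hLv⟩ := dOuter x
  have hdS : HasFDerivAt (hS h) (fderiv ℝ (hM h) x + L) x := (H.dM hx0).add hL
  have hg : gA h x = a (gradient h x) := by rw [gA, haI]
  have hD := ((H.cd_gA hx).differentiableAt (by simp)).hasFDerivAt
  set D := fderiv ℝ (gA h) x
  have h3 := hdS.clm_apply hD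
  have h4 : HasFDerivAt (gradient h) (((hS h x).comp D + (fderiv ℝ (hM h) x + L).flip (gA h x))) x := by
    apply h3.congr_of_eventuallyEq
    have hun : ∀ᶠ y in nhds x, IsUnit (hS h y) := by
      have hspd : SPD (hS h x) := H.spd x hx
      obtain ⟨u, hu⟩ := hspd.isUnit
      apply hdS.continuousAt.eventually
      rw [← hu]; exact Units.nhds u
    filter_upwards [hun] with y hy
    have e1 : hS h y * Ring.inverse (hS h y) = 1 := Ring.mul_inverse_cancel _ hy
    rw [gA, ← cmul, e1, cone]
  have h5 := h4.unique (H.dG hx0)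
  have h6 : ∀ v, hS h x (D v) + (fderiv ℝ (hM h) x v (gA h x) + L v (gA h x)) = hM h x v := by
    intro v; exact congrArg (fun A : Esp n →L[ℝ] Esp n => A v) h5
  have e3 : ⟪x, gA h x⟫ = h x := by rw [hg, ← hsym, hax, real_inner_comm, H.euler hx0]
  refine HasFDerivAt.congr_fderiv (f' := _) hD ?_
  ext1 v
  have h7 : D v = a (hS h x (D v)) := by rw [← cmul, ha, cone]
  rw [h7, eq_sub_of_add_eq (h6 v), csub, csub, csub, cmul, cmul, outer_apply, csmul]
  rw [hLv, cadd, outer_apply, outer_apply, H.T_swap hx0]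
  rw [e3, map_sub, map_add, map_add, map_smul, map_smul, hax, real_inner_comm]
  abel

/-- the vector field whose divergence is computed -/
lemma Vdiv (H : Sol n C h) (b : ℝ) (θ θ' : ℝ → ℝ) (hθ : ContDiff ℝ ∞ θ) (hθ' : ∀ s, HasDerivAt θ (θ' s) s)
    (V : Esp n → Esp n)
    (hV : V = fun y => Real.exp (-(b * h y ^ 2 / 2)) • ((gradient h y - h y • y) -
      θ (s2 h y) • (gA h y - h y • y))) {x : Esp n} (hx : ‖x‖ = 1)
    (a : Esp n →L[ℝ] Esp n) (haI : a = Ring.inverse (hS h x))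
    (ha : a * hS h x = 1) (ha' : hS h x * a = 1)
    (hax : a x = x) (hsym : ∀ v w, ⟪a v, w⟫ = ⟪v, a w⟫) (haM : ∀ v, a (hM h x v) = v - ⟪x, v⟫ • x)
    (hMa : ∀ v, hM h x (a v) = v - ⟪x, v⟫ • x) (htr : tr (a * hM h x) = n)
    (α : ℝ) (hα : α = ⟪a (gradient h x - h x • x), gradient h x - h x • x⟫) :
    ContDiffAt ℝ 1 V x ∧ ⟪x, V x⟫ = 0 ∧ sdiv x (fderiv ℝ V x) = Real.exp (-(b * h x ^ 2 / 2)) *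
      (tr (hM h x) - h x * n - θ' (s2 h x) * (2 * s2 h x - 2 * h x * α)
        - θ (s2 h x) * (n - s2 h x + h x * α - h x * (tr a - 1))
        - b * h x * (s2 h x - θ (s2 h x) * α)) := by
  have hx0 := unit_ne hx
  have hxx := inner_unit hx
  have hg : gA h x = a (gradient h x) := by rw [gA, haI]
  have hE : ⟪gradient h x, x⟫ = h x := H.euler hx0
  have hE' : ⟪x, gradient h x⟫ = h x := by rw [real_inner_comm, hE]
  have hxg : ⟪x, gA h x⟫ = h x := by rw [hg, ← hsym, hax, hE']
  have hgx : ⟪gA h x, x⟫ = h x := by rw [real_inner_comm, hxg]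
  have hGg : ⟪gradient h x, gA h x⟫ = α + h x ^ 2 := by
    rw [hα, map_sub, map_smul, hax, inner_sub_left, inner_sub_right, inner_sub_right,
      real_inner_smul_left, real_inner_smul_left, real_inner_smul_right, real_inner_smul_right,
      hxx, ← hg, hgx, hE', real_inner_comm]
    ring
  have hMx : hM h x x = 0 := H.My hx0
  have hMg : hM h x (gA h x) = gradient h x - h x • x := by rw [hg, hMa, hE']
  have hGG : ⟪gradient h x, gradient h x⟫ = s2 h x + h x ^ 2 := by rw [s2]; ring
  -- smoothness
  have cs2 : ContDiffAt ℝ ∞ (s2 h) x := by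
    have := ((H.cdG hx0).inner ℝ (H.cdG hx0)).sub ((H.cd hx0).pow 2)
    exact this
  have cV : ContDiffAt ℝ ∞ V x := by
    rw [hV]
    have c1 : ContDiffAt ℝ ∞ (fun y => Real.exp (-(b * h y ^ 2 / 2))) x := by
      apply ContDiffAt.exp
      have := H.cd hx0
      exact ((contDiffAt_const.mul (this.pow 2)).div_const 2).neg
    have c2 : ContDiffAt ℝ ∞ (fun y => h y • y) x := (H.cd hx0).smul contDiffAt_id
    exact c1.smul (((H.cdG hx0).sub c2).sub
      ((hθ.contDiffAt.comp x cs2).smul ((H.cd_gA hx).sub c2)))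
  refine ⟨cV.of_le (by exact_mod_cast le_top), ?_, ?_⟩
  · rw [hV]
    simp only [real_inner_smul_right, inner_sub_right, hE', hxg, hxx]
    ring
  -- derivative
  have d1 : HasFDerivAt (fun y => Real.exp (-(b * h y ^ 2 / 2)))
      ((-(b * h x) * Real.exp (-(b * h x ^ 2 / 2))) • innerSL ℝ (gradient h x)) x := by
    have s1 : HasDerivAt (fun t : ℝ => Real.exp (-(b * t ^ 2 / 2)))
      (-(b * h x) * Real.exp (-(b * h x ^ 2 / 2))) (h x) := by
      have h0 : HasDerivAt (fun t : ℝ => -(b * t ^ 2 / 2)) (-(b * h x)) (h x) := by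
        have := (((hasDerivAt_pow 2 (h x)).const_mul b).div_const 2).neg
        refine HasDerivAt.congr_deriv this ?_
        simp; ring
      have := h0.exp
      rwa [mul_comm] at this
    exact s1.comp_hasFDerivAt x (H.dh hx0)
  have d2 : HasFDerivAt (fun y => h y • y) (h x • (1 : Esp n →L[ℝ] Esp n) + outer (gradient h x) x) x := by
    have := (H.dh hx0).smul (hasFDerivAt_id x)
    exact this
  have d3 : HasFDerivAt (fun y => θ (s2 h y)) (θ' (s2 h x) • innerSL ℝ ((2 : ℝ) • hM h x (gradient h x) - (2 * h x) • gradient h x)) x :=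
    (hθ' (s2 h x)).comp_hasFDerivAt x (H.ds2 hx0)
  have d4 := H.d_gA hx a haI ha ha' hax hsym
  have d5 := d1.smul (((H.dG hx0).sub d2).sub (d3.smul (d4.sub d2)))
  set N := ((2 : ℝ) • hM h x (gradient h x) - (2 * h x) • gradient h x) with hN
  set W := (gradient h x - h x • x) - θ (s2 h x) • (gA h x - h x • x) with hW
  have d6 : fderiv ℝ V x = Real.exp (-(b * h x ^ 2 / 2)) • (hM h x - (h x • (1 : Esp n →L[ℝ] Esp n) + outer (gradient h x) x)
     - (θ (s2 h x) • ((a * hM h x - a * fderiv ℝ (hM h) x (gA h x) - outer (gA h x) x - h x • a) - (h x • (1 : Esp n →L[ℝ] Esp n) + outer (gradient h x) x))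
       + θ' (s2 h x) • outer N (gA h x - h x • x))) + (-(b * h x) * Real.exp (-(b * h x ^ 2 / 2))) • outer (gradient h x) W := by
    rw [hV]
    refine d5.fderiv.trans ?_
    ext1 v
    simp only [cadd, csmul, csub, outer_apply]
    rw [smul_smul, smul_smul]
    rfl
  -- sdiv pieces
  have p1 : sdiv x (hM h x) = tr (hM h x) := by rw [sdiv, hMx, inner_zero_right, sub_zero]
  have p2 : sdiv x (1 : Esp n →L[ℝ] Esp n) = n := by
    rw [sdiv, tr_one, cone, hxx]; push_cast; ring
  have p3 : sdiv x (a * hM h x) = n := by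
    rw [sdiv, htr, cmul, hMx, map_zero, inner_zero_right, sub_zero]
  have p5 : sdiv x a = tr a - 1 := by rw [sdiv, hax, hxx]
  have hT : fderiv ℝ (hM h) x x = - hM h x := by
    ext1 v; rw [H.T_swap hx0, H.T_y hx0]; rfl
  have p4 : sdiv x (a * fderiv ℝ (hM h) x (gA h x)) = s2 h x - h x * α - n * h x := by
    have e0 : gA h x = (gA h x - h x • x) + h x • x := by abel
    have e1 := H.dEq hx a ha hax hsym (gA h x - h x • x) (by
      rw [inner_sub_right, hxg, real_inner_smul_right, hxx]; ring)
    have e2 : ⟪x, (a * fderiv ℝ (hM h) x (gA h x)) x⟫ = 0 := by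
      rw [cmul, H.T_y hx0, map_neg, inner_neg_right, ← hsym, hax, ← H.Msym hx0, hMx,
        inner_zero_left, neg_zero]
    have e3 : fderiv ℝ (hM h) x (gA h x) = fderiv ℝ (hM h) x (gA h x - h x • x) - h x • hM h x := by
      rw [map_sub, map_smul, hT, smul_neg]; abel
    rw [sdiv, e2, e3, mul_sub, tr_sub, e1, cmul_smul, tr_smul, htr, H.Msym hx0, map_sub, map_smul,
      hMx, hMg, inner_sub_right, inner_sub_right, inner_sub_right, real_inner_smul_right,
      real_inner_smul_right, hE, hGG, hGg]
    rw [inner_zero_right]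
    ring
  have p6 : ⟪N, gA h x - h x • x⟫ = 2 * s2 h x - 2 * h x * α := by
    rw [hN, inner_sub_left, real_inner_smul_left, real_inner_smul_left, H.Msym hx0, map_sub,
      map_smul, hMx, hMg, smul_zero, sub_zero, inner_sub_right, inner_sub_right,
      real_inner_smul_right, hE, hGG, hGg]
    ring
  have p7 : ⟪x, gA h x - h x • x⟫ = 0 := by
    rw [inner_sub_right, hxg, real_inner_smul_right, hxx]; ring
  have p8 : ⟪x, W⟫ = 0 := by
    rw [hW, inner_sub_right, real_inner_smul_right, p7, inner_sub_right, hE',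
      real_inner_smul_right, hxx]; ring
  have p9 : ⟪gradient h x, W⟫ = s2 h x - θ (s2 h x) * α := by
    rw [hW, inner_sub_right, real_inner_smul_right, inner_sub_right, inner_sub_right, hGG, hGg,
      real_inner_smul_right, hE]; ring
  rw [d6]
  simp only [sdiv_add, sdiv_sub, sdivS, sdiv_outer, p1, p2, p3, p4, p5, p6, p7, p8, p9, hE, hxx, hgx]
  ring

end Sol


lemma scal_ineq (n : ℕ) (hn : 2 ≤ n) (X κ : ℝ) (hX : 0 ≤ X) (hκ : κ = ((n : ℝ) + 2) / (n + 4)) :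
    (1 + (n + 2) * X / n) ^ n ≤ (1 + X + κ * X ^ 2) ^ (n - 1) * (1 + 3 * X + 5 * κ * X ^ 2) := by
  obtain ⟨k, rfl⟩ := Nat.exists_eq_add_of_le hn
  have e : 2 + k - 1 = k + 1 := by omega
  rw [e, show 2 + k = k + 2 by omega] at *
  set N : ℝ := ((k + 2 : ℕ) : ℝ) with hN
  have hN2 : 2 ≤ N := by rw [hN]; push_cast; linarith [(Nat.cast_nonneg k : (0:ℝ) ≤ k)]
  have hκ0 : 0 < κ := by rw [hκ]; positivity
  set μ := 1 + (N + 2) * X / N with hμ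
  have hμ0 : 0 < μ := by positivity
  set q := 1 + X + κ * X ^ 2 with hq
  have hq0 : 0 < q := by positivity
  have hB := one_add_mul_le_pow (a := q / μ - 1) (by
    have : 0 < q / μ := by positivity
    linarith) (k + 1)
  have e1 : 1 + (q / μ - 1) = q / μ := by ring
  rw [e1, div_pow, le_div_iff₀ (by positivity)] at hB
  have e2 : (1 + ((k + 1 : ℕ) : ℝ) * (q / μ - 1)) * μ ^ (k + 1) = (μ + (N - 1) * (q - μ)) * μ ^ k := by
    rw [hN]; push_cast; field_simp; ring
  rw [e2] at hB
  have hpar : 0 < 1 + 3 * X + 5 * κ * X ^ 2 := by positivity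
  have key : μ ^ 2 ≤ (μ + (N - 1) * (q - μ)) * (1 + 3 * X + 5 * κ * X ^ 2) := by
    have hk : κ * (N + 4) = N + 2 := by rw [hκ]; field_simp
    have e3 : (μ + (N - 1) * (q - μ)) = 1 + (4 / N - 1) * X + (N - 1) * κ * X ^ 2 := by
      rw [hμ, hq]; field_simp; ring
    have e4 : (1 + (4 / N - 1) * X + (N - 1) * κ * X ^ 2) * (1 + 3 * X + 5 * κ * X ^ 2) - μ ^ 2
      = (N - 2 + 8 / N - 4 / N ^ 2) * X ^ 2 + κ * (3 * N - 8 + 20 / N) * X ^ 3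
        + 5 * (N - 1) * κ ^ 2 * X ^ 4 := by
      have : N - 2 + 8 / N - 4 / N ^ 2 = κ * (N + 4) + 12 / N - 3 - (1 + 2 / N) ^ 2 := by
        rw [hk]; field_simp; ring
      rw [this, hμ]; field_simp; ring
    have c2 : 0 ≤ N - 2 + 8 / N - 4 / N ^ 2 := by
      have : 4 / N ^ 2 ≤ 8 / N := by
        rw [div_le_div_iff₀ (by positivity) (by positivity)]
        nlinarith
      linarith
    have c3 : 0 ≤ 3 * N - 8 + 20 / N := by
      have : 3 * N - 8 + 20 / N = (3 * N ^ 2 - 8 * N + 20) / N := by field_simp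
      rw [this]; apply div_nonneg _ (by linarith)
      nlinarith [sq_nonneg (N - 1)]
    have c4 : 0 ≤ N - 1 := by linarith
    have : 0 ≤ (N - 2 + 8 / N - 4 / N ^ 2) * X ^ 2 + κ * (3 * N - 8 + 20 / N) * X ^ 3
        + 5 * (N - 1) * κ ^ 2 * X ^ 4 := by positivity
    rw [e3]; linarith
  calc μ ^ (k + 2) = μ ^ k * μ ^ 2 := by ring
    _ ≤ μ ^ k * ((μ + (N - 1) * (q - μ)) * (1 + 3 * X + 5 * κ * X ^ 2)) := by gcongr
    _ = ((μ + (N - 1) * (q - μ)) * μ ^ k) * (1 + 3 * X + 5 * κ * X ^ 2) := by ring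
    _ ≤ _ := by gcongr

lemma SPD.smul {n : ℕ} {A : Esp n →L[ℝ] Esp n} (hA : SPD A) {r : ℝ} (hr : 0 < r) : SPD (r • A) := by
  refine ⟨fun v w => ?_, fun v hv => ?_⟩
  · rw [csmul, csmul, real_inner_smul_left, real_inner_smul_right, hA.1]
  · rw [csmul, real_inner_smul_left]; exact mul_pos hr (hA.2 v hv)

lemma SPD_one {n : ℕ} : SPD (1 : Esp n →L[ℝ] Esp n) := by
  refine ⟨fun v w => rfl, fun v hv => ?_⟩
  rw [cone]; exact real_inner_self_pos.2 hv

lemma SPD_T {n : ℕ} (x p : Esp n) (hx : ‖x‖ = 1) (q q' μ : ℝ) (hq : 0 < q) (hq' : 0 ≤ q')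
    (hμ : 0 < μ) :
    SPD (q • (1 : Esp n →L[ℝ] Esp n) + q' • outer p p + (μ - q) • outer x x) := by
  refine ⟨fun v w => ?_, fun v hv => ?_⟩
  · simp only [cadd, csmul, cone, outer_apply, inner_add_left, inner_add_right,
      real_inner_smul_left, real_inner_smul_right]
    rw [real_inner_comm v p, real_inner_comm v x]; ring
  · simp only [cadd, csmul, cone, outer_apply, inner_add_left, 
      real_inner_smul_left]
    have h1 : 0 < ⟪v, v⟫ := real_inner_self_pos.2 hv
    have h2 : ⟪x, v⟫ * ⟪x, v⟫ ≤ ⟪x, x⟫ * ⟪v, v⟫ := real_inner_mul_inner_self_le x v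
    rw [inner_unit hx, one_mul] at h2
    have h3 : 0 ≤ q' * (⟪p, v⟫ * ⟪p, v⟫) := mul_nonneg hq' (mul_self_nonneg _)
    have h4 : 0 ≤ q * (⟪v, v⟫ - ⟪x, v⟫ * ⟪x, v⟫) := mul_nonneg hq.le (by linarith)
    by_cases h0 : ⟪x, v⟫ = 0
    · rw [h0]; have := mul_pos hq h1; linarith
    · have : 0 < μ * (⟪x, v⟫ * ⟪x, v⟫) := mul_pos hμ (mul_self_pos.2 h0)
      linarith

namespace Sol
variable {n : ℕ} {C : ℝ} {h : Esp n → ℝ}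

lemma spd_tau (H : Sol n C h) {x : Esp n} (hx : ‖x‖ = 1) {τ : ℝ} (hτ : 0 < τ) : SPD (hM h x + τ • outer x x) := by
  have hx0 := unit_ne hx
  refine ⟨fun v w => ?_, fun v hv => ?_⟩
  · simp only [cadd, csmul, outer_apply, inner_add_left, inner_add_right,
      real_inner_smul_left, real_inner_smul_right]
    rw [H.Msym hx0, real_inner_comm v x]; ring
  · have h2 := (H.spd x hx).2 (v + ((Real.sqrt τ - 1) * ⟪x, v⟫) • x) (by
      intro h0
      have h1 := congrArg (fun z => ⟪x, z⟫) h0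
      simp only [inner_add_right, real_inner_smul_right, inner_unit hx, inner_zero_right] at h1
      have h3 : Real.sqrt τ * ⟪x, v⟫ = 0 := by linarith
      have h4 : ⟪x, v⟫ = 0 := (mul_eq_zero.1 h3).resolve_left (Real.sqrt_pos.2 hτ).ne'
      rw [h4, mul_zero, zero_smul, add_zero] at h0
      exact hv h0)
    simp only [cadd, csmul, outer_apply, inner_add_left, inner_add_right, map_add, map_smul,
      real_inner_smul_left, real_inner_smul_right, H.My hx0, inner_unit hx, inner_zero_left,
      H.Msym hx0 v x, inner_zero_right] at h2 ⊢
    have h5 := Real.sq_sqrt hτ.le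
    rw [real_inner_comm v x] at *
    nlinarith

lemma tr_ge (H : Sol n C h) {x : Esp n} (hx : ‖x‖ = 1) {τ : ℝ} (hτ : 0 < τ) (hσ : dt (hS h x) = τ ^ n) :
    n * τ ≤ tr (hM h x) := by
  have h1 := trace_ineq (A := τ • (1 : Esp n →L[ℝ] Esp n)) (a := τ⁻¹ • (1 : Esp n →L[ℝ] Esp n))
    (SPD_one.smul hτ) (H.spd_tau hx hτ) (by
      ext1 v; rw [cmul, csmul, csmul, cone, cone, smul_smul, inv_mul_cancel₀ hτ.ne', one_smul])
  have h2 : dt (1 : Esp n →L[ℝ] Esp n) = 1 := by simp [dt]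
  rw [dt_tau _ _ _ (inner_unit hx) (H.My (unit_ne hx)), dt_smul, h2] at h1
  change _ + Real.log (τ * dt (hS h x)) - _ ≤ _ at h1
  rw [hσ, ← pow_succ', mul_one, csmul_mul, one_mul, tr_smul, tr_add, tr_smul, tr_outer, inner_unit hx] at h1
  have h3 : τ⁻¹ * (tr (hM h x) + τ * 1) = tr (hM h x) / τ + 1 := by field_simp
  rw [h3] at h1
  push_cast at h1
  have h4 : (n : ℝ) ≤ tr (hM h x) / τ := by linarith
  rwa [le_div_iff₀ hτ] at h4

lemma second_ge (H : Sol n C h) {x : Esp n} (hx : ‖x‖ = 1) {τ : ℝ} (hτ : 0 < τ) (hσ : dt (hS h x) = τ ^ n)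
    (hn : 1 ≤ n) (a : Esp n →L[ℝ] Esp n) 
    (ha : a * hS h x = 1) (hax : a x = x) (hsym : ∀ v w, ⟪a v, w⟫ = ⟪v, a w⟫) 
    (haM : ∀ v, a (hM h x v) = v - ⟪x, v⟫ • x)
    (α : ℝ) (hα : α = ⟪a (gradient h x - h x • x), gradient h x - h x • x⟫)
    (q q' μ : ℝ) (hq : 0 < q) (hq' : 0 ≤ q') (hμ : 0 < μ)
    (hqm : μ ^ n ≤ q ^ (n - 1) * (q + q' * s2 h x)) :
    n * μ ≤ τ * (q * (tr a - 1) + q' * α) := by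
  set p := gradient h x - h x • x with hp
  have hx0 := unit_ne hx
  have hxx := inner_unit hx
  have hps : ⟪p, p⟫ = s2 h x := by rw [real_inner_self_eq_norm_sq, H.p_sq hx]
  have hpx : ⟪p, x⟫ = 0 := by
    rw [hp, inner_sub_left, real_inner_smul_left, H.euler hx0, hxx]; ring
  have hs0 : 0 ≤ s2 h x := by rw [← hps]; exact real_inner_self_nonneg
  set u := μ / τ with hu
  have hu0 : 0 < u := by positivity
  have hut : μ / u = τ := by rw [hu]; field_simp
  have h1 := trace_ineq (A := u • (hM h x + τ • outer x x))
    (a := u⁻¹ • (a - outer x x) + μ⁻¹ • outer x x)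
    ((H.spd_tau hx hτ).smul hu0) (SPD_T x p hx q q' μ hq hq' hμ) (by
      ext1 v
      simp only [cmul, csmul, csub, cadd, outer_apply, map_add, map_smul, hax, haM, inner_add_right,
        real_inner_smul_right, hxx, cone]
      have : ⟪x, hM h x v⟫ = 0 := by rw [← H.Msym hx0, H.My hx0, inner_zero_left]
      rw [this]
      have hut : u * τ = μ := by rw [hu]; field_simp
      rw [← hut]
      match_scalars <;> field_simp <;> ring)
  rw [dt_outer2 x p q q' (μ - q) hq.ne' hxx hpx, dt_smul,
    dt_tau _ _ _ hxx (H.My hx0)] at h1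
  change _ - Real.log (_ * (_ * dt (hS h x))) ≤ _ at h1
  have e1 : u ^ (n + 1) * (τ * dt (hS h x)) = μ ^ (n + 1) := by
    rw [hσ, ← pow_succ', ← mul_pow, hu]; congr 1; field_simp
  obtain ⟨k, rfl⟩ := Nat.exists_eq_add_of_le' hn
  have e2 : q ^ (k + 1 + 1) * (1 + q' / q * ⟪p, p⟫) * (1 + (μ - q) / q) = μ * (q ^ k * (q + q' * s2 h x)) := by
    rw [hps]; field_simp; ring
  rw [e1, e2] at h1
  rw [Nat.add_sub_cancel] at hqm
  have e3 : Real.log (μ ^ (k + 1 + 1)) ≤ Real.log (μ * (q ^ k * (q + q' * s2 h x))) := by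
    apply Real.log_le_log (by positivity)
    rw [pow_succ' μ (k+1)]; gcongr
  have e4 : tr ((u⁻¹ • (a - outer x x) + μ⁻¹ • outer x x) *
      (q • (1 : Esp (k+1) →L[ℝ] Esp (k+1)) + q' • outer p p + (μ - q) • outer x x)) = 
      (q * (tr a - 1) + q' * α) / u + 1 := by
    have hxp : ⟪x, p⟫ = 0 := by rw [real_inner_comm, hpx]
    have hpa : ⟪p, a p⟫ = α := by rw [hα, real_inner_comm]
    simp only [add_mul, sub_mul, mul_add, csmul_mul, cmul_smul, tr_add, tr_smul, tr_sub, tr_mul_outer, mul_one,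
      tr_outer, hxx, hxp, hax, outer_apply, hpa, zero_smul, inner_zero_right, one_smul]
    field_simp; ring
  rw [e4] at h1
  have h2 : ((k + 1 : ℕ) : ℝ) ≤ (q * (tr a - 1) + q' * α) / u := by
    push_cast at h1 ⊢; linarith
  rw [le_div_iff₀ hu0, hu] at h2
  have h3 := mul_le_mul_of_nonneg_left h2 hτ.le
  have e5 : τ * (((k + 1 : ℕ) : ℝ) * (μ / τ)) = ((k + 1 : ℕ) : ℝ) * μ := by field_simp
  rw [e5] at h3
  exact h3

theorem part2 (H : Sol n C h) (hn : 2 ≤ n) (hpos : ∀ x : Esp n, ‖x‖ = 1 → 0 ≤ h x) :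
    ∀ x : Esp n, ‖x‖ = 1 → s2 h x = 0 := by
  have hn0 : (0 : ℝ) < n := by exact_mod_cast (by omega : 0 < n)
  have hn2 : (2 : ℝ) ≤ n := by exact_mod_cast hn
  obtain ⟨R, hR0, hR⟩ : ∃ R : ℝ, 0 < R ∧ R ^ n = C :=
    ⟨C ^ ((n : ℝ)⁻¹), Real.rpow_pos_of_pos H.C_pos _, Real.rpow_inv_natCast_pow H.C_pos.le (by omega)⟩
  set N : ℝ := (n : ℝ) with hN
  obtain ⟨b, hb⟩ : ∃ b : ℝ, b = 1 - 1 / N := ⟨_, rfl⟩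
  have hb0 : 0 < b := by
    rw [hb, sub_pos, div_lt_one hn0]; linarith
  obtain ⟨k, hk⟩ : ∃ k : ℝ, k = b / (N + 2) := ⟨_, rfl⟩
  have hk0 : 0 < k := by rw [hk]; positivity
  obtain ⟨κ, hκ⟩ : ∃ κ : ℝ, κ = (N + 2) / (N + 4) := ⟨_, rfl⟩
  have hκ0 : 0 < κ := by rw [hκ]; positivity
  set θ : ℝ → ℝ := fun s => R * Real.exp (s / (2 * N)) * (1 + k * s + κ * (k * s) ^ 2) with hθ
  set θ' : ℝ → ℝ := fun s => R * Real.exp (s / (2 * N)) * ((1 + k * s + κ * (k * s) ^ 2) / (2 * N)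
    + k * (1 + 2 * κ * (k * s))) with hθ'
  have cθ : ContDiff ℝ ∞ θ := by
    rw [hθ]; fun_prop
  have dθ : ∀ s, HasDerivAt θ (θ' s) s := by
    intro s
    have a1 : HasDerivAt (fun s : ℝ => Real.exp (s / (2 * N))) (Real.exp (s / (2 * N)) * (1 / (2 * N))) s :=
      ((hasDerivAt_id s).div_const (2 * N)).exp
    have a2 : HasDerivAt (fun s : ℝ => k * s) k s := by
      simpa using (hasDerivAt_id s).const_mul k
    have a3 := (a1.const_mul R).mul (((a2.const_add 1)).add ((a2.pow 2).const_mul κ))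
    refine HasDerivAt.congr_deriv (f' := _) a3 ?_
    rw [hθ']; simp; ring
  have main : ∀ x : Esp n, ‖x‖ = 1 → ∃ P : ℝ, (0 ≤ s2 h x) ∧
      R * Real.exp (s2 h x / (2 * N)) * ((N + 2) * κ * (k * s2 h x) ^ 3) ≤ P ∧
      (∀ V : Esp n → Esp n, (V = fun y => Real.exp (-(b * h y ^ 2 / 2)) • ((gradient h y - h y • y) -
      θ (s2 h y) • (gA h y - h y • y))) →
       ContDiffAt ℝ 1 V x ∧ ⟪x, V x⟫ = 0 ∧ sdiv x (fderiv ℝ V x) = Real.exp (-(b * h x ^ 2 / 2)) * P) := by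
    intro x hx
    obtain ⟨a, haI, ha, ha', hsym, hax, haM, hMa, htr⟩ := H.exists_inv hx
    obtain ⟨α, hα⟩ : ∃ α, α = ⟪a (gradient h x - h x • x), gradient h x - h x • x⟫ := ⟨_, rfl⟩
    have hs0 : 0 ≤ s2 h x := by rw [← H.p_sq hx]; positivity
    refine ⟨_, hs0, ?_, fun V hV => H.Vdiv b θ θ' cθ dθ V hV hx a haI ha ha' hax hsym haM hMa htr α hα⟩
    have hτ0 : 0 < R * Real.exp (s2 h x / (2 * N)) := by positivity
    have hσ : dt (hS h x) = (R * Real.exp (s2 h x / (2 * N))) ^ n := by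
      rw [H.eqS hx, mul_pow, hR, ← Real.exp_nat_mul]
      congr 2; rw [← hN]; field_simp
    set X := k * s2 h x with hX
    have hX0 : 0 ≤ X := by positivity
    have i1 := H.tr_ge hx hτ0 hσ
    have i2 := H.second_ge hx hτ0 hσ (by omega) a ha hax hsym haM α hα (1 + X + κ * X ^ 2)
      (2 * k * (1 + 2 * κ * X)) (1 + (N + 2) * X / N) (by positivity) (by positivity) (by positivity) (by
        refine (scal_ineq n hn X κ hX0 hκ).trans (le_of_eq ?_)
        congr 1
        rw [hX]; ring)
    rw [hθ, hθ']
    simp only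
    rw [← hX]
    rw [← hN] at i1 i2
    set τ := R * Real.exp (s2 h x / (2 * N))
    have hbs : b * s2 h x = (N + 2) * X := by rw [hX, hk]; field_simp
    have hκ4 : κ * (N + 4) = N + 2 := by rw [hκ]; field_simp
    have i3 := mul_nonneg (hpos x hx) (sub_nonneg.2 i2)
    have e1 : N * (1 + (N + 2) * X / N) = N + (N + 2) * X := by field_simp
    rw [e1] at i3
    have e2 : k * s2 h x = X := hX.symm
    have hbN : b = 1 - N⁻¹ := by rw [hb]; simp
    have fin : tr (hM h x) - h x * N - τ * ((1 + X + κ * X ^ 2) / (2 * N) + k * (1 + 2 * κ * X)) *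
          (2 * s2 h x - 2 * h x * α) - τ * (1 + X + κ * X ^ 2) * (N - s2 h x + h x * α - h x * (tr a - 1)) -
        b * h x * (s2 h x - τ * (1 + X + κ * X ^ 2) * α)
      = (tr (hM h x) - N * τ) + τ * ((N + 2) * κ * X ^ 3) + h x * (τ * ((1 + X + κ * X ^ 2) * (tr a - 1) + 2 * k * (1 + 2 * κ * X) * α) - (N + (N + 2) * X)) := by
      have e3 : (1 + X + κ * X ^ 2) / (2 * N) = (1 + X + κ * X ^ 2) * (1 - b) / 2 := by
        rw [hbN]; field_simp; ring
      rw [e3]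
      linear_combination (τ * (1 + X + κ * X ^ 2) - h x) * hbs  - 2 * τ * (1 + 2 * κ * X) * e2 - τ * X ^ 2 * hκ4
    rw [fin]
    linarith
  have hz := sphere_div (fun y => Real.exp (-(b * h y ^ 2 / 2)) • ((gradient h y - h y • y) -
      θ (s2 h y) • (gA h y - h y • y)))
    (fun x hx => by obtain ⟨P, _, _, hP⟩ := main x hx; exact (hP _ rfl).1)
    (fun x hx => by obtain ⟨P, _, _, hP⟩ := main x hx; exact (hP _ rfl).2.1)
    (fun x hx => by
      obtain ⟨P, h0, h1, hP⟩ := main x hx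
      rw [(hP _ rfl).2.2]
      have : 0 ≤ P := le_trans (by positivity) h1
      positivity)
  intro x hx
  have h2 := hz x hx
  obtain ⟨P, h0, h1, hP⟩ := main x hx
  rw [(hP _ rfl).2.2] at h2
  have h3 : P = 0 := (mul_eq_zero.1 h2).resolve_left (Real.exp_pos _).ne'
  rw [h3] at h1
  by_contra hne
  have h4 : 0 < s2 h x := lt_of_le_of_ne h0 (Ne.symm hne)
  have : 0 < R * Real.exp (s2 h x / (2 * N)) * ((N + 2) * κ * (k * s2 h x) ^ 3) := by positivity
  linarith

end Sol


lemma le_of_hd {f f' : ℝ → ℝ} {a b : ℝ} (hab : a ≤ b) (hd : ∀ t, HasDerivAt f (f' t) t)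
    (h0 : ∀ t, a < t → t < b → 0 ≤ f' t) : f a ≤ f b := by
  have := monotoneOn_of_deriv_nonneg (convex_Icc a b) (f := f)
    (fun t _ => (hd t).continuousAt.continuousWithinAt)
    (fun t _ => (hd t).differentiableAt.differentiableWithinAt)
    (fun t ht => by
      rw [interior_Icc] at ht
      rw [(hd t).deriv]; exact h0 t ht.1 ht.2)
  exact this (Set.left_mem_Icc.2 hab) (Set.right_mem_Icc.2 hab) hab

lemma lt_of_hd {f f' : ℝ → ℝ} {a b : ℝ} (hab : a < b) (hd : ∀ t, HasDerivAt f (f' t) t)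
    (h0 : ∀ t, a < t → t < b → 0 < f' t) : f a < f b := by
  have := strictMonoOn_of_deriv_pos (convex_Icc a b) (f := f)
    (fun t _ => (hd t).continuousAt.continuousWithinAt)
    (fun t ht => by
      rw [interior_Icc] at ht
      rw [(hd t).deriv]; exact h0 t ht.1 ht.2)
  exact this (Set.left_mem_Icc.2 hab.le) (Set.right_mem_Icc.2 hab.le) hab

section Circ
variable {n : ℕ}

lemma exists_perp (hn : 1 ≤ n) {x : Esp n} (hx : ‖x‖ = 1) : ∃ u : Esp n, ‖u‖ = 1 ∧ ⟪x, u⟫ = 0 := by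
  haveI : Fact (Module.finrank ℝ (Esp n) = n + 1) := ⟨by simp⟩
  have h1 := Submodule.finrank_orthogonal_span_singleton (𝕜 := ℝ) (n := n) (unit_ne hx)
  haveI : Nontrivial (Submodule.span ℝ {x})ᗮ := by
    apply Module.nontrivial_of_finrank_pos (R := ℝ); rw [h1]; omega
  obtain ⟨⟨v, hv⟩, hv0⟩ := exists_ne (0 : (Submodule.span ℝ {x})ᗮ)
  have hv0' : v ≠ 0 := by
    intro h; apply hv0; ext1; exact h
  rw [Submodule.mem_orthogonal_singleton_iff_inner_right] at hv
  exact ⟨nrm v, norm_nrm hv0', by rw [nrm, real_inner_smul_right, hv, mul_zero]⟩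

/-- great circle -/
def gc (a u : Esp n) (t : ℝ) : Esp n := Real.cos t • a + Real.sin t • u
/-- velocity of the great circle -/
def gc' (a u : Esp n) (t : ℝ) : Esp n := -Real.sin t • a + Real.cos t • u

lemma gc_hd (a u : Esp n) (t : ℝ) : HasDerivAt (gc a u) (gc' a u t) t :=
  ((Real.hasDerivAt_cos t).smul_const a).add ((Real.hasDerivAt_sin t).smul_const u)

lemma gc'_hd (a u : Esp n) (t : ℝ) : HasDerivAt (gc' a u) (-gc a u t) t := by
  have := ((Real.hasDerivAt_sin t).neg.smul_const a).add ((Real.hasDerivAt_cos t).smul_const u)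
  refine HasDerivAt.congr_deriv (f' := _) this ?_
  rw [gc]; module

lemma gc_sq {a u : Esp n} (ha : ‖a‖ = 1) (hu : ‖u‖ = 1) (hau : ⟪a, u⟫ = 0) (t : ℝ) :
    ⟪gc a u t, gc a u t⟫ = 1 := by
  have hua : ⟪u, a⟫ = 0 := by rw [real_inner_comm, hau]
  simp only [gc, inner_add_left, inner_add_right, real_inner_smul_left, real_inner_smul_right,
    inner_unit ha, inner_unit hu, hau, hua]
  nlinarith [Real.sin_sq_add_cos_sq t]

lemma norm_one_of {x : Esp n} (h : ⟪x, x⟫ = 1) : ‖x‖ = 1 := by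
  rw [real_inner_self_eq_norm_sq] at h
  exact (pow_eq_one_iff_of_nonneg (norm_nonneg x) (by norm_num)).1 h

lemma gc_norm {a u : Esp n} (ha : ‖a‖ = 1) (hu : ‖u‖ = 1) (hau : ⟪a, u⟫ = 0) (t : ℝ) :
    ‖gc a u t‖ = 1 := norm_one_of (gc_sq ha hu hau t)

lemma gc'_norm {a u : Esp n} (ha : ‖a‖ = 1) (hu : ‖u‖ = 1) (hau : ⟪a, u⟫ = 0) (t : ℝ) :
    ‖gc' a u t‖ = 1 := by
  apply norm_one_of
  have hua : ⟪u, a⟫ = 0 := by rw [real_inner_comm, hau]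
  simp only [gc', inner_add_left, inner_add_right, real_inner_smul_left, real_inner_smul_right,
    inner_unit ha, inner_unit hu, hau, hua]
  nlinarith [Real.sin_sq_add_cos_sq t]

lemma gc_gc' {a u : Esp n} (ha : ‖a‖ = 1) (hu : ‖u‖ = 1) (hau : ⟪a, u⟫ = 0) (t : ℝ) :
    ⟪gc a u t, gc' a u t⟫ = 0 := by
  have hua : ⟪u, a⟫ = 0 := by rw [real_inner_comm, hau]
  simp only [gc, gc', inner_add_left, inner_add_right, real_inner_smul_left, real_inner_smul_right,
    inner_unit ha, inner_unit hu, hau, hua]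
  ring

lemma exists_gc (hn : 1 ≤ n) {x y : Esp n} (hx : ‖x‖ = 1) (hy : ‖y‖ = 1) :
    ∃ u : Esp n, ‖u‖ = 1 ∧ ⟪x, u⟫ = 0 ∧ ∃ t, 0 ≤ t ∧ t ≤ Real.pi ∧ y = gc x u t := by
  set w := y - ⟪x, y⟫ • x with hw
  have hxx := inner_unit hx
  have hyy := inner_unit hy
  have hww : ⟪w, w⟫ = 1 - ⟪x, y⟫ ^ 2 := by
    rw [hw]
    simp only [inner_sub_left, inner_sub_right, real_inner_smul_left, real_inner_smul_right, hxx, hyy]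
    rw [real_inner_comm x y]; ring
  have hxw : ⟪x, w⟫ = 0 := by
    rw [hw, inner_sub_right, real_inner_smul_right, hxx]; ring
  have hab : |⟪x, y⟫| ≤ 1 := by
    have := abs_real_inner_le_norm x y
    rwa [hx, hy, one_mul] at this
  have hab' := abs_le.1 hab
  have hcos := Real.cos_arccos hab'.1 hab'.2
  have hsin : Real.sin (Real.arccos ⟪x, y⟫) = ‖w‖ := by
    rw [Real.sin_arccos, ← hww, real_inner_self_eq_norm_sq, Real.sqrt_sq (norm_nonneg w)]
  by_cases h0 : w = 0
  · obtain ⟨u, hu, hxu⟩ := exists_perp hn hx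
    refine ⟨u, hu, hxu, Real.arccos ⟪x, y⟫, Real.arccos_nonneg _, Real.arccos_le_pi _, ?_⟩
    rw [gc, hcos, hsin, h0, norm_zero, zero_smul, add_zero]
    exact sub_eq_zero.1 (hw.symm.trans h0)
  · refine ⟨nrm w, norm_nrm h0, by rw [nrm, real_inner_smul_right, hxw, mul_zero],
      Real.arccos ⟪x, y⟫, Real.arccos_nonneg _, Real.arccos_le_pi _, ?_⟩
    rw [gc, hcos, hsin, norm_smul_nrm h0, hw]; abel

end Circ

namespace SH
variable {n : ℕ} {h : Esp n → ℝ}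

lemma f_hd (H : SH n h) {a u : Esp n} (ha : ‖a‖ = 1) (hu : ‖u‖ = 1) (hau : ⟪a, u⟫ = 0) (t : ℝ) :
    HasDerivAt (fun t => h (gc a u t)) ⟪gradient h (gc a u t), gc' a u t⟫ t :=
  (H.dh (unit_ne (gc_norm ha hu hau t))).comp_hasDerivAt t (gc_hd a u t)

lemma f'_hd (H : SH n h) {a u : Esp n} (ha : ‖a‖ = 1) (hu : ‖u‖ = 1) (hau : ⟪a, u⟫ = 0) (t : ℝ) :
    HasDerivAt (fun t => ⟪gradient h (gc a u t), gc' a u t⟫)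
      (⟪hM h (gc a u t) (gc' a u t), gc' a u t⟫ - h (gc a u t)) t := by
  have hne := unit_ne (gc_norm ha hu hau t)
  have h1 : HasDerivAt (fun t => gradient h (gc a u t)) (hM h (gc a u t) (gc' a u t)) t :=
    (H.dG hne).comp_hasDerivAt t (gc_hd a u t)
  have h2 := h1.inner ℝ (gc'_hd a u t)
  refine HasDerivAt.congr_deriv (f' := _) h2 ?_
  rw [inner_neg_right, H.euler hne]; ring

end SH

namespace Sol
variable {n : ℕ} {C : ℝ} {h : Esp n → ℝ}

lemma M_pos (H : Sol n C h) {x v : Esp n} (hx : ‖x‖ = 1) (hv : v ≠ 0) (hxv : ⟪x, v⟫ = 0) : 0 < ⟪hM h x v, v⟫ := by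
  have := (H.spd x hx).2 v hv
  rw [cadd, outer_apply, hxv, zero_smul, add_zero] at this
  exact this

/-- strict support inequality -/
lemma support (H : Sol n C h) (hn : 1 ≤ n) {z y : Esp n} (hz : ‖z‖ = 1) (hy : ‖y‖ = 1) (hzy : y ≠ z) :
    ⟪gradient h z, y⟫ < h y := by
  obtain ⟨u, hu, hzu, t, ht0, htpi, rfl⟩ := exists_gc hn hz hy
  have ht : 0 < t := by
    rcases ht0.lt_or_eq with h | h
    · exact h
    · exfalso; apply hzy; rw [← h]; simp [gc]
  have hs : ∀ s : ℝ, HasDerivAt (fun s => Real.sin (t - s)) (-Real.cos (t - s)) s := by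
    intro s
    have := (Real.hasDerivAt_sin (t - s)).comp s ((hasDerivAt_id s).const_sub t)
    exact HasDerivAt.congr_deriv (f' := _) this (by simp)
  have hc : ∀ s : ℝ, HasDerivAt (fun s => Real.cos (t - s)) (Real.sin (t - s)) s := by
    intro s
    have := (Real.hasDerivAt_cos (t - s)).comp s ((hasDerivAt_id s).const_sub t)
    exact HasDerivAt.congr_deriv (f' := _) this (by simp)
  have key := lt_of_hd ht (fun s => ((H.f'_hd hz hu hzu s).mul (hs s)).add
    ((H.f_hd hz hu hzu s).mul (hc s))) (fun s hs0 hst => by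
      have h1 := H.M_pos (gc_norm hz hu hzu s) (unit_ne (gc'_norm hz hu hzu s)) (gc_gc' hz hu hzu s)
      have h2 : 0 < Real.sin (t - s) := Real.sin_pos_of_pos_of_lt_pi (by linarith) (by linarith)
      nlinarith [mul_pos h1 h2])
  simp only [Pi.add_apply, Pi.mul_apply, sub_zero, sub_self, Real.sin_zero, Real.cos_zero, mul_zero, mul_one, zero_add] at key
  refine lt_of_eq_of_lt ?_ key
  simp only [gc, gc', Real.sin_zero, Real.cos_zero, one_smul, zero_smul, add_zero, neg_zero, zero_add,
    inner_add_right, real_inner_smul_right, H.euler (unit_ne hz)]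
  ring

lemma const_of_s2 (H : Sol n C h) (hn : 1 ≤ n) (h0 : ∀ x : Esp n, ‖x‖ = 1 → s2 h x = 0) {x y : Esp n}
    (hx : ‖x‖ = 1) (hy : ‖y‖ = 1) : h y = h x := by
  obtain ⟨u, hu, hxu, t, ht0, htpi, rfl⟩ := exists_gc hn hx hy
  have hd : ∀ s, HasDerivAt (fun t => h (gc x u t)) 0 s := by
    intro s
    refine HasDerivAt.congr_deriv (f' := _) (H.f_hd hx hu hxu s) ?_
    have hg := gc_norm hx hu hxu s
    have h1 := H.p_sq hg
    rw [h0 _ hg] at h1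
    have h2 : gradient h (gc x u s) - h (gc x u s) • gc x u s = 0 := by
      rw [← norm_eq_zero]; exact pow_eq_zero_iff (by norm_num) |>.1 h1
    rw [sub_eq_zero.1 h2, real_inner_smul_left, gc_gc' hx hu hxu, mul_zero]
  have h1 := le_of_hd ht0 hd (fun _ _ _ => le_rfl)
  have h2 := le_of_hd ht0 (fun s => (hd s).neg) (fun _ _ _ => by simp)
  have e : gc x u 0 = x := by simp [gc]
  simp only [Pi.neg_apply, e] at h1 h2
  linarith

/-- critical point gradient at a minimizer -/
lemma crit (H : Sol n C h) {x0 : Esp n} (hx : ‖x0‖ = 1) (hmin : ∀ x : Esp n, ‖x‖ = 1 → h x0 ≤ h x) {v : Esp n}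
    (hv : ⟪x0, v⟫ = 0) : ⟪gradient h x0, v⟫ = 0 := by
  by_cases hv0 : v = 0
  · simp [hv0]
  have hd := H.f_hd hx (norm_nrm hv0) (by rw [nrm, real_inner_smul_right, hv, mul_zero]) 0
  have e : gc x0 (nrm v) 0 = x0 := by simp [gc]
  have e' : gc' x0 (nrm v) 0 = nrm v := by simp [gc']
  have hm : IsLocalMin (fun t => h (gc x0 (nrm v) t)) 0 := by
    filter_upwards with t
    rw [e]
    exact hmin _ (gc_norm hx (norm_nrm hv0) (by rw [nrm, real_inner_smul_right, hv, mul_zero]) t)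
  have := hm.hasDerivAt_eq_zero hd
  rw [e, e'] at this
  rw [← norm_smul_nrm hv0, real_inner_smul_right, this, mul_zero]

lemma crit' (H : Sol n C h) {x0 : Esp n} (hx : ‖x0‖ = 1) (hmin : ∀ x : Esp n, ‖x‖ = 1 → h x0 ≤ h x) :
    gradient h x0 = h x0 • x0 := by
  have h1 : ⟪x0, gradient h x0 - h x0 • x0⟫ = 0 := by
    rw [inner_sub_right, real_inner_smul_right, inner_unit hx, real_inner_comm, H.euler (unit_ne hx)]; ring
  have h2 := H.crit hx hmin h1
  have h3 : ⟪gradient h x0 - h x0 • x0, gradient h x0 - h x0 • x0⟫ = 0 := by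
    rw [inner_sub_left, h2, real_inner_smul_left, h1]; ring
  exact sub_eq_zero.1 (inner_self_eq_zero.1 h3)

end Sol


lemma second_deriv_test {φ φ' : ℝ → ℝ} {c : ℝ} (h1 : ∀ᶠ t in nhds (0 : ℝ), HasDerivAt φ (φ' t) t)
    (h2 : HasDerivAt φ' c 0) (hm : IsLocalMin φ 0) : 0 ≤ c := by
  by_contra hc
  push Not at hc
  have e1 : deriv φ =ᶠ[nhds 0] φ' := h1.mono fun t ht => ht.deriv
  have e2 : deriv (deriv φ) 0 = c := by rw [e1.deriv_eq, h2.deriv]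
  have hM := isLocalMax_of_deriv_deriv_neg (by rw [e2]; exact hc) hm.deriv_eq_zero
    h1.self_of_nhds.continuousAt
  have e3 : φ =ᶠ[nhds 0] fun _ => φ 0 := by
    filter_upwards [hm, hM] with t ht1 ht2
    exact le_antisymm ht2 ht1
  have e4 : deriv φ =ᶠ[nhds 0] deriv (fun _ => φ 0) := e3.deriv
  have e5 := e4.deriv_eq
  rw [e2] at e5
  simp at e5
  exact hc.ne e5

lemma deriv_nonneg_right {g : ℝ → ℝ} {c b : ℝ} (hb : 0 < b) (hd : HasDerivAt g c 0)
    (hg : ∀ t, 0 < t → t < b → g 0 ≤ g t) : 0 ≤ c := by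
  have h1 := hd.hasDerivWithinAt (s := Set.Ioi 0)
  rw [hasDerivWithinAt_iff_tendsto_slope' (by simp)] at h1
  refine ge_of_tendsto h1 ?_
  filter_upwards [Ioo_mem_nhdsGT hb] with t ht
  rw [slope_def_field]
  apply div_nonneg
  · linarith [hg t ht.1 ht.2]
  · linarith [ht.1]

lemma tr_mul_nonneg {n : ℕ} {a P : Esp n →L[ℝ] Esp n} (ha : ∀ v w, ⟪a v, w⟫ = ⟪v, a w⟫)
    (hap : ∀ v, 0 ≤ ⟪a v, v⟫) (hP : ∀ v, 0 ≤ ⟪P v, v⟫) : 0 ≤ tr (a * P) := by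
  have hs : (a : Esp n →ₗ[ℝ] Esp n).IsSymmetric := ha
  have hf : Module.finrank ℝ (Esp n) = n + 1 := by simp
  have hb := hs.apply_eigenvectorBasis hf
  rw [tr_mul_comm, tr_eq_sum_onb (hs.eigenvectorBasis hf)]
  apply Finset.sum_nonneg
  intro i _
  have h1 : a (hs.eigenvectorBasis hf i) = (hs.eigenvalues hf i) • hs.eigenvectorBasis hf i := hb i
  rw [cmul, h1, map_smul, real_inner_smul_right, real_inner_comm]
  apply mul_nonneg _ (hP _)
  have h2 := hap (hs.eigenvectorBasis hf i)
  rw [h1, real_inner_smul_left, inner_unit ((hs.eigenvectorBasis hf).orthonormal.1 i), mul_one] at h2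
  exact h2

lemma line_hd {n : ℕ} (y u : Esp n) (t : ℝ) : HasDerivAt (fun t : ℝ => y + t • u) u t := by
  have := ((hasDerivAt_id t).smul_const u).const_add y
  exact HasDerivAt.congr_deriv (f' := _) this (by simp)

/-- barrier along a line -/
lemma barrier_hd {n : ℕ} (α : ℝ) (y y0 u : Esp n) (t : ℝ) :
    HasDerivAt (fun t : ℝ => Real.exp (-α * ⟪y + t • u - y0, y + t • u - y0⟫))
      (Real.exp (-α * ⟪y + t • u - y0, y + t • u - y0⟫) * (-2 * α * ⟪y + t • u - y0, u⟫)) t := by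
  have h1 : HasDerivAt (fun t : ℝ => y + t • u - y0) u t := (line_hd y u t).sub_const y0
  have h2 := ((h1.inner ℝ h1).const_mul (-α)).exp
  refine HasDerivAt.congr_deriv (f' := _) h2 ?_
  rw [real_inner_comm (y + t • u - y0) u]; ring

lemma barrier_hd2 {n : ℕ} (α : ℝ) (y y0 u : Esp n) (t : ℝ) :
    HasDerivAt (fun t : ℝ => Real.exp (-α * ⟪y + t • u - y0, y + t • u - y0⟫) * (-2 * α * ⟪y + t • u - y0, u⟫))
      (Real.exp (-α * ⟪y + t • u - y0, y + t • u - y0⟫) * (4 * α ^ 2 * ⟪y + t • u - y0, u⟫ ^ 2 - 2 * α * ⟪u, u⟫)) t := by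
  have h1 : HasDerivAt (fun t : ℝ => y + t • u - y0) u t := (line_hd y u t).sub_const y0
  have h2 := (barrier_hd α y y0 u t).mul ((h1.inner ℝ (hasDerivAt_const t u)).const_mul (-2 * α))
  refine HasDerivAt.congr_deriv (f' := _) h2 ?_
  rw [inner_zero_right]; ring

theorem hopf {n : ℕ} {w : Esp n → ℝ} (W : SH n w) (y0 : Esp n) (r : ℝ) (hr : 0 < r)
    (h0 : ∀ y, ‖y - y0‖ ≤ r → y ≠ 0) (lam Λ β K : ℝ) (hlam : 0 < lam) (hΛ : 0 ≤ Λ) (hβ : 0 ≤ β) (hK : 0 ≤ K)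
    (hsup : ∀ y, ‖y - y0‖ ≤ r → ∃ (a : Esp n →L[ℝ] Esp n) (B : Esp n),
      (∀ v w, ⟪a v, w⟫ = ⟪v, a w⟫) ∧ (∀ v, lam * ⟪v, v⟫ ≤ ⟪a v, v⟫) ∧ tr a ≤ Λ ∧ ‖B‖ ≤ β ∧
      tr (a * hM w y) ≤ ⟪B, gradient w y⟫ + K * w y)
    (hpos : ∀ y, ‖y - y0‖ < r → 0 < w y) (z0 : Esp n) (hz : ‖z0 - y0‖ = r) (hw0 : w z0 = 0) :
    0 < ⟪gradient w z0, y0 - z0⟫ := by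
  have hcont : ContinuousOn w {y | y ≠ 0} := fun y hy => (W.cd hy).continuousAt.continuousWithinAt
  -- nonnegativity on closed ball
  have hnn : ∀ y, ‖y - y0‖ ≤ r → 0 ≤ w y := by
    intro y hy
    have hc : ContinuousAt (fun t : ℝ => w (y + t • (y0 - y))) 0 := by
      have h1 : ContinuousAt w (y + (0 : ℝ) • (y0 - y)) := by
        rw [zero_smul, add_zero]; exact (W.cd (h0 y hy)).continuousAt
      exact ContinuousAt.comp (f := fun t : ℝ => y + t • (y0 - y)) h1 (line_hd y (y0 - y) 0).continuousAt
    have hc' := hc.continuousWithinAt (s := Set.Ioi 0)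
    have hc2 : Filter.Tendsto (fun t : ℝ => w (y + t • (y0 - y))) (nhdsWithin 0 (Set.Ioi 0)) (nhds (w y)) := by
      have := hc'.tendsto
      simpa using this
    refine ge_of_tendsto hc2 ?_
    filter_upwards [Ioo_mem_nhdsGT (show (0 : ℝ) < 1 by norm_num)] with t ht
    apply (hpos _ _).le
    have e : y + t • (y0 - y) - y0 = (1 - t) • (y - y0) := by module
    rw [e, norm_smul, Real.norm_of_nonneg (by linarith [ht.2])]
    nlinarith [ht.1, ht.2, norm_nonneg (y - y0)]
  obtain ⟨α, hα1, hα⟩ : ∃ α : ℝ, 1 ≤ α ∧ K < α ^ 2 * lam * r ^ 2 - α * (2 * Λ + 2 * β * r) := by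
    refine ⟨(2 * Λ + 2 * β * r + K + 1) / (lam * r ^ 2) + 1, ?_, ?_⟩
    · have : 0 ≤ (2 * Λ + 2 * β * r + K + 1) / (lam * r ^ 2) := by positivity
      linarith
    · set α := (2 * Λ + 2 * β * r + K + 1) / (lam * r ^ 2) + 1 with hα
      have h1 : 1 ≤ α := by
        have : 0 ≤ (2 * Λ + 2 * β * r + K + 1) / (lam * r ^ 2) := by positivity
        linarith
      have h2 : α * (lam * r ^ 2) = 2 * Λ + 2 * β * r + K + 1 + lam * r ^ 2 := by
        rw [hα]; field_simp
      have h3 : 0 < lam * r ^ 2 := by positivity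
      nlinarith
  have hα0 : 0 < α := by linarith
  set E : Esp n → ℝ := fun y => Real.exp (-α * ⟪y - y0, y - y0⟫) with hE
  have hEc : Continuous E := by
    rw [hE]; fun_prop
  set v : Esp n → ℝ := fun y => E y - Real.exp (-α * r ^ 2) with hv
  have hvc : Continuous v := hEc.sub continuous_const
  -- inner sphere
  obtain ⟨δ, hδ0, hδ⟩ : ∃ δ : ℝ, 0 < δ ∧ ∀ y, ‖y - y0‖ = r / 2 → δ ≤ w y := by
    have hcomp : IsCompact (sphere y0 (r / 2)) := isCompact_sphere _ _
    rcases (sphere y0 (r / 2)).eq_empty_or_nonempty with he | hne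
    · refine ⟨1, one_pos, fun y hy => ?_⟩
      have : y ∈ sphere y0 (r / 2) := by rw [mem_sphere_iff_norm]; exact hy
      rw [he] at this; exact absurd this (Set.notMem_empty _)
    · obtain ⟨ym, hym, hmin⟩ := hcomp.exists_isMinOn hne (hcont.mono (by
        intro y hy; rw [mem_sphere_iff_norm] at hy; exact h0 y (by linarith)))
      rw [mem_sphere_iff_norm] at hym
      refine ⟨w ym, hpos ym (by linarith), fun y hy => hmin (by rw [mem_sphere_iff_norm]; exact hy)⟩
  -- comparison
  have hcmp : ∀ y, r / 2 ≤ ‖y - y0‖ → ‖y - y0‖ ≤ r → δ * v y ≤ w y := by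
    set A : Set (Esp n) := {y | r / 2 ≤ ‖y - y0‖ ∧ ‖y - y0‖ ≤ r} with hA
    have hAc : IsCompact A := by
      apply (isCompact_closedBall y0 r).of_isClosed_subset
      · have hnc : Continuous fun y : Esp n => ‖y - y0‖ := by fun_prop
        exact (isClosed_le continuous_const hnc).inter (isClosed_le hnc continuous_const)
      · intro y hy; rw [mem_closedBall_iff_norm]; exact hy.2
    have hz0A : z0 ∈ A := ⟨by rw [hz]; linarith, hz.le⟩
    obtain ⟨ym, hymA, hmin⟩ := hAc.exists_isMinOn (f := fun y => w y - δ * v y) ⟨z0, hz0A⟩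
      ((hcont.mono (fun y hy => h0 y hy.2)).sub (continuous_const.mul hvc).continuousOn)
    suffices hfin : 0 ≤ w ym - δ * v ym by
      intro y h1 h2
      have h3 : w ym - δ * v ym ≤ w y - δ * v y := hmin ⟨h1, h2⟩
      linarith
    by_contra hneg
    push Not at hneg
    have hv1 : ∀ y, v y ≤ 1 := by
      intro y
      have h1 : E y ≤ 1 := by
        rw [hE]; simp only
        rw [Real.exp_le_one_iff]
        have : 0 ≤ ⟪y - y0, y - y0⟫ := real_inner_self_nonneg
        nlinarith
      have h2 := Real.exp_pos (-α * r ^ 2)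
      rw [hv]; simp only; linarith
    have hin : r / 2 < ‖ym - y0‖ := by
      rcases hymA.1.lt_or_eq with h | h
      · exact h
      · exfalso
        have h1 := hδ ym h.symm
        have h2 := hv1 ym
        nlinarith
    have hout : ‖ym - y0‖ < r := by
      rcases hymA.2.lt_or_eq with h | h
      · exact h
      · exfalso
        have h1 := hnn ym hymA.2
        have h2 : v ym = 0 := by
          rw [hv, hE]; simp only
          rw [real_inner_self_eq_norm_sq, h, sub_self]
        rw [h2] at hneg; linarith
    have hne := h0 ym hymA.2
    have hloc : IsLocalMin (fun y => w y - δ * v y) ym := by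
      have ho : IsOpen {y : Esp n | r / 2 < ‖y - y0‖ ∧ ‖y - y0‖ < r} := by
        have hnc : Continuous fun y : Esp n => ‖y - y0‖ := by fun_prop
        exact (isOpen_lt continuous_const hnc).inter (isOpen_lt hnc continuous_const)
      filter_upwards [ho.mem_nhds ⟨hin, hout⟩] with y hy
      exact hmin ⟨hy.1.le, hy.2.le⟩
    set ξ := ym - y0 with hξ
    have hEp : 0 < E ym := Real.exp_pos _
    have hdirs : ∀ u : Esp n, ⟪gradient w ym, u⟫ = δ * (E ym * (-2 * α * ⟪ξ, u⟫)) ∧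
        0 ≤ ⟪hM w ym u, u⟫ - δ * (E ym * (4 * α ^ 2 * ⟪ξ, u⟫ ^ 2 - 2 * α * ⟪u, u⟫)) := by
      intro u
      have hlc : ContinuousAt (fun t : ℝ => ym + t • u) 0 := (line_hd ym u 0).continuousAt
      have el : ym + (0 : ℝ) • u = ym := by simp
      have hne' : ∀ᶠ t in nhds (0 : ℝ), ym + t • u ≠ 0 := by
        apply hlc.eventually_ne; rw [el]; exact hne
      have hl : IsLocalMin (fun t : ℝ => w (ym + t • u) - δ * v (ym + t • u)) 0 := by
        have hloc' : IsLocalMin (fun y => w y - δ * v y) (ym + (0 : ℝ) • u) := by rw [el]; exact hloc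
        have := hlc.eventually hloc'
        exact this
      have d1 : ∀ᶠ t in nhds (0 : ℝ), HasDerivAt (fun t : ℝ => w (ym + t • u) - δ * v (ym + t • u))
          (⟪gradient w (ym + t • u), u⟫ - δ * (Real.exp (-α * ⟪ym + t • u - y0, ym + t • u - y0⟫) * (-2 * α * ⟪ym + t • u - y0, u⟫))) t := by
        filter_upwards [hne'] with t ht
        have a1 : HasDerivAt (fun t : ℝ => w (ym + t • u)) ⟪gradient w (ym + t • u), u⟫ t := by
          have := (W.dh ht).comp_hasDerivAt t (line_hd ym u t)
          exact this
        have a2 := ((barrier_hd α ym y0 u t).sub_const (Real.exp (-α * r ^ 2))).const_mul δ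
        exact a1.sub a2
      have d2 : HasDerivAt (fun t : ℝ => ⟪gradient w (ym + t • u), u⟫ - δ * (Real.exp (-α * ⟪ym + t • u - y0, ym + t • u - y0⟫) * (-2 * α * ⟪ym + t • u - y0, u⟫)))
          (⟪hM w ym u, u⟫ - δ * (E ym * (4 * α ^ 2 * ⟪ξ, u⟫ ^ 2 - 2 * α * ⟪u, u⟫))) 0 := by
        have a1 : HasDerivAt (fun t : ℝ => gradient w (ym + t • u)) (hM w ym u) 0 := by
          have := W.dG hne
          rw [← el] at this
          have h2 := this.comp_hasDerivAt (0 : ℝ) (line_hd ym u 0)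
          rw [el] at h2
          exact h2
        have a2 := (a1.inner ℝ (hasDerivAt_const (0 : ℝ) u)).sub ((barrier_hd2 α ym y0 u 0).const_mul δ)
        refine HasDerivAt.congr_deriv (f' := _) a2 ?_
        simp only [el, inner_zero_right, zero_add, hE, hξ]
      have f1 := hl.hasDerivAt_eq_zero d1.self_of_nhds
      have f2 := second_deriv_test d1 d2 hl
      refine ⟨?_, f2⟩
      simp only [el] at f1
      linarith
    obtain ⟨a, B, hasym, hal, hat, hB, heq⟩ := hsup ym hymA.2
    have hxx : r ^ 2 / 4 ≤ ⟪ξ, ξ⟫ := by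
      rw [real_inner_self_eq_norm_sq]; nlinarith
    set P := hM w ym - (δ * E ym) • ((4 * α ^ 2) • outer ξ ξ - (2 * α) • (1 : Esp n →L[ℝ] Esp n)) with hP
    have h1 : 0 ≤ tr (a * P) := by
      apply tr_mul_nonneg hasym
      · intro v; refine le_trans ?_ (hal v)
        exact mul_nonneg hlam.le real_inner_self_nonneg
      · intro u
        have := (hdirs u).2
        rw [hP]
        simp only [csub, csmul, cone, outer_apply, inner_sub_left, real_inner_smul_left]
        refine this.trans_eq ?_
        ring
    have h2 : tr (a * P) = tr (a * hM w ym) - δ * E ym * (4 * α ^ 2 * ⟪a ξ, ξ⟫ - 2 * α * tr a) := by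
      rw [hP, mul_sub, tr_sub, cmul_smul, tr_smul, mul_sub, tr_sub, cmul_smul, cmul_smul, tr_smul,
        tr_smul, mul_one, tr_mul_outer, hasym]
    have h3 : ⟪B, gradient w ym⟫ ≤ δ * E ym * (2 * α * (β * r)) := by
      rw [real_inner_comm, (hdirs B).1]
      have : -⟪ξ, B⟫ ≤ β * r := by
        have h4 := abs_real_inner_le_norm ξ B
        have h5 := neg_abs_le ⟪ξ, B⟫
        have h6 : ‖ξ‖ * ‖B‖ ≤ r * β := mul_le_mul hymA.2 hB (norm_nonneg _) hr.le
        linarith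
      have h7 : 0 ≤ δ * E ym * (2 * α) := by positivity
      nlinarith [mul_le_mul_of_nonneg_left this h7]
    have h4 : K * w ym ≤ δ * E ym * K := by
      have : w ym ≤ δ * E ym := by
        have h5 : v ym ≤ E ym := by
          rw [hv]; simp only; linarith [Real.exp_pos (-α * r ^ 2)]
        nlinarith
      nlinarith
    have h5 := hal ξ
    have h6 : 0 ≤ δ * E ym * (2 * α * (β * r) + K - (4 * α ^ 2 * ⟪a ξ, ξ⟫ - 2 * α * tr a)) := by
      rw [h2] at h1; linarith
    have h7 : 0 ≤ 2 * α * (β * r) + K - (4 * α ^ 2 * ⟪a ξ, ξ⟫ - 2 * α * tr a) :=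
      nonneg_of_mul_nonneg_right h6 (by positivity)
    have h8 : lam * (r ^ 2 / 4) ≤ ⟪a ξ, ξ⟫ := le_trans (by gcongr) h5
    have h9 : α ^ 2 * (lam * (r ^ 2 / 4)) ≤ α ^ 2 * ⟪a ξ, ξ⟫ := by gcongr
    have h10 : α * tr a ≤ α * Λ := by gcongr
    nlinarith
  -- conclusion
  have hne := h0 z0 hz.le
  have el : z0 + (0 : ℝ) • (y0 - z0) = z0 := by simp
  have a1 : HasDerivAt (fun t : ℝ => w (z0 + t • (y0 - z0))) ⟪gradient w z0, y0 - z0⟫ 0 := by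
    have := W.dh hne
    rw [← el] at this
    have h2 := this.comp_hasDerivAt (0 : ℝ) (line_hd z0 (y0 - z0) 0)
    rw [el] at h2
    exact h2
  have a2 := ((barrier_hd α z0 y0 (y0 - z0) 0).sub_const (Real.exp (-α * r ^ 2))).const_mul δ
  have a3 := a1.sub a2
  have hvz : v z0 = 0 := by
    rw [hv, hE]; simp only
    rw [real_inner_self_eq_norm_sq, hz, sub_self]
  have h1 := deriv_nonneg_right (b := 1 / 2) (by norm_num) a3 (by
    intro t ht0 ht1
    change w (z0 + (0 : ℝ) • (y0 - z0)) - δ * v (z0 + (0 : ℝ) • (y0 - z0)) ≤ w (z0 + t • (y0 - z0)) - δ * v (z0 + t • (y0 - z0))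
    rw [el, hw0, hvz]
    have e : z0 + t • (y0 - z0) - y0 = (1 - t) • (z0 - y0) := by module
    have hn : ‖z0 + t • (y0 - z0) - y0‖ = (1 - t) * r := by
      rw [e, norm_smul, Real.norm_of_nonneg (by linarith), hz]
    have := hcmp (z0 + t • (y0 - z0)) (by rw [hn]; nlinarith) (by rw [hn]; nlinarith)
    linarith)
  rw [el] at h1
  have h2 : ⟪z0 - y0, y0 - z0⟫ = -r ^ 2 := by
    rw [← neg_sub z0 y0, inner_neg_right, real_inner_self_eq_norm_sq, hz]
  rw [h2] at h1
  have h3 : 0 < δ * (Real.exp (-α * ⟪z0 - y0, z0 - y0⟫) * (-2 * α * -r ^ 2)) := by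
    have : -2 * α * -r ^ 2 = 2 * α * r ^ 2 := by ring
    rw [this]; positivity
  linarith


/-- reflection -/
def rf {n : ℕ} (e : Esp n) : Esp n →L[ℝ] Esp n := 1 - (2 : ℝ) • outer e e

section refl
variable {n : ℕ} {e : Esp n}

lemma rf_apply (e y : Esp n) : rf e y = y - (2 * ⟪e, y⟫) • e := by
  rw [rf, csub, cone, csmul, outer_apply, smul_smul]

lemma rf_sym (e v w : Esp n) : ⟪rf e v, w⟫ = ⟪v, rf e w⟫ := by
  rw [rf_apply, rf_apply, inner_sub_left, inner_sub_right, real_inner_smul_left, real_inner_smul_right,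
    real_inner_comm e v]; ring

lemma rf_rf (he : ‖e‖ = 1) (y : Esp n) : rf e (rf e y) = y := by
  rw [rf_apply, rf_apply, inner_sub_right, real_inner_smul_right, inner_unit he]; module

lemma rf_mul (he : ‖e‖ = 1) : rf e * rf e = 1 := by
  ext1 y; rw [cmul, rf_rf he, cone]

lemma rf_norm (he : ‖e‖ = 1) (y : Esp n) : ‖rf e y‖ = ‖y‖ := by
  have : ⟪rf e y, rf e y⟫ = ⟪y, y⟫ := by rw [rf_sym, rf_rf he]
  rw [real_inner_self_eq_norm_sq, real_inner_self_eq_norm_sq] at this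
  exact (pow_left_inj₀ (norm_nonneg _) (norm_nonneg _) (by norm_num)).1 this

lemma rf_ne (he : ‖e‖ = 1) {y : Esp n} (hy : y ≠ 0) : rf e y ≠ 0 := by
  intro h; apply hy; rw [← rf_rf he y, h, map_zero]

lemma grad_of {h : Esp n → ℝ} {g y : Esp n} (hd : HasFDerivAt h (innerSL ℝ g) y) : gradient h y = g := by
  apply HasGradientAt.gradient
  exact hd

lemma SH.comp_rf {h : Esp n → ℝ} (H : SH n h) (he : ‖e‖ = 1) : SH n (fun y => h (rf e y)) := by
  refine ⟨?_, ?_⟩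
  · intro y hy
    have h1 := H.cd (rf_ne he hy)
    exact (h1.comp y (rf e).contDiff.contDiffAt).contDiffWithinAt
  · intro r hr y
    simp only [map_smul]
    exact H.hom r hr _

lemma SH.sub {h k : Esp n → ℝ} (H : SH n h) (K : SH n k) : SH n (fun y => h y - k y) := by
  refine ⟨H.sm.sub K.sm, ?_⟩
  intro r hr y
  simp only
  rw [H.hom r hr, K.hom r hr]; ring

lemma SH.grad_rf {h : Esp n → ℝ} (H : SH n h) (he : ‖e‖ = 1) {y : Esp n} (hy : y ≠ 0) :
    gradient (fun y => h (rf e y)) y = rf e (gradient h (rf e y)) := by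
  apply grad_of
  have h1 := (H.dh (rf_ne he hy)).comp y (rf e).hasFDerivAt
  refine HasFDerivAt.congr_fderiv (f' := _) h1 ?_
  ext v
  simp only [ContinuousLinearMap.comp_apply, innerSL_apply_apply]
  rw [rf_sym]

lemma SH.hM_rf {h : Esp n → ℝ} (H : SH n h) (he : ‖e‖ = 1) {y : Esp n} (hy : y ≠ 0) :
    hM (fun y => h (rf e y)) y = rf e * hM h (rf e y) * rf e := by
  have h1 := (rf e).hasFDerivAt.comp y ((H.dG (rf_ne he hy)).comp y (rf e).hasFDerivAt)
  have h2 : (fun y => gradient (fun y => h (rf e y)) y) =ᶠ[nhds y] fun y => rf e (gradient h (rf e y)) := by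
    filter_upwards [isOpen_compl_singleton.mem_nhds hy] with z hz
    exact H.grad_rf he hz
  have h3 := (h1.congr_of_eventuallyEq h2).fderiv
  exact h3

lemma SH.grad_sub {h k : Esp n → ℝ} (H : SH n h) (K : SH n k) {y : Esp n} (hy : y ≠ 0) :
    gradient (fun y => h y - k y) y = gradient h y - gradient k y := by
  apply grad_of
  refine HasFDerivAt.congr_fderiv (f' := _) ((H.dh hy).sub (K.dh hy)) ?_
  rw [map_sub]

lemma SH.hM_sub {h k : Esp n → ℝ} (H : SH n h) (K : SH n k) {y : Esp n} (hy : y ≠ 0) :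
    hM (fun y => h y - k y) y = hM h y - hM k y := by
  have h2 : (fun y => gradient (fun y => h y - k y) y) =ᶠ[nhds y] fun y => gradient h y - gradient k y := by
    filter_upwards [isOpen_compl_singleton.mem_nhds hy] with z hz
    exact H.grad_sub K hz
  exact (((H.dG hy).sub (K.dG hy)).congr_of_eventuallyEq h2).fderiv

lemma Sol.comp_rf {C : ℝ} {h : Esp n → ℝ} (H : Sol n C h) (he : ‖e‖ = 1) : Sol n C (fun y => h (rf e y)) := by
  have key : ∀ x : Esp n, ‖x‖ = 1 → hM (fun y => h (rf e y)) x + outer x x =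
      rf e * (hM h (rf e x) + outer (rf e x) (rf e x)) * rf e := by
    intro x hx
    rw [H.toSH.hM_rf he (unit_ne hx), mul_add, add_mul]
    congr 1
    ext1 v
    rw [cmul, cmul, outer_apply, outer_apply, map_smul, rf_rf he, rf_sym, rf_rf he]
  refine ⟨H.toSH.comp_rf he, ?_, ?_⟩
  · intro x hx
    have hx' : ‖rf e x‖ = 1 := by rw [rf_norm he, hx]
    have hs := H.spd _ hx'
    rw [key x hx]
    refine ⟨?_, ?_⟩
    · intro v w
      rw [cmul, cmul, cmul, cmul, rf_sym, hs.1, rf_sym]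
    · intro v hv
      rw [cmul, cmul, rf_sym]
      exact hs.2 _ (rf_ne he hv)
  · intro x hx
    have hx' : ‖rf e x‖ = 1 := by rw [rf_norm he, hx]
    rw [key x hx, dt_mul, dt_mul, mul_comm (dt (rf e)), mul_assoc, ← dt_mul, rf_mul he, H.eq _ hx',
      H.toSH.grad_rf he (unit_ne hx)]
    have : rf e (gradient h (rf e x)) - h (rf e x) • x = rf e (gradient h (rf e x) - h (rf e x) • rf e x) := by
      rw [map_sub, map_smul, rf_rf he]
    rw [this, rf_norm he]
    have h1 : dt (1 : Esp n →L[ℝ] Esp n) = 1 := by simp [dt]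
    rw [h1, mul_one]

end refl

section ellip
variable {n : ℕ} {C : ℝ} {h k : Esp n → ℝ}

/-- differential inequality at unit vectors -/
lemma Sol.diff_ineq (H : Sol n C h) (K : Sol n C k) {x : Esp n} (hx : ‖x‖ = 1) :
    tr (Ring.inverse (hS h x) * hM (fun y => h y - k y) x) ≤
      ⟪(1 / 2 : ℝ) • (gradient h x + gradient k x), gradient (fun y => h y - k y) x⟫
        - (1 / 2) * (h x + k x) * (h x - k x) := by
  have hx0 := unit_ne hx
  obtain ⟨a, ha, ha1, ha2, hsym, hax, haM, hMa, htr⟩ := H.exists_inv hx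
  rw [← ha, H.toSH.hM_sub K.toSH hx0, H.toSH.grad_sub K.toSH hx0]
  have h1 := trace_ineq (H.spd x hx) (K.spd x hx) ha1
  have h2 : hM h x - hM k x = hS h x - (hM k x + outer x x) := by rw [hS]; abel
  rw [h2, mul_sub, tr_sub, ha1, tr_one]
  have eH := H.eqS hx
  have eK := K.eqS hx
  rw [hS] at eH eK
  rw [eH, eK, Real.log_mul H.C_pos.ne' (Real.exp_pos _).ne', Real.log_mul H.C_pos.ne' (Real.exp_pos _).ne',
    Real.log_exp, Real.log_exp] at h1
  rw [real_inner_smul_left, inner_add_left, inner_sub_right, inner_sub_right,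
    real_inner_comm (gradient h x) (gradient k x)]
  rw [s2, s2] at h1
  push_cast at h1 ⊢
  nlinarith
end ellip


section ellip
variable {n : ℕ} {C : ℝ} {h k : Esp n → ℝ}

set_option maxHeartbeats 800000 in
lemma Sol.ellip_data (H : Sol n C h) (K : Sol n C k) : ∃ lam Λ β κ : ℝ, 0 < lam ∧ 0 ≤ Λ ∧ 0 ≤ β ∧ 0 ≤ κ ∧
    ∀ x : Esp n, ‖x‖ = 1 → (∀ v w, ⟪Ring.inverse (hS h x) v, w⟫ = ⟪v, Ring.inverse (hS h x) w⟫) ∧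
      (∀ v, lam * ⟪v, v⟫ ≤ ⟪Ring.inverse (hS h x) v, v⟫) ∧ tr (Ring.inverse (hS h x)) ≤ Λ ∧
      ‖(1 / 2 : ℝ) • (gradient h x + gradient k x)‖ ≤ β ∧ -((1 / 2) * (h x + k x)) ≤ κ := by
  have hs : IsCompact (sphere (0 : Esp n) 1) := isCompact_sphere _ _
  have hun : ∀ x : Esp n, x ∈ sphere (0 : Esp n) 1 → ‖x‖ = 1 := fun x hx => by simpa using hx
  have ca : ContinuousOn (fun x => Ring.inverse (hS h x)) (sphere (0 : Esp n) 1) := fun x hx =>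
    (H.cd_inv (hun x hx)).continuousAt.continuousWithinAt
  have cg : ContinuousOn (gradient h) (sphere (0 : Esp n) 1) := fun x hx =>
    (H.toSH.cdG (unit_ne (hun x hx))).continuousAt.continuousWithinAt
  have cg' : ContinuousOn (gradient k) (sphere (0 : Esp n) 1) := fun x hx =>
    (K.toSH.cdG (unit_ne (hun x hx))).continuousAt.continuousWithinAt
  have ch : ContinuousOn h (sphere (0 : Esp n) 1) := fun x hx =>
    (H.toSH.cd (unit_ne (hun x hx))).continuousAt.continuousWithinAt
  have ck : ContinuousOn k (sphere (0 : Esp n) 1) := fun x hx =>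
    (K.toSH.cd (unit_ne (hun x hx))).continuousAt.continuousWithinAt
  obtain ⟨Λ, hΛ⟩ := hs.exists_bound_of_continuousOn (continuous_tr.comp_continuousOn ca)
  obtain ⟨β, hβ⟩ := hs.exists_bound_of_continuousOn ((cg.add cg').const_smul (1 / 2 : ℝ))
  obtain ⟨κ, hκ⟩ := hs.exists_bound_of_continuousOn (continuousOn_const.mul (ch.add ck) (f := fun _ => (1 / 2 : ℝ)))
  have h1 : ‖(EuclideanSpace.single 0 1 : Esp n)‖ = 1 := by simp
  have hpair : ContinuousOn (fun p : Esp n × Esp n => ⟪Ring.inverse (hS h p.1) p.2, p.2⟫)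
      (sphere (0 : Esp n) 1 ×ˢ sphere (0 : Esp n) 1) := by
    apply ContinuousOn.inner
    · apply ContinuousOn.clm_apply
      · exact ca.comp continuousOn_fst (fun p hp => hp.1)
      · exact continuousOn_snd
    · exact continuousOn_snd
  obtain ⟨pm, hpm, hmin⟩ := (hs.prod hs).exists_isMinOn
    ⟨((EuclideanSpace.single 0 1 : Esp n), (EuclideanSpace.single 0 1 : Esp n)),
      ⟨by simpa using h1, by simpa using h1⟩⟩ hpair
  have hposi : ∀ x : Esp n, ‖x‖ = 1 → ∀ v : Esp n, v ≠ 0 → 0 < ⟪Ring.inverse (hS h x) v, v⟫ := by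
    intro x hx v hv
    obtain ⟨a, ha, ha1, ha2, hsym, -⟩ := H.exists_inv hx
    rw [← ha]
    have h2 : hS h x (a v) = v := by rw [← cmul, ha2, cone]
    have h3 : a v ≠ 0 := by
      intro h0; rw [h0, map_zero] at h2; exact hv h2.symm
    have h4 := (H.spd x hx).2 _ h3
    have h5 : ⟪hS h x (a v), a v⟫ = ⟪a v, v⟫ := by rw [h2, real_inner_comm]
    rw [← h5]; exact h4
  have hz : (EuclideanSpace.single 0 1 : Esp n) ∈ sphere (0 : Esp n) 1 := by simpa using h1
  refine ⟨⟪Ring.inverse (hS h pm.1) pm.2, pm.2⟫, Λ, β, κ, hposi _ (hun _ hpm.1) _ (unit_ne (hun _ hpm.2)),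
    (norm_nonneg _).trans (hΛ _ hz), (norm_nonneg _).trans (hβ _ hz), (norm_nonneg _).trans (hκ _ hz), ?_⟩
  intro x hx
  have hx' : x ∈ sphere (0 : Esp n) 1 := by simpa using hx
  refine ⟨?_, ?_, ?_, hβ x hx', ?_⟩
  · obtain ⟨a, ha, ha1, ha2, hsym, -⟩ := H.exists_inv hx
    rw [← ha]; exact hsym
  · intro v
    by_cases hv : v = 0
    · simp [hv]
    have hmem : (x, nrm v) ∈ sphere (0 : Esp n) 1 ×ˢ sphere (0 : Esp n) 1 :=
      ⟨hx', by rw [mem_sphere_iff_norm, sub_zero]; exact norm_nrm hv⟩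
    have h2 := isMinOn_iff.1 hmin _ hmem
    simp only at h2
    have h3 : ⟪Ring.inverse (hS h x) v, v⟫ = ‖v‖ ^ 2 * ⟪Ring.inverse (hS h x) (nrm v), nrm v⟫ := by
      conv_lhs => rw [← norm_smul_nrm hv, map_smul, real_inner_smul_left, real_inner_smul_right]
      ring
    rw [h3, real_inner_self_eq_norm_sq v, mul_comm]
    exact mul_le_mul_of_nonneg_left h2 (sq_nonneg _)
  · exact (le_abs_self _).trans (hΛ x hx')
  · exact (neg_le_abs _).trans (hκ x hx')

lemma Sol.hopf' (H : Sol n C h) (K : Sol n C k) (y0 : Esp n) (r : ℝ) (hr : 0 < r)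
    (h0 : ∀ y, ‖y - y0‖ ≤ r → y ≠ 0) (hnn : ∀ y, ‖y - y0‖ ≤ r → 0 ≤ h y - k y)
    (hpos : ∀ y, ‖y - y0‖ < r → 0 < h y - k y) (z0 : Esp n) (hz : ‖z0 - y0‖ = r) (hw0 : h z0 - k z0 = 0) :
    0 < ⟪gradient (fun y => h y - k y) z0, y0 - z0⟫ := by
  obtain ⟨lam, Λ, β, κ, hlam, hΛ, hβ, hκ, hx⟩ := H.ellip_data K
  have W := H.toSH.sub K.toSH
  obtain ⟨ym, hym, hmin⟩ := (isCompact_closedBall y0 r).exists_isMinOn ⟨y0, mem_closedBall_self hr.le⟩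
    (continuous_norm.continuousOn (s := closedBall y0 r))
  have hρ : 0 < ‖ym‖ := norm_pos_iff.2 (h0 ym (by rwa [mem_closedBall_iff_norm] at hym))
  refine hopf W y0 r hr h0 lam Λ (‖ym‖⁻¹ * β) (‖ym‖⁻¹ ^ 2 * κ) hlam hΛ (by positivity) (by positivity) ?_ hpos z0 hz hw0
  intro y hy
  have hy0 := h0 y hy
  have hyp : 0 < ‖y‖ := norm_pos_iff.2 hy0
  have hle : ‖ym‖ ≤ ‖y‖ := hmin (by rwa [mem_closedBall_iff_norm])
  have hinv : ‖y‖⁻¹ ≤ ‖ym‖⁻¹ := inv_anti₀ hρ hle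
  have hu := norm_nrm hy0
  obtain ⟨h1, h2, h3, h4, h5⟩ := hx _ hu
  have hd := H.diff_ineq K hu
  refine ⟨Ring.inverse (hS h (nrm y)), ‖y‖⁻¹ • ((1 / 2 : ℝ) • (gradient h (nrm y) + gradient k (nrm y))), h1, h2, h3, ?_, ?_⟩
  · rw [norm_smul, norm_inv, norm_norm]
    exact mul_le_mul hinv h4 (norm_nonneg _) (by positivity)
  · have e1 : hM (fun y => h y - k y) y = ‖y‖⁻¹ • hM (fun y => h y - k y) (nrm y) := by
      conv_lhs => rw [← norm_smul_nrm hy0]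
      exact W.Mhom (unit_ne hu) hyp
    have e2 : gradient (fun y => h y - k y) y = gradient (fun y => h y - k y) (nrm y) := by
      conv_lhs => rw [← norm_smul_nrm hy0]
      exact W.Ghom (unit_ne hu) hyp
    have e3 : h y - k y = ‖y‖ * (h (nrm y) - k (nrm y)) := by
      conv_lhs => rw [← norm_smul_nrm hy0]
      exact W.hom _ hyp _
    have hnn' := hnn y hy
    rw [e1, e2, cmul_smul, tr_smul, real_inner_smul_left]
    have h6 : ‖y‖⁻¹ * tr (Ring.inverse (hS h (nrm y)) * hM (fun y => h y - k y) (nrm y)) ≤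
      ‖y‖⁻¹ * (⟪(1 / 2 : ℝ) • (gradient h (nrm y) + gradient k (nrm y)), gradient (fun y => h y - k y) (nrm y)⟫
        - (1 / 2) * (h (nrm y) + k (nrm y)) * (h (nrm y) - k (nrm y))) := by gcongr
    refine h6.trans ?_
    have h7 : h (nrm y) - k (nrm y) = ‖y‖⁻¹ * (h y - k y) := by rw [e3]; field_simp
    have h8 : ‖y‖⁻¹ * (-((1 / 2) * (h (nrm y) + k (nrm y))) * (h (nrm y) - k (nrm y))) ≤
       ‖ym‖⁻¹ ^ 2 * κ * (h y - k y) := by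
      rw [h7]
      calc ‖y‖⁻¹ * (-((1 / 2) * (h (nrm y) + k (nrm y))) * (‖y‖⁻¹ * (h y - k y)))
          = (‖y‖⁻¹ ^ 2 * (h y - k y)) * (-((1 / 2) * (h (nrm y) + k (nrm y)))) := by ring
        _ ≤ (‖y‖⁻¹ ^ 2 * (h y - k y)) * κ := by gcongr
        _ ≤ (‖ym‖⁻¹ ^ 2 * (h y - k y)) * κ := by gcongr
        _ = _ := by ring
    linarith

/-- strong maximum principle on a half space -/
lemma Sol.smp (H : Sol n C h) (K : Sol n C k) (e : Esp n) (hd : ∀ y, 0 < ⟪e, y⟫ → 0 ≤ h y - k y)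
    (p : Esp n) (hp : 0 < ⟪e, p⟫) (hp0 : h p - k p = 0) : ∀ y, 0 < ⟪e, y⟫ → h y - k y = 0 := by
  have W := H.toSH.sub K.toSH
  have hne : ∀ y, 0 < ⟪e, y⟫ → y ≠ 0 := by
    rintro y hy rfl; simp at hy
  have hΩo : IsOpen {y : Esp n | 0 < ⟪e, y⟫} := by
    have : Continuous fun y : Esp n => ⟪e, y⟫ := by fun_prop
    exact isOpen_lt continuous_const this
  have hΩc : Convex ℝ {y : Esp n | 0 < ⟪e, y⟫} := by
    intro x hx y hy s t hs ht hst
    simp only [Set.mem_setOf_eq, inner_add_right, real_inner_smul_right] at hx hy ⊢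
    rcases hs.lt_or_eq with h1 | h1
    · have := mul_pos h1 hx; have := mul_nonneg ht hy.le; linarith
    · have : t = 1 := by linarith
      rw [← h1, this]; linarith
  have hdc : ContinuousOn (fun y => h y - k y) {y : Esp n | 0 < ⟪e, y⟫} := fun y hy =>
    (W.cd (hne y hy)).continuousAt.continuousWithinAt
  have hO1 : IsOpen ({y : Esp n | 0 < ⟪e, y⟫} ∩ (fun y => h y - k y) ⁻¹' Set.Ioi 0) :=
    hdc.isOpen_inter_preimage hΩo isOpen_Ioi
  have hO2 : IsOpen ({y : Esp n | 0 < ⟪e, y⟫ ∧ h y - k y = 0}) := by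
    rw [isOpen_iff]
    rintro z ⟨hz, hz0⟩
    obtain ⟨ρ, hρ, hball⟩ := isOpen_iff.1 hΩo z hz
    refine ⟨ρ / 2, by linarith, ?_⟩
    intro y1 hy1
    rw [mem_ball_iff_norm] at hy1
    have hy1Ω : 0 < ⟪e, y1⟫ := hball (by rw [mem_ball_iff_norm]; linarith)
    refine ⟨hy1Ω, ?_⟩
    by_contra hcon
    have hy1p : 0 < h y1 - k y1 := lt_of_le_of_ne (hd y1 hy1Ω) (Ne.symm hcon)
    have hsub : ∀ y, ‖y - y1‖ ≤ ‖z - y1‖ → 0 < ⟪e, y⟫ := by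
      intro y hy
      apply hball
      rw [mem_ball_iff_norm]
      have : y - z = (y - y1) + (y1 - z) := by abel
      rw [this]
      have := norm_add_le (y - y1) (y1 - z)
      rw [norm_sub_rev z y1] at hy
      linarith
    have hAc : IsCompact (closedBall y1 ‖z - y1‖ ∩ (fun y => h y - k y) ⁻¹' {0}) := by
      apply (isCompact_closedBall y1 ‖z - y1‖).of_isClosed_subset _ Set.inter_subset_left
      apply ContinuousOn.preimage_isClosed_of_isClosed _ isClosed_closedBall isClosed_singleton
      apply hdc.mono
      intro y hy; rw [mem_closedBall_iff_norm] at hy; exact hsub y hy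
    have hnc : Continuous fun y : Esp n => ‖y - y1‖ := by fun_prop
    obtain ⟨z0, ⟨hz0b, hz00⟩, hmin⟩ := hAc.exists_isMinOn
      ⟨z, by rw [mem_closedBall_iff_norm], hz0⟩ hnc.continuousOn
    rw [mem_closedBall_iff_norm] at hz0b
    have hz00' : h z0 - k z0 = 0 := hz00
    have hr : 0 < ‖z0 - y1‖ := by
      rw [norm_pos_iff, sub_ne_zero]; rintro rfl; linarith
    have hz0Ω := hsub z0 hz0b
    have := H.hopf' K y1 ‖z0 - y1‖ hr (fun y hy => hne y (hsub y (hy.trans hz0b)))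
      (fun y hy => hd y (hsub y (hy.trans hz0b))) ?_ z0 rfl hz00'
    · have hloc : IsLocalMin (fun y => h y - k y) z0 := by
        filter_upwards [hΩo.mem_nhds hz0Ω] with y hy
        rw [hz00']; exact hd y hy
      have h1 := hloc.hasFDerivAt_eq_zero (W.dh (hne z0 hz0Ω))
      have h2 := DFunLike.congr_fun h1 (y1 - z0)
      rw [innerSL_apply_apply, ContinuousLinearMap.zero_apply] at h2
      linarith
    · intro y hy
      have hyΩ := hsub y (hy.le.trans hz0b)
      refine lt_of_le_of_ne (hd y hyΩ) (fun h0 => ?_)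
      have h3 : ‖z0 - y1‖ ≤ ‖y - y1‖ := hmin
        (show y ∈ closedBall y1 ‖z - y1‖ ∩ (fun y => h y - k y) ⁻¹' {0} from
          ⟨by rw [mem_closedBall_iff_norm]; exact hy.le.trans hz0b, h0.symm⟩)
      linarith
  intro y hy
  by_contra hcon
  have hyp : 0 < h y - k y := lt_of_le_of_ne (hd y hy) (Ne.symm hcon)
  obtain ⟨q, -, hq1, hq2⟩ := hΩc.isPreconnected _ _ hO1 hO2 (by
    intro q hq
    rcases (hd q hq).lt_or_eq with h1 | h1
    · exact Or.inl ⟨hq, h1⟩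
    · exact Or.inr ⟨hq, h1.symm⟩) ⟨y, hy, hy, hyp⟩ ⟨p, hp, hp, hp0⟩
  have : 0 < h q - k q := hq1.2
  linarith [hq2.2]

lemma Sol.refl_rigid (H : Sol n C h) {e : Esp n} (he : ‖e‖ = 1)
    (hd : ∀ y, 0 < ⟪e, y⟫ → 0 ≤ h y - h (rf e y))
    (hz : (∃ y, 0 < ⟪e, y⟫ ∧ h y - h (rf e y) = 0) ∨ (∃ y, ‖y‖ = 1 ∧ ⟪e, y⟫ = 0 ∧ ⟪gradient h y, e⟫ = 0)) :
    ∀ y, h (rf e y) = h y := by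
  have K := H.comp_rf he
  have hrf0 : ∀ y, ⟪e, y⟫ = 0 → rf e y = y := by
    intro y hy; rw [rf_apply, hy, mul_zero, zero_smul, sub_zero]
  have hp : ∃ y, 0 < ⟪e, y⟫ ∧ h y - h (rf e y) = 0 := by
    rcases hz with h1 | ⟨y, hy, hey, hgy⟩
    · exact h1
    by_contra hcon
    push Not at hcon
    have hpos : ∀ z, 0 < ⟪e, z⟫ → 0 < h z - h (rf e z) := fun z hz =>
      lt_of_le_of_ne (hd z hz) (Ne.symm (hcon z hz))
    have hin : ∀ z : Esp n, 1 / 2 - ‖z - (y + (1 / 2 : ℝ) • e)‖ ≤ ⟪e, z⟫ := by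
      intro z
      have h1 := abs_real_inner_le_norm e (z - (y + (1 / 2 : ℝ) • e))
      rw [inner_sub_right, inner_add_right, real_inner_smul_right, inner_unit he, hey, he] at h1
      have := neg_abs_le (⟪e, z⟫ - (0 + 1 / 2 * 1))
      linarith
    have hnz : ∀ z : Esp n, ‖z - (y + (1 / 2 : ℝ) • e)‖ ≤ 1 / 2 → z ≠ 0 := by
      rintro z hz rfl
      rw [zero_sub, norm_neg] at hz
      have h1 := inner_unit hy
      have h2 : ‖y + (1 / 2 : ℝ) • e‖ ^ 2 = 5 / 4 := by
        rw [← real_inner_self_eq_norm_sq]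
        simp only [inner_add_left, inner_add_right, real_inner_smul_left, real_inner_smul_right,
          inner_unit he, hey, real_inner_comm e y, h1]
        norm_num
      nlinarith [norm_nonneg (y + (1 / 2 : ℝ) • e)]
    have := H.hopf' K (y + (1 / 2 : ℝ) • e) (1 / 2) (by norm_num) hnz ?_ ?_ y ?_ ?_
    · rw [H.toSH.grad_sub K.toSH (unit_ne hy), H.toSH.grad_rf he (unit_ne hy), hrf0 y hey,
        rf_apply, real_inner_comm (gradient h y) e, hgy] at this
      simp at this
    · intro z hz
      rcases (show 0 ≤ ⟪e, z⟫ by linarith [hin z]).lt_or_eq with h1 | h1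
      · exact hd z h1
      · simp only [hrf0 z h1.symm, sub_self, le_refl]
    · intro z hz
      exact hpos z (by linarith [hin z])
    · rw [sub_add_cancel_left, norm_neg, norm_smul, he]; norm_num
    · simp only [hrf0 y hey, sub_self]
  obtain ⟨p, hp, hp0⟩ := hp
  have h1 := H.smp K e hd p hp hp0
  intro y
  rcases lt_trichotomy ⟪e, y⟫ 0 with h2 | h2 | h2
  · have h3 : ⟪e, rf e y⟫ = -⟪e, y⟫ := by
      rw [rf_apply, inner_sub_right, real_inner_smul_right, inner_unit he]; ring
    have h4 := h1 (rf e y) (by linarith)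
    simp only [rf_rf he] at h4
    linarith
  · rw [hrf0 y h2]
  · linarith [h1 y h2]
end ellip


section mp
variable {n : ℕ} {C : ℝ} {h : Esp n → ℝ}

/-- averaged derivative -/
def Ii (h : Esp n → ℝ) (e z : Esp n) (φ : ℝ) : ℝ :=
  ∫ τ in (-1 : ℝ)..1, ⟪gradient h (gc z e (φ * τ)), gc' z e (φ * τ)⟫

lemma rf_gc {e z : Esp n} (he : ‖e‖ = 1) (hz : ⟪e, z⟫ = 0) (φ : ℝ) : rf e (gc z e φ) = gc z e (-φ) := by
  rw [rf_apply, gc, gc, inner_add_right, real_inner_smul_right, real_inner_smul_right, hz, inner_unit he,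
    Real.cos_neg, Real.sin_neg]
  module

lemma SH.Ii_mul (H : SH n h) {e z : Esp n} (he : ‖e‖ = 1) (hz : ‖z‖ = 1) (hez : ⟪e, z⟫ = 0) (φ : ℝ) :
    φ * Ii h e z φ = h (gc z e φ) - h (rf e (gc z e φ)) := by
  have hze : ⟪z, e⟫ = 0 := by rw [real_inner_comm, hez]
  rw [rf_gc he hez, Ii, ← intervalIntegral.integral_const_mul]
  have hd : ∀ τ : ℝ, HasDerivAt (fun τ => h (gc z e (φ * τ)))
      (φ * ⟪gradient h (gc z e (φ * τ)), gc' z e (φ * τ)⟫) τ := by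
    intro τ
    have h1 := H.f_hd hz he hze (φ * τ)
    have h2 : HasDerivAt (fun τ : ℝ => φ * τ) φ τ := by
      simpa using (hasDerivAt_id τ).const_mul φ
    have h3 := h1.comp τ h2
    refine HasDerivAt.congr_deriv (f' := _) h3 ?_
    ring
  have hc : Continuous fun τ : ℝ => φ * ⟪gradient h (gc z e (φ * τ)), gc' z e (φ * τ)⟫ := by
    have h1 : Continuous fun t : ℝ => ⟪gradient h (gc z e t), gc' z e t⟫ :=
      continuous_iff_continuousAt.2 fun t => (H.f'_hd hz he hze t).continuousAt
    exact continuous_const.mul (h1.comp (continuous_const.mul continuous_id))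
  rw [intervalIntegral.integral_eq_sub_of_hasDerivAt (fun τ _ => hd τ) (hc.intervalIntegrable _ _)]
  simp

lemma Ii_zero (e z : Esp n) : Ii h e z 0 = 2 * ⟪gradient h z, e⟫ := by
  have h1 : gc z e 0 = z := by simp [gc]
  have h2 : gc' z e 0 = e := by simp [gc']
  simp only [Ii, zero_mul, h1, h2, intervalIntegral.integral_const, smul_eq_mul]
  norm_num

lemma SH.d_nonneg (H : SH n h) (hn : 1 ≤ n) {e : Esp n} (he : ‖e‖ = 1)
    (hI : ∀ z, ‖z‖ = 1 → ⟪e, z⟫ = 0 → ∀ φ, 0 ≤ φ → φ ≤ Real.pi / 2 → 0 ≤ Ii h e z φ) :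
    ∀ y, 0 < ⟪e, y⟫ → 0 ≤ h y - h (rf e y) := by
  intro y hy
  have hy0 : y ≠ 0 := by rintro rfl; simp at hy
  have hyp : 0 < ‖y‖ := norm_pos_iff.2 hy0
  obtain ⟨u, hu, heu, s, hs0, hspi, hsy⟩ := exists_gc hn he (norm_nrm hy0)
  have h1 : ⟪e, nrm y⟫ = Real.cos s := by
    rw [hsy, gc, inner_add_right, real_inner_smul_right, real_inner_smul_right, inner_unit he, heu]; ring
  have h2 : 0 < Real.cos s := by
    rw [← h1, nrm, real_inner_smul_right]; positivity
  have hs2 : s ≤ Real.pi / 2 := by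
    by_contra hcon
    push Not at hcon
    have := Real.cos_nonpos_of_pi_div_two_le_of_le hcon.le (by linarith [Real.pi_pos])
    linarith
  have h3 : nrm y = gc u e (Real.pi / 2 - s) := by
    rw [hsy, gc, gc, Real.cos_pi_div_two_sub, Real.sin_pi_div_two_sub, add_comm]
  have h4 := H.Ii_mul he hu heu (Real.pi / 2 - s)
  have h5 := hI u hu heu (Real.pi / 2 - s) (by linarith) (by linarith)
  rw [← h3] at h4
  have h6 : 0 ≤ h (nrm y) - h (rf e (nrm y)) := by
    rw [← h4]; exact mul_nonneg (by linarith) h5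
  have h7 : h y - h (rf e y) = ‖y‖ * (h (nrm y) - h (rf e (nrm y))) := by
    conv_lhs => rw [← norm_smul_nrm hy0, map_smul]
    rw [H.hom _ hyp, H.hom _ hyp]; ring
  rw [h7]; positivity

lemma Sol.support_le (H : Sol n C h) (hn : 1 ≤ n) {z y : Esp n} (hz : ‖z‖ = 1) (hy : ‖y‖ = 1) :
    ⟪gradient h z, y⟫ ≤ h y := by
  by_cases hzy : y = z
  · rw [hzy, H.toSH.euler (unit_ne hz)]
  · exact (H.support hn hz hy hzy).le

lemma Sol.Ii_pos0 (H : Sol n C h) (hn : 1 ≤ n) {x0 : Esp n} (hx0 : ‖x0‖ = 1) (hneg : h x0 < 0)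
    {z : Esp n} (hz : ‖z‖ = 1) (hez : ⟪-x0, z⟫ = 0) {φ : ℝ} (h0 : 0 ≤ φ) (h1 : φ ≤ Real.pi / 2) :
    0 < Ii h (-x0) z φ := by
  have he : ‖-x0‖ = 1 := by rw [norm_neg, hx0]
  have hze : ⟪z, -x0⟫ = 0 := by rw [real_inner_comm, hez]
  rcases h0.lt_or_eq with h2 | h2
  · have h3 := H.toSH.Ii_mul he hz hez φ
    have hy := gc_norm hz he hze φ
    set y := gc z (-x0) φ with hyd
    have hr : ‖rf (-x0) y‖ = 1 := by rw [rf_norm he, hy]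
    have hs : ⟪-x0, y⟫ = Real.sin φ := by
      rw [hyd, gc, inner_add_right, real_inner_smul_right, real_inner_smul_right, hez, inner_unit he]; ring
    have hsp : 0 < Real.sin φ := Real.sin_pos_of_pos_of_lt_pi h2 (by linarith [Real.pi_pos])
    have h4 := H.support_le hn hr hy
    have h5 := H.support_le hn hr hx0
    have h6 := H.toSH.euler (unit_ne hr)
    have h7 : ⟪gradient h (rf (-x0) y), y⟫ = h (rf (-x0) y) - 2 * Real.sin φ * ⟪gradient h (rf (-x0) y), x0⟫ := by
      have e1 : y = rf (-x0) y - (2 * Real.sin φ) • x0 := by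
        rw [rf_apply, hs]; module
      have e2 : ⟪gradient h (rf (-x0) y), y⟫ = ⟪gradient h (rf (-x0) y), rf (-x0) y - (2 * Real.sin φ) • x0⟫ := by
        rw [← e1]
      rw [e2, inner_sub_right, real_inner_smul_right, h6]
    have h8 : 0 < φ * Ii h (-x0) z φ := by rw [h3]; nlinarith
    exact pos_of_mul_pos_right h8 h0
  · rw [← h2, Ii_zero, inner_neg_right]
    have := H.support_le hn hz hx0
    linarith

lemma Sol.Ii_cont (H : Sol n C h) (x0 e : Esp n) (hx0 : ‖x0‖ = 1) (he : ‖e‖ = 1) (hxe : ⟪-x0, e⟫ = 0)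
    (K : Set (ℝ × Esp n × ℝ)) (hK : ∀ p ∈ K, ‖p.2.1‖ = 1 ∧ ⟪gc (-x0) e p.1, p.2.1⟫ = 0) :
    ContinuousOn (fun p : ℝ × Esp n × ℝ => Ii h (gc (-x0) e p.1) p.2.1 p.2.2) K := by
  rw [continuousOn_iff_continuous_restrict]
  have hx0' : ‖-x0‖ = 1 := by rw [norm_neg, hx0]
  have c1 : Continuous fun q : K × ℝ => gc (q.1.1.2.1) (gc (-x0) e q.1.1.1) (q.1.1.2.2 * q.2) := by
    unfold gc; fun_prop
  have c2 : Continuous fun q : K × ℝ => gc' (q.1.1.2.1) (gc (-x0) e q.1.1.1) (q.1.1.2.2 * q.2) := by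
    unfold gc' gc; fun_prop
  have cG : ContinuousOn (gradient h) {y | y ≠ 0} := fun y hy => (H.toSH.cdG hy).continuousAt.continuousWithinAt
  have c3 := cG.comp_continuous c1 (by
    intro q
    obtain ⟨h1, h2⟩ := hK _ q.1.2
    exact unit_ne (gc_norm h1 (gc_norm hx0' he hxe _) (by rw [real_inner_comm]; exact h2) _))
  have c4 := c3.inner c2 (𝕜 := ℝ)
  exact intervalIntegral.continuous_parametric_intervalIntegral_of_continuous'
    (f := fun (p : K) (τ : ℝ) => ⟪gradient h (gc (p.1.2.1) (gc (-x0) e p.1.1) (p.1.2.2 * τ)),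
      gc' (p.1.2.1) (gc (-x0) e p.1.1) (p.1.2.2 * τ)⟫) c4 (-1) 1

theorem Sol.sym_of_neg (H : Sol n C h) (hn : 1 ≤ n) {x0 : Esp n} (hx0 : ‖x0‖ = 1)
    (hmin : ∀ x : Esp n, ‖x‖ = 1 → h x0 ≤ h x) (hneg : h x0 < 0) {e : Esp n} (he : ‖e‖ = 1)
    (hxe : ⟪x0, e⟫ = 0) : ∀ y, h (rf e y) = h y := by
  have hx0' : ‖-x0‖ = 1 := by rw [norm_neg, hx0]
  have hxe' : ⟪-x0, e⟫ = 0 := by rw [inner_neg_left, hxe, neg_zero]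
  set et : ℝ → Esp n := fun t => gc (-x0) e t with het
  have hetn : ∀ t, ‖et t‖ = 1 := fun t => gc_norm hx0' he hxe' t
  have hetc : Continuous et := by rw [het]; unfold gc; fun_prop
  have het0 : et 0 = -x0 := by simp [het, gc]
  have hetp : et (Real.pi / 2) = e := by simp [het, gc]
  have hpi := Real.pi_pos
  set K : Set (ℝ × Esp n × ℝ) := {p | (p.1 ∈ Set.Icc 0 (Real.pi / 2) ∧ p.2.1 ∈ sphere (0 : Esp n) 1 ∧
    p.2.2 ∈ Set.Icc 0 (Real.pi / 2)) ∧ ⟪et p.1, p.2.1⟫ = 0} with hKd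
  have hKc : IsCompact K := by
    have h1 : IsCompact (Set.Icc (0 : ℝ) (Real.pi / 2) ×ˢ (sphere (0 : Esp n) 1 ×ˢ Set.Icc (0 : ℝ) (Real.pi / 2))) :=
      isCompact_Icc.prod ((isCompact_sphere _ _).prod isCompact_Icc)
    have h2 : IsClosed {p : ℝ × Esp n × ℝ | ⟪et p.1, p.2.1⟫ = 0} := by
      have : Continuous fun p : ℝ × Esp n × ℝ => ⟪et p.1, p.2.1⟫ := by fun_prop
      exact isClosed_eq this continuous_const
    exact h1.inter_right h2
  have hIc := H.Ii_cont x0 e hx0 he hxe' K (fun p hp => ⟨by simpa using hp.1.2.1, hp.2⟩)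
  set S := K ∩ (fun p : ℝ × Esp n × ℝ => Ii h (gc (-x0) e p.1) p.2.1 p.2.2) ⁻¹' Set.Iic 0 with hS
  have hSc : IsCompact S := hKc.of_isClosed_subset
    (hIc.preimage_isClosed_of_isClosed hKc.isClosed isClosed_Iic) Set.inter_subset_left
  have hSne : S.Nonempty := by
    refine ⟨(Real.pi / 2, x0, 0), ⟨⟨⟨by positivity, le_refl _⟩, by simpa using hx0, le_refl _, by positivity⟩, ?_⟩, ?_⟩
    · simp only [hetp]; rw [real_inner_comm, hxe]
    · show Ii h (et (Real.pi / 2)) x0 0 ≤ 0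
      rw [hetp, Ii_zero, H.crit hx0 hmin hxe, mul_zero]
  obtain ⟨p, ⟨⟨⟨hpt, hpz, hpφ⟩, hpe⟩, hpI⟩, hpm⟩ := hSc.exists_isMinOn hSne continuous_fst.continuousOn
  obtain ⟨t, z, φ⟩ := p
  simp only at hpt hpz hpφ hpe
  have hpI : Ii h (et t) z φ ≤ 0 := hpI
  have hz : ‖z‖ = 1 := by simpa using hpz
  have hIpos : ∀ s, 0 ≤ s → s < t → ∀ z, ‖z‖ = 1 → ⟪et s, z⟫ = 0 → ∀ φ, 0 ≤ φ → φ ≤ Real.pi / 2 → 0 ≤ Ii h (et s) z φ := by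
    intro s hs0 hst z' hz' hez' φ' h1 h2
    by_contra hcon
    push Not at hcon
    have h3 : (s, z', φ') ∈ S := ⟨⟨⟨⟨hs0, by linarith [hpt.2]⟩, by simpa using hz', h1, h2⟩, hez'⟩, hcon.le⟩
    have h4 := isMinOn_iff.1 hpm _ h3
    simp only at h4
    linarith
  have ht0 : 0 < t := by
    rcases hpt.1.lt_or_eq with h1 | h1
    · exact h1
    · exfalso
      rw [← h1, het0] at hpe hpI
      have := H.Ii_pos0 hn hx0 hneg hz hpe hpφ.1 hpφ.2
      linarith
  have hd : ∀ y, 0 < ⟪et t, y⟫ → 0 ≤ h y - h (rf (et t) y) := by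
    intro y hy
    have hy0 : y ≠ 0 := by rintro rfl; simp at hy
    have c1 : Continuous fun s => ⟪et s, y⟫ := by fun_prop
    have c2 : Continuous fun s => rf (et s) y := by
      simp only [rf_apply]; fun_prop
    have c3 : ContinuousAt (fun s => h y - h (rf (et s) y)) t := by
      have h1 : ContinuousAt h (rf (et t) y) := (H.toSH.cd (rf_ne (hetn t) hy0)).continuousAt
      exact continuousAt_const.sub (ContinuousAt.comp (f := fun s => rf (et s) y) h1 c2.continuousAt)
    have c4 : Filter.Tendsto (fun s => h y - h (rf (et s) y)) (nhdsWithin t (Set.Iio t)) (nhds (h y - h (rf (et t) y))) :=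
      c3.tendsto.mono_left nhdsWithin_le_nhds
    refine ge_of_tendsto c4 ?_
    have h5 : ∀ᶠ s in nhdsWithin t (Set.Iio t), 0 < ⟪et s, y⟫ :=
      (c1.continuousAt.eventually (isOpen_Ioi.mem_nhds hy)).filter_mono nhdsWithin_le_nhds
    filter_upwards [h5, Ioo_mem_nhdsLT ht0] with s hs1 hs2
    exact H.toSH.d_nonneg hn (hetn s) (hIpos s hs2.1.le hs2.2) y hs1
  have hez : ⟪z, et t⟫ = 0 := by rw [real_inner_comm]; exact hpe
  have key := H.refl_rigid (hetn t) hd (by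
    rcases hpφ.1.lt_or_eq with h1 | h1
    · left
      have h2 := H.toSH.Ii_mul (hetn t) hz hpe φ
      have h3 : 0 < ⟪et t, gc z (et t) φ⟫ := by
        rw [gc, inner_add_right, real_inner_smul_right, real_inner_smul_right, hpe, inner_unit (hetn t)]
        have := Real.sin_pos_of_pos_of_lt_pi h1 (by linarith [hpφ.2])
        linarith
      refine ⟨_, h3, le_antisymm ?_ (hd _ h3)⟩
      rw [← h2]; exact mul_nonpos_of_nonneg_of_nonpos h1.le hpI
    · right
      refine ⟨z, hz, hpe, le_antisymm ?_ ?_⟩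
      · rw [← h1, Ii_zero] at hpI; linarith
      · have hd1 := H.toSH.f_hd hz (hetn t) hez 0
        have hd2 : HasDerivAt (fun s : ℝ => h (gc z (et t) (-s))) (-⟪gradient h (gc z (et t) 0), gc' z (et t) 0⟫) 0 := by
          have h3 : HasDerivAt (fun t' => h (gc z (et t) t')) ⟪gradient h (gc z (et t) 0), gc' z (et t) 0⟫ (-0) := by
            rw [neg_zero]; exact hd1
          have h4 := h3.comp (0 : ℝ) (hasDerivAt_neg (0 : ℝ))
          refine HasDerivAt.congr_deriv (f' := _) h4 ?_
          ring
        have hd3 := hd1.sub hd2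
        have h5 := ge_of_tendsto (hasDerivAt_iff_tendsto_slope.1 hd3 |>.mono_left
          (nhdsWithin_mono (0 : ℝ) (fun x (hx : x ∈ Set.Ioi (0 : ℝ)) => ne_of_gt hx))) (b := 0) (by
            filter_upwards [Ioo_mem_nhdsGT hpi] with s hs
            rw [slope_def_field]
            apply div_nonneg _ (by linarith [hs.1])
            simp only [neg_zero, Pi.sub_apply, sub_self, sub_zero]
            rw [← rf_gc (hetn t) hpe]
            apply hd
            rw [gc, inner_add_right, real_inner_smul_right, real_inner_smul_right, hpe, inner_unit (hetn t)]
            have := Real.sin_pos_of_pos_of_lt_pi hs.1 hs.2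
            linarith)
        have h6 : gc z (et t) 0 = z := by simp [gc]
        have h7 : gc' z (et t) 0 = et t := by simp [gc']
        rw [h6, h7] at h5
        linarith)
  rcases hpt.2.lt_or_eq with h1 | h1
  · exfalso
    have h2 := key x0
    have hcos : 0 < Real.cos t := Real.cos_pos_of_mem_Ioo ⟨by linarith, h1⟩
    have h3 : ⟪et t, x0⟫ = -Real.cos t := by
      rw [het]; simp only
      rw [gc, inner_add_left, real_inner_smul_left, real_inner_smul_left, inner_neg_left, inner_unit hx0,
        real_inner_comm, hxe]; ring
    have h4 : rf (et t) x0 ≠ x0 := by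
      intro h5
      have h6 : ⟪et t, rf (et t) x0⟫ = -⟪et t, x0⟫ := by
        rw [rf_apply, inner_sub_right, real_inner_smul_right, inner_unit (hetn t)]; ring
      rw [h5, h3] at h6; linarith
    have hr : ‖rf (et t) x0‖ = 1 := by rw [rf_norm (hetn t), hx0]
    have h5 := H.support hn hx0 hr h4
    rw [H.crit' hx0 hmin, real_inner_smul_left] at h5
    have h6 := real_inner_le_norm x0 (rf (et t) x0)
    rw [hx0, hr] at h6
    nlinarith
  · rw [h1, hetp] at key
    exact key
end mp


lemma le_of_hdI {f f' : ℝ → ℝ} {a b : ℝ} (hab : a ≤ b) (hd : ∀ t, a ≤ t → t ≤ b → HasDerivAt f (f' t) t)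
    (h0 : ∀ t, a < t → t < b → 0 ≤ f' t) : f a ≤ f b := by
  have := monotoneOn_of_deriv_nonneg (convex_Icc a b) (f := f)
    (fun t ht => (hd t ht.1 ht.2).continuousAt.continuousWithinAt)
    (fun t ht => by
      rw [interior_Icc] at ht
      exact (hd t ht.1.le ht.2.le).differentiableAt.differentiableWithinAt)
    (fun t ht => by
      rw [interior_Icc] at ht
      rw [(hd t ht.1.le ht.2.le).deriv]; exact h0 t ht.1 ht.2)
  exact this ⟨le_refl _, hab⟩ ⟨hab, le_refl _⟩ hab

open Real in
set_option maxHeartbeats 1000000 in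
theorem ode_contra (m : ℕ) (C R : ℝ) (hR : 0 < R) (hRC : R ^ (m + 1) = C) (f f1 r1 : ℝ → ℝ)
    (hf : ∀ t, HasDerivAt f (f1 t) t) (hf1 : ∀ t, HasDerivAt f1 (r1 t - f t) t) (hr1 : ∀ t, 0 < r1 t)
    (h0 : f1 0 = 0) (hpi : f1 π = 0)
    (heq : ∀ t, 0 < t → t < π → r1 t * (f t * sin t + f1 t * cos t) ^ m = C * exp (f1 t ^ 2 / 2) * sin t ^ m)
    (hmin : ∀ t, f π ≤ f t) (hlt : f π < R) : False := by
  have hC : 0 < C := by rw [← hRC]; positivity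
  have pp := pi_pos
  set r : ℝ → ℝ := fun t => f t * sin t + f1 t * cos t with hr
  have hrd : ∀ t, HasDerivAt r (r1 t * cos t) t := by
    intro t
    have := ((hf t).mul (hasDerivAt_sin t)).add ((hf1 t).mul (hasDerivAt_cos t))
    refine HasDerivAt.congr_deriv (f' := _) this ?_
    ring
  have hr0 : r 0 = 0 := by simp [hr, h0]
  have hrpi : r π = 0 := by simp [hr, hpi]
  have hrp : ∀ t, 0 < t → t < π → 0 < r t := by
    intro t h1 h2
    rcases le_or_gt t (π / 2) with h3 | h3
    · have := lt_of_hd (f := r) h1 hrd (fun s hs1 hs2 =>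
        mul_pos (hr1 s) (cos_pos_of_mem_Ioo ⟨by linarith, by linarith⟩))
      linarith
    · have := lt_of_hd (f := fun t => - r t) h2 (fun s => (hrd s).neg) (fun s hs1 hs2 => by
        have := cos_neg_of_pi_div_two_lt_of_lt (x := s) (by linarith) (by linarith)
        nlinarith [hr1 s])
      linarith
  have heq' : ∀ t, 0 < t → t < π → r1 t * r t ^ m = C * exp (f1 t ^ 2 / 2) * sin t ^ m := heq
  -- the auxiliary function
  set X : ℝ → ℝ := fun t => C * (exp (-(f t ^ 2 / 2)) * sin t ^ (m + 1)) -
    exp (-((f t ^ 2 + f1 t ^ 2) / 2)) * r t ^ (m + 1) with hX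
  set X' : ℝ → ℝ := fun t => C * (exp (-(f t ^ 2 / 2)) * (-(f t * f1 t)) * sin t ^ (m + 1)
      + exp (-(f t ^ 2 / 2)) * ((m + 1 : ℝ) * sin t ^ m * cos t)) -
      (exp (-((f t ^ 2 + f1 t ^ 2) / 2)) * (-(f1 t * r1 t)) * r t ^ (m + 1) +
       exp (-((f t ^ 2 + f1 t ^ 2) / 2)) * ((m + 1 : ℝ) * r t ^ m * (r1 t * cos t))) with hX'
  have hXd : ∀ t, HasDerivAt X (X' t) t := by
    intro t
    have a1 : HasDerivAt (fun t => exp (-(f t ^ 2 / 2))) (exp (-(f t ^ 2 / 2)) * (-(f t * f1 t))) t := by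
      have := ((((hf t).pow 2).div_const 2).neg).exp
      refine HasDerivAt.congr_deriv (f' := _) this ?_
      simp; ring
    have a2 : HasDerivAt (fun t => exp (-((f t ^ 2 + f1 t ^ 2) / 2)))
        (exp (-((f t ^ 2 + f1 t ^ 2) / 2)) * (-(f1 t * r1 t))) t := by
      have := (((((hf t).pow 2).add ((hf1 t).pow 2)).div_const 2).neg).exp
      refine HasDerivAt.congr_deriv (f' := _) this ?_
      simp; ring
    have a3 : HasDerivAt (fun t => sin t ^ (m + 1)) ((m + 1 : ℝ) * sin t ^ m * cos t) t := by
      have := (hasDerivAt_sin t).pow (m + 1)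
      refine HasDerivAt.congr_deriv (f' := _) this ?_
      simp
    have a4 : HasDerivAt (fun t => r t ^ (m + 1)) ((m + 1 : ℝ) * r t ^ m * (r1 t * cos t)) t := by
      have := (hrd t).pow (m + 1)
      refine HasDerivAt.congr_deriv (f' := _) this ?_
      simp
    exact ((a1.mul a3).const_mul C).sub (a2.mul a4)
  have hX'e : ∀ t, 0 < t → t < π → X' t = C * exp (-(f t ^ 2 / 2)) * sin t ^ m * f1 t ^ 2 * cos t := by
    intro t ht0 ht1
    have e1 := heq' t ht0 ht1
    have e2 : exp (-((f t ^ 2 + f1 t ^ 2) / 2)) * (r1 t * r t ^ m) = C * exp (-(f t ^ 2 / 2)) * sin t ^ m := by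
      rw [e1]
      have : exp (-(f t ^ 2 / 2)) = exp (-((f t ^ 2 + f1 t ^ 2) / 2)) * exp (f1 t ^ 2 / 2) := by
        rw [← exp_add]; congr 1; ring
      rw [this]; ring
    have e3 : X' t = C * (exp (-(f t ^ 2 / 2)) * (-(f t * f1 t)) * sin t ^ (m + 1)
      + exp (-(f t ^ 2 / 2)) * ((m + 1 : ℝ) * sin t ^ m * cos t)) -
      (exp (-((f t ^ 2 + f1 t ^ 2) / 2)) * (r1 t * r t ^ m)) * (-(f1 t * r t) + (m + 1 : ℝ) * cos t) := by
      rw [hX']; simp only; ring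
    rw [e3, e2]
    simp only [hr]; ring
  have hX0 : X 0 = 0 := by simp [hX, hr0]
  have hXpi : X π = 0 := by simp [hX, hrpi]
  have hXnn : ∀ t, 0 < t → t < π → 0 ≤ X t := by
    intro t h1 h2
    rcases le_or_gt t (π / 2) with h3 | h3
    · have := le_of_hd (f := X) h1.le hXd (fun s hs1 hs2 => by
        rw [hX'e s hs1 (by linarith)]
        have := cos_pos_of_mem_Ioo (x := s) ⟨by linarith, by linarith⟩
        have := sin_pos_of_pos_of_lt_pi hs1 (by linarith)
        positivity)
      linarith
    · have := le_of_hd (f := fun t => - X t) h2.le (fun s => (hXd s).neg) (fun s hs1 hs2 => by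
        rw [hX'e s (by linarith) hs2]
        have h5 := cos_neg_of_pi_div_two_lt_of_lt (x := s) (by linarith) (by linarith)
        have := sin_pos_of_pos_of_lt_pi (x := s) (by linarith) hs2
        have h6 : 0 ≤ C * exp (-(f s ^ 2 / 2)) * sin s ^ m * f1 s ^ 2 := by positivity
        nlinarith)
      linarith
  have hrr : ∀ t, 0 < t → t < π → r t ≤ r1 t * sin t := by
    intro t h1 h2
    have h3 := hXnn t h1 h2
    have hs := sin_pos_of_pos_of_lt_pi h1 h2
    have hrt := hrp t h1 h2
    have e1 := heq' t h1 h2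
    have e4 : X t = exp (-((f t ^ 2 + f1 t ^ 2) / 2)) * (r t ^ m * (r1 t * sin t - r t)) := by
      have : exp (-(f t ^ 2 / 2)) = exp (-((f t ^ 2 + f1 t ^ 2) / 2)) * exp (f1 t ^ 2 / 2) := by
        rw [← exp_add]; congr 1; ring
      rw [hX]; simp only
      rw [this]
      calc _ = exp (-((f t ^ 2 + f1 t ^ 2) / 2)) * ((C * exp (f1 t ^ 2 / 2) * sin t ^ m) * sin t - r t ^ (m + 1)) := by ring
        _ = _ := by rw [← e1]; ring
    rw [e4] at h3
    have h5 := nonneg_of_mul_nonneg_right h3 (exp_pos _)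
    have h6 := nonneg_of_mul_nonneg_right h5 (pow_pos hrt m)
    linarith
  set V : ℝ → ℝ := fun t => f1 t / sin t with hV
  have hVm : ∀ s t, 0 < s → s ≤ t → t < π → V s ≤ V t := by
    intro s t h1 h2 h3
    refine le_of_hdI (f := V) (f' := fun t => ((r1 t - f t) * sin t - f1 t * cos t) / sin t ^ 2) h2 ?_ ?_
    · intro x hx1 hx2
      have hs := sin_pos_of_pos_of_lt_pi (x := x) (by linarith) (by linarith)
      exact (hf1 x).div (hasDerivAt_sin x) hs.ne'
    · intro x hx1 hx2
      have := hrr x (by linarith) (by linarith)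
      apply div_nonneg _ (sq_nonneg _)
      simp only [hr] at this
      linarith
  have hf1V : ∀ t, 0 < t → t < π → f1 t = V t * sin t := by
    intro t h1 h2
    have hs := sin_pos_of_pos_of_lt_pi h1 h2
    rw [hV]; field_simp
  have hVneg : ∀ t, 0 < t → t < π → V t < 0 := by
    intro t h1 h2
    by_contra hcon
    push Not at hcon
    have h3 : ∀ s, t < s → s < π → 0 ≤ f1 s := by
      intro s hs1 hs2
      rw [hf1V s (by linarith) hs2]
      have := sin_pos_of_pos_of_lt_pi (x := s) (by linarith) hs2
      have := hVm t s h1 hs1.le hs2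
      apply mul_nonneg <;> linarith
    have hconst : ∀ s, t < s → s < π → f s = f π := by
      intro s hs1 hs2
      apply le_antisymm _ (hmin s)
      exact le_of_hd hs2.le hf (fun x hx1 hx2 => h3 x (by linarith) hx2)
    obtain ⟨s, hs1, hs2⟩ := exists_between h2
    have hev : f =ᶠ[nhds s] fun _ => f π := by
      filter_upwards [Ioo_mem_nhds hs1 hs2] with x hx
      exact hconst x hx.1 hx.2
    have hz : ∀ x, t < x → x < π → f1 x = 0 := by
      intro x hx1 hx2
      have hev : f =ᶠ[nhds x] fun _ => f π := by
        filter_upwards [Ioo_mem_nhds hx1 hx2] with x hx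
        exact hconst x hx.1 hx.2
      exact (hf x).unique ((hasDerivAt_const x (f π)).congr_of_eventuallyEq hev)
    have hev1 : f1 =ᶠ[nhds s] fun _ => 0 := by
      filter_upwards [Ioo_mem_nhds hs1 hs2] with x hx
      exact hz x hx.1 hx.2
    have e1 := (hf1 s).unique ((hasDerivAt_const s (0 : ℝ)).congr_of_eventuallyEq hev1)
    have e2 : r1 s = f s := by linarith
    have e3 := heq' s (by linarith) hs2
    have hs := sin_pos_of_pos_of_lt_pi (x := s) (by linarith) hs2
    simp only [hr, hz s hs1 hs2] at e3
    rw [e2] at e3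
    have e4 : f s ^ (m + 1) * sin s ^ m = C * sin s ^ m := by
      have : exp ((0 : ℝ) ^ 2 / 2) = 1 := by simp
      rw [this] at e3
      rw [zero_mul, add_zero, mul_pow] at e3
      linear_combination e3
    have e5 := mul_right_cancel₀ (pow_pos hs m).ne' e4
    rw [← hRC] at e5
    have e6 := (pow_left_inj₀ (e2 ▸ (hr1 s).le) hR.le (by omega)).1 e5
    rw [hconst s hs1 hs2] at e6
    linarith
  -- comparison of the two halves
  set E : ℝ → ℝ := fun t => C * exp (f1 t ^ 2 / 2) with hE
  set P : ℝ → ℝ := fun t => r t ^ (m + 1) - r (π - t) ^ (m + 1) with hP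
  set P' : ℝ → ℝ := fun t => (m + 1 : ℝ) * r t ^ m * (r1 t * cos t)
    - (m + 1 : ℝ) * r (π - t) ^ m * (r1 (π - t) * cos (π - t) * (-1)) with hP'
  have hPd : ∀ t, HasDerivAt P (P' t) t := by
    intro t
    have a1 := (hrd t).pow (m + 1)
    have a2 : HasDerivAt (fun t => π - t) (-1) t := (hasDerivAt_id t).const_sub π
    have a3 := ((hrd (π - t)).comp t a2).pow (m + 1)
    refine HasDerivAt.congr_deriv (f' := _) (a1.sub a3) ?_
    simp [hP']
  have hP'e : ∀ t, 0 < t → t < π → P' t = (m + 1 : ℝ) * sin t ^ m * cos t * (E t - E (π - t)) := by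
    intro t h1 h2
    have e1 := heq' t h1 h2
    have e2 := heq' (π - t) (by linarith) (by linarith)
    rw [sin_pi_sub] at e2
    simp only [hP', hE, cos_pi_sub]
    linear_combination (m + 1 : ℝ) * cos t * e1 - (m + 1 : ℝ) * cos t * e2
  have hsq : ∀ t, 0 < t → t ≤ π / 2 → f1 (π - t) ^ 2 ≤ f1 t ^ 2 := by
    intro t h1 h2
    rw [hf1V t h1 (by linarith), hf1V (π - t) (by linarith) (by linarith), sin_pi_sub, mul_pow, mul_pow]
    have := hVm t (π - t) h1 (by linarith) (by linarith)
    have := hVneg t h1 (by linarith)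
    have := hVneg (π - t) (by linarith) (by linarith)
    gcongr ?_ * _
    nlinarith
  have hP'nn : ∀ t, 0 < t → t < π / 2 → 0 ≤ P' t := by
    intro t h1 h2
    rw [hP'e t h1 (by linarith)]
    have hs := sin_pos_of_pos_of_lt_pi h1 (by linarith)
    have hc := cos_pos_of_mem_Ioo (x := t) ⟨by linarith, h2⟩
    have : E (π - t) ≤ E t := by
      simp only [hE]
      have := hsq t h1 h2.le
      gcongr
    have : 0 ≤ E t - E (π - t) := by linarith
    positivity
  have hP0 : P 0 = 0 := by simp [hP, hr0, hrpi]
  have hP2 : P (π / 2) = 0 := by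
    simp only [hP]; rw [show π - π / 2 = π / 2 by ring, sub_self]
  have hPz : ∀ t, 0 < t → t < π / 2 → P t = 0 := by
    intro t h1 h2
    have a1 := le_of_hd h1.le hPd (fun s hs1 hs2 => hP'nn s hs1 (by linarith))
    have a2 := le_of_hd h2.le hPd (fun s hs1 hs2 => hP'nn s (by linarith) hs2)
    linarith
  set t0 := π / 6 with ht0
  have hP't0 : P' t0 = 0 := by
    have hev : P =ᶠ[nhds t0] fun _ => 0 := by
      filter_upwards [Ioo_mem_nhds (a := 0) (b := π / 2) (x := t0) (by positivity) (by rw [ht0]; linarith)] with x hx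
      exact hPz x hx.1 hx.2
    exact (hPd t0).unique ((hasDerivAt_const t0 (0 : ℝ)).congr_of_eventuallyEq hev)
  have ht0p : 0 < t0 := by positivity
  have ht0l : t0 < π / 2 := by rw [ht0]; linarith
  have hs0 := sin_pos_of_pos_of_lt_pi ht0p (by linarith)
  have hE0 : E t0 = E (π - t0) := by
    rw [hP'e t0 ht0p (by linarith)] at hP't0
    have hc := cos_pos_of_mem_Ioo (x := t0) ⟨by linarith, ht0l⟩
    have : (m + 1 : ℝ) * sin t0 ^ m * cos t0 ≠ 0 := by positivity
    have := (mul_eq_zero.1 hP't0).resolve_left this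
    linarith
  have hV0 : V t0 = V (π - t0) := by
    simp only [hE] at hE0
    have e1 := exp_injective (mul_left_cancel₀ hC.ne' hE0)
    rw [hf1V t0 ht0p (by linarith), hf1V (π - t0) (by linarith) (by linarith), sin_pi_sub] at e1
    have e2 : (V t0 ^ 2 - V (π - t0) ^ 2) * sin t0 ^ 2 = 0 := by linarith
    have e3 := (mul_eq_zero.1 e2).resolve_right (by positivity)
    have := hVneg t0 ht0p (by linarith)
    have := hVneg (π - t0) (by linarith) (by linarith)
    have e4 : (V t0 - V (π - t0)) * (V t0 + V (π - t0)) = 0 := by linarith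
    have := (mul_eq_zero.1 e4).resolve_right (by linarith)
    linarith
  set v := V t0 with hv
  have hvn : v < 0 := hVneg t0 ht0p (by linarith)
  have hVc : ∀ t, t0 < t → t < π - t0 → f1 t = v * sin t := by
    intro t h1 h2
    rw [hf1V t (by linarith) (by linarith)]
    have a1 := hVm t0 t ht0p h1.le (by linarith)
    have a2 := hVm t (π - t0) (by linarith) h2.le (by linarith)
    rw [← hV0] at a2
    rw [le_antisymm a2 a1]
  have hr1e : ∀ t, t0 < t → t < π - t0 → r1 t = f t + v * cos t := by
    intro t h1 h2
    have hev : f1 =ᶠ[nhds t] fun t => v * sin t := by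
      filter_upwards [Ioo_mem_nhds h1 h2] with x hx
      exact hVc x hx.1 hx.2
    have := (hf1 t).unique (((hasDerivAt_sin t).const_mul v).congr_of_eventuallyEq hev)
    linarith
  have hpow : ∀ t, t0 < t → t < π - t0 → (f t + v * cos t) ^ (m + 1) = C * exp ((v * sin t) ^ 2 / 2) := by
    intro t h1 h2
    have e1 := heq' t (by linarith) (by linarith)
    have hs := sin_pos_of_pos_of_lt_pi (x := t) (by linarith) (by linarith)
    simp only [hr] at e1
    rw [hr1e t h1 h2, hVc t h1 h2] at e1
    have e2 : f t * sin t + v * sin t * cos t = (f t + v * cos t) * sin t := by ring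
    rw [e2, mul_pow, ← mul_assoc] at e1
    have e3 := mul_right_cancel₀ (pow_pos hs m).ne' e1
    rw [← e3]; ring
  have hconst : f (π / 4) + v * cos (π / 4) = f (π / 2) + v * cos (π / 2) := by
    have hd : ∀ t, HasDerivAt (fun t => f t + v * cos t) (f1 t + v * -sin t) t := fun t =>
      (hf t).add ((hasDerivAt_cos t).const_mul v)
    apply le_antisymm
    · apply le_of_hd (f := fun t => f t + v * cos t) (by linarith) hd
      intro t h1 h2
      rw [hVc t (by rw [ht0]; linarith) (by rw [ht0]; linarith)]; linarith
    · have := le_of_hd (f := fun t => -(f t + v * cos t)) (a := π / 4) (b := π / 2) (by linarith) (fun t => (hd t).neg) (by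
        intro t h1 h2
        rw [hVc t (by rw [ht0]; linarith) (by rw [ht0]; linarith)]; linarith)
      linarith
  have p1 := hpow (π / 4) (by rw [ht0]; linarith) (by rw [ht0]; linarith)
  have p2 := hpow (π / 2) (by rw [ht0]; linarith) (by rw [ht0]; linarith)
  rw [hconst, p2] at p1
  have e1 := exp_injective (mul_left_cancel₀ hC.ne' p1)
  have q : (√2 / 2) ^ 2 = (1 : ℝ) / 2 := by
    rw [div_pow, sq_sqrt (by norm_num : (0 : ℝ) ≤ 2)]; norm_num
  rw [sin_pi_div_two, sin_pi_div_four, mul_pow, mul_pow, q] at e1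
  have : 0 < v ^ 2 := sq_pos_of_neg hvn
  linarith


section zonal
variable {n : ℕ} {C : ℝ} {h : Esp n → ℝ}

lemma decomp2 {y τ : Esp n} (hy : ‖y‖ = 1) (hτ : ‖τ‖ = 1) (hyτ : ⟪y, τ⟫ = 0) (v : Esp n) :
    ⟪y, v - ⟪y, v⟫ • y - ⟪τ, v⟫ • τ⟫ = 0 ∧ ⟪τ, v - ⟪y, v⟫ • y - ⟪τ, v⟫ • τ⟫ = 0 := by
  have hτy : ⟪τ, y⟫ = 0 := by rw [real_inner_comm, hyτ]
  constructor
  · simp only [inner_sub_right, real_inner_smul_right, inner_unit hy, hyτ]; ring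
  · simp only [inner_sub_right, real_inner_smul_right, inner_unit hτ, hτy]; ring

lemma circle_det {m : ℕ} (M : Esp (m + 1) →L[ℝ] Esp (m + 1)) {y τ : Esp (m + 1)} (hy : ‖y‖ = 1) (hτ : ‖τ‖ = 1)
    (hyτ : ⟪y, τ⟫ = 0) (q r1 : ℝ) (hq : q ≠ 0) (hMy : M y = 0) (hMτ : M τ = r1 • τ)
    (hMv : ∀ v, ⟪y, v⟫ = 0 → ⟪τ, v⟫ = 0 → M v = q • v) :
    dt (M + outer y y) = r1 * q ^ m := by
  have hτy : ⟪τ, y⟫ = 0 := by rw [real_inner_comm, hyτ]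
  have e1 : M + outer y y = q • (1 : Esp (m + 1) →L[ℝ] Esp (m + 1)) + (r1 - q) • outer τ τ + (1 - q) • outer y y := by
    ext1 v
    obtain ⟨h1, h2⟩ := decomp2 hy hτ hyτ v
    have h3 := hMv _ h1 h2
    rw [map_sub, map_sub, map_smul, map_smul, hMy, hMτ] at h3
    simp only [cadd, csmul, cone, outer_apply]
    have h4 : M v = q • (v - ⟪y, v⟫ • y - ⟪τ, v⟫ • τ) + ⟪τ, v⟫ • r1 • τ := by
      rw [← h3]; module
    rw [h4]; module
  rw [e1, dt_outer2 y τ q _ _ hq (inner_unit hy) hτy, inner_unit hτ]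
  field_simp
  ring

lemma rf_swap {a u v : Esp n} (hu : ‖u‖ = 1) (hv : ‖v‖ = 1) (hau : ⟪a, u⟫ = 0) (hav : ⟪a, v⟫ = 0) (huv : v ≠ u) :
    ∃ e : Esp n, ‖e‖ = 1 ∧ ⟪a, e⟫ = 0 ∧ ∀ t, rf e (gc a u t) = gc a v t := by
  have hw : v - u ≠ 0 := sub_ne_zero.2 huv
  have hp : 0 < ‖v - u‖ := norm_pos_iff.2 hw
  have hae : ⟪a, nrm (v - u)⟫ = 0 := by
    rw [nrm, real_inner_smul_right, inner_sub_right, hau, hav]; ring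
  refine ⟨nrm (v - u), norm_nrm hw, hae, fun t => ?_⟩
  have h2 : ‖v - u‖ ^ 2 = 2 - 2 * ⟪v, u⟫ := by
    rw [norm_sub_sq_real, hu, hv]; ring
  have h3 : rf (nrm (v - u)) u = v := by
    rw [rf_apply, nrm, real_inner_smul_left, inner_sub_left, inner_unit hu, smul_smul]
    have : 2 * (‖v - u‖⁻¹ * (⟪v, u⟫ - 1)) * ‖v - u‖⁻¹ = -1 := by
      field_simp; linarith
    rw [this]; module
  have h4 : rf (nrm (v - u)) a = a := by
    rw [rf_apply, real_inner_comm, hae]; simp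
  rw [gc, map_add, map_smul, map_smul, h3, h4, gc]

theorem Sol.zonal_false (H : Sol n C h) (hn : 1 ≤ n) {x0 : Esp n} (hx0 : ‖x0‖ = 1)
    (hmin : ∀ x : Esp n, ‖x‖ = 1 → h x0 ≤ h x)
    (hsym : ∀ e : Esp n, ‖e‖ = 1 → ⟪x0, e⟫ = 0 → ∀ y, h (rf e y) = h y)
    (R : ℝ) (hR : 0 < R) (hRC : R ^ n = C) (hlt : h x0 < R) : False := by
  obtain ⟨m, rfl⟩ : ∃ m, n = m + 1 := ⟨n - 1, by omega⟩
  set a := -x0 with ha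
  have han : ‖a‖ = 1 := by rw [ha, norm_neg, hx0]
  have hsym' : ∀ e : Esp (m + 1), ‖e‖ = 1 → ⟪a, e⟫ = 0 → ∀ y, h (rf e y) = h y := by
    intro e he hae
    apply hsym e he
    rw [ha, inner_neg_left] at hae; linarith
  obtain ⟨u, hu, hau⟩ := exists_perp hn han
  set f : ℝ → ℝ := fun t => h (gc a u t) with hf
  set f1 : ℝ → ℝ := fun t => ⟪gradient h (gc a u t), gc' a u t⟫ with hf1
  set r1 : ℝ → ℝ := fun t => ⟪hM h (gc a u t) (gc' a u t), gc' a u t⟫ with hr1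
  have hfd : ∀ t, HasDerivAt f (f1 t) t := fun t => H.toSH.f_hd han hu hau t
  have hf1d : ∀ t, HasDerivAt f1 (r1 t - f t) t := fun t => H.toSH.f'_hd han hu hau t
  have hr1p : ∀ t, 0 < r1 t := fun t =>
    H.M_pos (gc_norm han hu hau t) (unit_ne (gc'_norm han hu hau t)) (gc_gc' han hu hau t)
  have Z1 : ∀ v, ‖v‖ = 1 → ⟪a, v⟫ = 0 → ∀ t, h (gc a v t) = f t := by
    intro v hv hav t
    by_cases huv : v = u
    · rw [huv]
    · obtain ⟨e, he, hae, hrf⟩ := rf_swap hu hv hau hav huv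
      rw [← hrf t, hsym' e he hae]
  have Z1' : ∀ v, ‖v‖ = 1 → ⟪a, v⟫ = 0 → ∀ t, ⟪gradient h (gc a v t), gc' a v t⟫ = f1 t := by
    intro v hv hav t
    have h1 := H.toSH.f_hd han hv hav t
    have h2 : (fun t => h (gc a v t)) = f := funext (Z1 v hv hav)
    rw [h2] at h1
    exact h1.unique (hfd t)
  have Z2 : ∀ v, ‖v‖ = 1 → ⟪a, v⟫ = 0 → ∀ t, gradient h (gc a v t) = f t • gc a v t + f1 t • gc' a v t := by
    intro v hv hav t
    have hy := gc_norm han hv hav t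
    have hτ := gc'_norm han hv hav t
    have hyτ := gc_gc' han hv hav t
    obtain ⟨h1, h2⟩ := decomp2 hy hτ hyτ (gradient h (gc a v t))
    set w := gradient h (gc a v t) - ⟪gc a v t, gradient h (gc a v t)⟫ • gc a v t - ⟪gc' a v t, gradient h (gc a v t)⟫ • gc' a v t with hw
    have e1 : ⟪gc a v t, gradient h (gc a v t)⟫ = f t := by
      rw [real_inner_comm, H.toSH.euler (unit_ne hy), Z1 v hv hav]
    have e2 : ⟪gc' a v t, gradient h (gc a v t)⟫ = f1 t := by
      rw [real_inner_comm, Z1' v hv hav]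
    have hw0 : w = 0 := by
      by_contra hcon
      have e3 : a = Real.cos t • gc a v t - Real.sin t • gc' a v t := by
        rw [gc, gc']
        have := Real.sin_sq_add_cos_sq t
        have e4 : Real.cos t • (Real.cos t • a + Real.sin t • v) - Real.sin t • (-Real.sin t • a + Real.cos t • v)
          = (Real.sin t ^ 2 + Real.cos t ^ 2) • a := by module
        rw [e4, this, one_smul]
      have haw : ⟪a, w⟫ = 0 := by
        rw [e3, inner_sub_left, real_inner_smul_left, real_inner_smul_left, h1, h2]; ring
      have hae : ⟪a, nrm w⟫ = 0 := by rw [nrm, real_inner_smul_right, haw, mul_zero]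
      have he := norm_nrm hcon
      have hfun : (fun y => h (rf (nrm w) y)) = h := funext (hsym' _ he hae)
      have hg := H.toSH.grad_rf he (unit_ne hy)
      have hyy : rf (nrm w) (gc a v t) = gc a v t := by
        have : ⟪nrm w, gc a v t⟫ = 0 := by rw [real_inner_comm, nrm, real_inner_smul_right, h1, mul_zero]
        rw [rf_apply, this]; simp
      rw [hfun, hyy, rf_apply] at hg
      have h3 : ⟪nrm w, gradient h (gc a v t)⟫ = 0 := by
        have h4 : (2 * ⟪nrm w, gradient h (gc a v t)⟫) • nrm w = 0 := by
          have := sub_eq_self.1 hg.symm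
          exact this
        rcases smul_eq_zero.1 h4 with h5 | h5
        · linarith
        · exact absurd h5 (unit_ne he)
      have h5 : ⟪w, gradient h (gc a v t)⟫ = 0 := by
        rw [nrm, real_inner_smul_left] at h3
        exact (mul_eq_zero.1 h3).resolve_left (inv_ne_zero (norm_ne_zero_iff.2 hcon))
      have h6 : ⟪w, w⟫ = 0 := by
        conv_lhs => rw [hw]
        rw [← hw, inner_sub_right, inner_sub_right, real_inner_smul_right, real_inner_smul_right, h5,
          real_inner_comm _ w, h1, real_inner_comm _ w, h2]; ring
      exact hcon (inner_self_eq_zero.1 h6)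
    rw [hw, e1, e2] at hw0
    rw [← sub_eq_zero, ← hw0]; abel
  have Z3 : ∀ t, hM h (gc a u t) (gc' a u t) = r1 t • gc' a u t := by
    intro t
    have hy := gc_norm han hu hau t
    have d1 : HasDerivAt (fun t => gradient h (gc a u t)) (hM h (gc a u t) (gc' a u t)) t :=
      (H.toSH.dG (unit_ne hy)).comp_hasDerivAt t (gc_hd a u t)
    have d2 := ((hfd t).smul (gc_hd a u t)).add ((hf1d t).smul (gc'_hd a u t))
    have e1 : (fun t => gradient h (gc a u t)) = fun t => f t • gc a u t + f1 t • gc' a u t := funext (Z2 u hu hau)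
    rw [e1] at d1
    have := d1.unique d2
    rw [this]; module
  have Z4 : ∀ v, ⟪a, v⟫ = 0 → ⟪u, v⟫ = 0 → ∀ t, Real.sin t • hM h (gc a u t) v =
      (f t * Real.sin t + f1 t * Real.cos t) • v := by
    intro v hav huv t
    by_cases hv0 : v = 0
    · rw [hv0, map_zero, smul_zero, smul_zero]
    have key : Real.sin t • hM h (gc a u t) (nrm v) = (f t * Real.sin t + f1 t * Real.cos t) • nrm v := by
      have he := norm_nrm hv0
      have hae : ⟪a, nrm v⟫ = 0 := by rw [nrm, real_inner_smul_right, hav, mul_zero]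
      have hue : ⟪u, nrm v⟫ = 0 := by rw [nrm, real_inner_smul_right, huv, mul_zero]
      set e := nrm v with hed
      have hun : ∀ s, ‖gc u e s‖ = 1 := fun s => gc_norm hu he hue s
      have hua : ∀ s, ⟪a, gc u e s⟫ = 0 := by
        intro s; rw [gc, inner_add_right, real_inner_smul_right, real_inner_smul_right, hau, hae]; ring
      have c0 : gc u e 0 = u := by simp [gc]
      have c1 : gc' u e 0 = e := by simp [gc']
      have d0 : HasDerivAt (gc u e) e 0 := by have := gc_hd u e 0; rw [c1] at this; exact this
      have dy : HasDerivAt (fun s => gc a (gc u e s) t) (Real.sin t • e) 0 := by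
        unfold gc at d0 ⊢
        exact (d0.const_smul (Real.sin t)).const_add _
      have dτ : HasDerivAt (fun s => gc' a (gc u e s) t) (Real.cos t • e) 0 := by
        unfold gc gc' at *
        exact (d0.const_smul (Real.cos t)).const_add _
      have d1 : HasDerivAt (fun s => gradient h (gc a (gc u e s) t)) (hM h (gc a u t) (Real.sin t • e)) 0 := by
        have hG : HasFDerivAt (gradient h) (hM h (gc a u t)) (gc a (gc u e 0) t) := by
          rw [c0]; exact H.toSH.dG (unit_ne (gc_norm han hu hau t))
        have := hG.comp_hasDerivAt (0 : ℝ) dy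
        exact this
      have d2 := (dy.const_smul (f t)).add (dτ.const_smul (f1 t))
      have e1 : (fun s => gradient h (gc a (gc u e s) t)) =
        fun s => f t • gc a (gc u e s) t + f1 t • gc' a (gc u e s) t := funext fun s => Z2 _ (hun s) (hua s) t
      rw [e1] at d1
      have := d1.unique d2
      rw [map_smul] at this
      rw [this]; module
    have e1 : v = ‖v‖ • nrm v := (norm_smul_nrm hv0).symm
    rw [e1, map_smul, smul_comm, key, smul_comm]
  have g0 : ∀ v : Esp (m + 1), gc a v 0 = a := fun v => by simp [gc]
  have g0' : ∀ v : Esp (m + 1), gc' a v 0 = v := fun v => by simp [gc']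
  have gp : ∀ v : Esp (m + 1), gc a v Real.pi = -a := fun v => by simp [gc]
  have gp' : ∀ v : Esp (m + 1), gc' a v Real.pi = -v := fun v => by simp [gc']
  have hnu : ‖-u‖ = 1 := by rw [norm_neg, hu]
  have hanu : ⟪a, -u⟫ = 0 := by rw [inner_neg_right, hau, neg_zero]
  have hf10 : f1 0 = 0 := by
    have h1 := Z1' _ hnu hanu 0
    simp only [hf1, g0, g0', inner_neg_right] at h1 ⊢
    linarith
  have hf1p : f1 Real.pi = 0 := by
    have h1 := Z1' _ hnu hanu Real.pi
    simp only [hf1, gp, gp', inner_neg_right] at h1 ⊢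
    linarith
  have hfp : f Real.pi = h x0 := by
    show h (gc a u Real.pi) = h x0
    rw [gp, ha, neg_neg]
  -- positivity of r
  have hrd : ∀ t, HasDerivAt (fun t => f t * Real.sin t + f1 t * Real.cos t) (r1 t * Real.cos t) t := by
    intro t
    have := ((hfd t).mul (Real.hasDerivAt_sin t)).add ((hf1d t).mul (Real.hasDerivAt_cos t))
    refine HasDerivAt.congr_deriv (f' := _) this ?_
    ring
  have hrp : ∀ t, 0 < t → t < Real.pi → 0 < f t * Real.sin t + f1 t * Real.cos t := by
    intro t h1 h2
    rcases le_or_gt t (Real.pi / 2) with h3 | h3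
    · have := lt_of_hd h1 hrd (fun s hs1 hs2 =>
        mul_pos (hr1p s) (Real.cos_pos_of_mem_Ioo ⟨by linarith, by linarith⟩))
      simp [hf10] at this
      linarith
    · have := lt_of_hd h2 (fun s => (hrd s).neg) (fun s hs1 hs2 => by
        have := Real.cos_neg_of_pi_div_two_lt_of_lt (x := s) (by linarith) (by linarith)
        nlinarith [hr1p s])
      simp [hf1p] at this
      linarith
  refine ode_contra m C R hR hRC f f1 r1 hfd hf1d hr1p hf10 hf1p ?_ ?_ (by rw [hfp]; exact hlt)
  · intro t ht0 ht1
    have hs := Real.sin_pos_of_pos_of_lt_pi ht0 ht1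
    have hy := gc_norm han hu hau t
    have hτ := gc'_norm han hu hau t
    have hyτ := gc_gc' han hu hau t
    have hrt := hrp t ht0 ht1
    set r := f t * Real.sin t + f1 t * Real.cos t with hrdef
    have hdet := circle_det (hM h (gc a u t)) hy hτ hyτ (r / Real.sin t) (r1 t) (by positivity)
      (H.toSH.My (unit_ne hy)) (Z3 t) (by
        intro v hv1 hv2
        have hsc := Real.sin_sq_add_cos_sq t
        have hav : ⟪a, v⟫ = 0 := by
          have e4 : a = Real.cos t • gc a u t - Real.sin t • gc' a u t := by
            have e5 : Real.cos t • gc a u t - Real.sin t • gc' a u t = (Real.sin t ^ 2 + Real.cos t ^ 2) • a := by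
              rw [gc, gc']; module
            rw [e5, hsc, one_smul]
          rw [e4, inner_sub_left, real_inner_smul_left, real_inner_smul_left, hv1, hv2]; ring
        have huv : ⟪u, v⟫ = 0 := by
          have e4 : u = Real.sin t • gc a u t + Real.cos t • gc' a u t := by
            have e5 : Real.sin t • gc a u t + Real.cos t • gc' a u t = (Real.sin t ^ 2 + Real.cos t ^ 2) • u := by
              rw [gc, gc']; module
            rw [e5, hsc, one_smul]
          rw [e4, inner_add_left, real_inner_smul_left, real_inner_smul_left, hv1, hv2]; ring
        have h1 := Z4 v hav huv t
        have h2 : hM h (gc a u t) v = (Real.sin t)⁻¹ • (Real.sin t • hM h (gc a u t) v) := by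
          rw [smul_smul, inv_mul_cancel₀ hs.ne', one_smul]
        rw [h2, h1, smul_smul]
        congr 1
        rw [hrdef]; field_simp)
    have heq := H.eq _ hy
    rw [hdet, Z2 u hu hau t] at heq
    have e6 : f t • gc a u t + f1 t • gc' a u t - h (gc a u t) • gc a u t = f1 t • gc' a u t := by
      simp only [hf]; abel
    rw [e6, norm_smul, hτ, mul_one, Real.norm_eq_abs, sq_abs] at heq
    rw [← heq, div_pow]
    field_simp
  · intro t
    rw [hfp]
    exact hmin _ (gc_norm han hu hau t)
end zonal


lemma exp_lip {B a b : ℝ} (hB : 0 ≤ B) (ha : |a| ≤ B) (hb : |b| ≤ B) :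
    |Real.exp (a ^ 2 / 2) - Real.exp (b ^ 2 / 2)| ≤ Real.exp (B ^ 2 / 2) * B * |a - b| := by
  have hh : ∀ x y : ℝ, |x| ≤ B → |y| ≤ B → Real.exp (x ^ 2 / 2) - Real.exp (y ^ 2 / 2) ≤ Real.exp (B ^ 2 / 2) * B * |x - y| := by
    intro x y hx hy
    have h1 := Real.add_one_le_exp (y ^ 2 / 2 - x ^ 2 / 2)
    have h2 : Real.exp (y ^ 2 / 2) = Real.exp (x ^ 2 / 2) * Real.exp (y ^ 2 / 2 - x ^ 2 / 2) := by
      rw [← Real.exp_add]; congr 1; ring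
    have hp := Real.exp_pos (x ^ 2 / 2)
    have h3 : Real.exp (x ^ 2 / 2) - Real.exp (y ^ 2 / 2) ≤ Real.exp (x ^ 2 / 2) * (x ^ 2 / 2 - y ^ 2 / 2) := by
      rw [h2]; nlinarith
    have h4 : x ^ 2 / 2 - y ^ 2 / 2 ≤ B * |x - y| := by
      have e1 : x ^ 2 / 2 - y ^ 2 / 2 = (x + y) / 2 * (x - y) := by ring
      rw [e1]
      calc (x + y) / 2 * (x - y) ≤ |(x + y) / 2 * (x - y)| := le_abs_self _
        _ = |(x + y) / 2| * |x - y| := abs_mul _ _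
        _ ≤ B * |x - y| := by
          gcongr
          rw [abs_le] at *
          constructor <;> linarith
    have h5 : Real.exp (x ^ 2 / 2) ≤ Real.exp (B ^ 2 / 2) := by
      apply Real.exp_le_exp.2
      have := sq_le_sq' (by linarith [(abs_le.1 hx).1]) (abs_le.1 hx).2
      linarith
    calc _ ≤ _ := h3
      _ ≤ Real.exp (x ^ 2 / 2) * (B * |x - y|) := by gcongr
      _ ≤ Real.exp (B ^ 2 / 2) * (B * |x - y|) := by gcongr
      _ = _ := by ring
  rw [abs_le]
  constructor
  · have := hh b a hb ha
    rw [abs_sub_comm] at this; linarith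
  · exact hh a b ha hb

lemma ode_unique {C B : ℝ} (hC : 0 ≤ C) (hB : 0 ≤ B) {f f1 g g1 : ℝ → ℝ}
    (hf : ∀ t, HasDerivAt f (f1 t) t) (hf1 : ∀ t, HasDerivAt f1 (C * Real.exp (f1 t ^ 2 / 2) - f t) t)
    (hg : ∀ t, HasDerivAt g (g1 t) t) (hg1 : ∀ t, HasDerivAt g1 (C * Real.exp (g1 t ^ 2 / 2) - g t) t)
    (bf : ∀ t, |f1 t| ≤ B) (bg : ∀ t, |g1 t| ≤ B) (h0 : f 0 = g 0) (h1 : f1 0 = g1 0) :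
    ∀ t, 0 ≤ t → f t = g t := by
  intro t ht
  set L := C * (Real.exp (B ^ 2 / 2) * B) with hL
  have hL0 : 0 ≤ L := by positivity
  set D : ℝ → ℝ := fun t => (f t - g t) ^ 2 + (f1 t - g1 t) ^ 2 with hD
  set D' : ℝ → ℝ := fun t => 2 * (f1 t - g1 t) * (C * (Real.exp (f1 t ^ 2 / 2) - Real.exp (g1 t ^ 2 / 2))) with hD'
  have hDd : ∀ t, HasDerivAt D (D' t) t := by
    intro t
    have := (((hf t).sub (hg t)).pow 2).add (((hf1 t).sub (hg1 t)).pow 2)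
    refine HasDerivAt.congr_deriv (f' := _) this ?_
    simp [hD']; ring
  have hD'le : ∀ t, D' t ≤ 2 * L * D t := by
    intro t
    have h2 := exp_lip hB (bf t) (bg t)
    have h3 : (f1 t - g1 t) * (Real.exp (f1 t ^ 2 / 2) - Real.exp (g1 t ^ 2 / 2)) ≤
        Real.exp (B ^ 2 / 2) * B * (f1 t - g1 t) ^ 2 := by
      calc _ ≤ |(f1 t - g1 t) * (Real.exp (f1 t ^ 2 / 2) - Real.exp (g1 t ^ 2 / 2))| := le_abs_self _
        _ = |f1 t - g1 t| * |Real.exp (f1 t ^ 2 / 2) - Real.exp (g1 t ^ 2 / 2)| := abs_mul _ _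
        _ ≤ |f1 t - g1 t| * (Real.exp (B ^ 2 / 2) * B * |f1 t - g1 t|) := by gcongr
        _ = Real.exp (B ^ 2 / 2) * B * |f1 t - g1 t| ^ 2 := by ring
        _ = _ := by rw [sq_abs]
    have h4 := mul_le_mul_of_nonneg_left h3 hC
    have h5 : 0 ≤ L * (f t - g t) ^ 2 := by positivity
    simp only [hD', hD, hL] at *
    nlinarith
  have hd2 : ∀ t, HasDerivAt (fun t => -(D t * Real.exp (-(2 * L) * t)))
      (-(D' t * Real.exp (-(2 * L) * t) + D t * (Real.exp (-(2 * L) * t) * (-(2 * L))))) t := by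
    intro t
    have h6 : HasDerivAt (fun t : ℝ => -(2 * L) * t) (-(2 * L)) t := by
      simpa using (hasDerivAt_id t).const_mul (-(2 * L))
    exact ((hDd t).mul h6.exp).neg
  have h7 := le_of_hd ht hd2 (fun s _ _ => by
    have := hD'le s
    have hp := Real.exp_pos (-(2 * L) * s)
    nlinarith)
  have hD0 : D 0 = 0 := by simp [hD, h0, h1]
  simp only [hD0, zero_mul, neg_zero] at h7
  have hp := Real.exp_pos (-(2 * L) * t)
  have h8 : D t ≤ 0 := by
    by_contra hcon
    push Not at hcon
    have := mul_pos hcon hp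
    linarith
  have h9 : (f t - g t) ^ 2 = 0 := by
    simp only [hD] at h8
    nlinarith [sq_nonneg (f t - g t), sq_nonneg (f1 t - g1 t)]
  have := pow_eq_zero_iff (two_ne_zero) |>.1 h9
  linarith

lemma perp_zero {y τ v : Esp 1} (hy : ‖y‖ = 1) (hτ : ‖τ‖ = 1) (hyτ : ⟪y, τ⟫ = 0) (h1 : ⟪y, v⟫ = 0) (h2 : ⟪τ, v⟫ = 0) :
    v = 0 := by
  by_contra hv
  have h1' : ⟪y, nrm v⟫ = 0 := by rw [nrm, real_inner_smul_right, h1, mul_zero]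
  have h2' : ⟪τ, nrm v⟫ = 0 := by rw [nrm, real_inner_smul_right, h2, mul_zero]
  have ho : Orthonormal ℝ ![y, τ, nrm v] := by
    refine ⟨?_, ?_⟩
    · intro i; fin_cases i
      · exact hy
      · exact hτ
      · exact norm_nrm hv
    · intro i j hij
      fin_cases i <;> fin_cases j <;> simp at hij ⊢
      · exact hyτ
      · exact h1'
      · rw [real_inner_comm]; exact hyτ
      · exact h2'
      · rw [real_inner_comm]; exact h1'
      · rw [real_inner_comm]; exact h2'
  have := ho.linearIndependent.fintype_card_le_finrank
  simp at this

section one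
variable {C : ℝ} {h : Esp 1 → ℝ}

lemma Sol.r1_eq (H : Sol 1 C h) {a u : Esp 1} (ha : ‖a‖ = 1) (hu : ‖u‖ = 1) (hau : ⟪a, u⟫ = 0) (t : ℝ) :
    ⟪hM h (gc a u t) (gc' a u t), gc' a u t⟫ = C * Real.exp (⟪gradient h (gc a u t), gc' a u t⟫ ^ 2 / 2) := by
  have hy := gc_norm ha hu hau t
  have hτ := gc'_norm ha hu hau t
  have hyτ := gc_gc' ha hu hau t
  set y := gc a u t
  set τ := gc' a u t
  have dec : ∀ v : Esp 1, v = ⟪y, v⟫ • y + ⟪τ, v⟫ • τ := by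
    intro v
    obtain ⟨h1, h2⟩ := decomp2 hy hτ hyτ v
    have := perp_zero hy hτ hyτ h1 h2
    rw [← sub_eq_zero, ← this]; abel
  have hMτ : hM h y τ = ⟪hM h y τ, τ⟫ • τ := by
    have h1 := dec (hM h y τ)
    have h2 : ⟪y, hM h y τ⟫ = 0 := by
      rw [← H.toSH.Msym (unit_ne hy), H.toSH.My (unit_ne hy), inner_zero_left]
    rw [h2, zero_smul, zero_add, real_inner_comm] at h1
    exact h1
  have hdet := circle_det (m := 0) (hM h y) hy hτ hyτ 1 ⟪hM h y τ, τ⟫ one_ne_zero (H.toSH.My (unit_ne hy)) hMτ (by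
    intro v h1 h2
    rw [perp_zero hy hτ hyτ h1 h2, map_zero, smul_zero])
  have heq := H.eq _ hy
  rw [hdet] at heq
  have hG := dec (gradient h y)
  rw [real_inner_comm, H.toSH.euler (unit_ne hy), real_inner_comm (gradient h y) τ] at hG
  have e1 : gradient h y - h y • y = ⟪gradient h y, τ⟫ • τ := by
    nth_rw 1 [hG]; abel
  rw [e1, norm_smul, hτ, mul_one, Real.norm_eq_abs, sq_abs] at heq
  rw [← heq]; simp

theorem Sol.part5 (H : Sol 1 C h) {x0 : Esp 1} (hx0 : ‖x0‖ = 1)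
    (hmin : ∀ x : Esp 1, ‖x‖ = 1 → h x0 ≤ h x) : ∀ x, ‖x‖ = 1 → h x = h x0 := by
  have hC := H.C_pos
  obtain ⟨B, hB⟩ := (isCompact_sphere (0 : Esp 1) 1).exists_bound_of_continuousOn (f := gradient h)
    (fun x hx => (H.toSH.cdG (unit_ne (by simpa using hx))).continuousAt.continuousWithinAt)
  have hB0 : 0 ≤ B := (norm_nonneg _).trans (hB x0 (by simpa using hx0))
  -- data along a great circle
  have bnd : ∀ u : Esp 1, ‖u‖ = 1 → ⟪x0, u⟫ = 0 → ∀ t, |⟪gradient h (gc x0 u t), gc' x0 u t⟫| ≤ B := by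
    intro u hu hxu t
    have h1 := abs_real_inner_le_norm (gradient h (gc x0 u t)) (gc' x0 u t)
    rw [gc'_norm hx0 hu hxu, mul_one] at h1
    exact h1.trans (hB _ (by simpa using gc_norm hx0 hu hxu t))
  have d0 : ∀ u : Esp 1, ‖u‖ = 1 → ⟪x0, u⟫ = 0 → ∀ t, HasDerivAt (fun t => h (gc x0 u t)) ⟪gradient h (gc x0 u t), gc' x0 u t⟫ t :=
    fun u hu hxu t => H.toSH.f_hd hx0 hu hxu t
  have d1 : ∀ u : Esp 1, ‖u‖ = 1 → ⟪x0, u⟫ = 0 → ∀ t, HasDerivAt (fun t => ⟪gradient h (gc x0 u t), gc' x0 u t⟫)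
      (C * Real.exp (⟪gradient h (gc x0 u t), gc' x0 u t⟫ ^ 2 / 2) - h (gc x0 u t)) t := by
    intro u hu hxu t
    have := H.toSH.f'_hd hx0 hu hxu t
    rw [H.r1_eq hx0 hu hxu] at this
    exact this
  have i0 : ∀ u : Esp 1, gc x0 u 0 = x0 := fun u => by simp [gc]
  have i1 : ∀ u : Esp 1, gc' x0 u 0 = u := fun u => by simp [gc']
  have hsymm : ∀ u : Esp 1, ‖u‖ = 1 → ⟪x0, u⟫ = 0 → ∀ t, 0 ≤ t → h (gc x0 u t) = h (gc x0 (-u) t) := by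
    intro u hu hxu
    have hu' : ‖-u‖ = 1 := by rw [norm_neg, hu]
    have hxu' : ⟪x0, -u⟫ = 0 := by rw [inner_neg_right, hxu, neg_zero]
    refine ode_unique hC.le hB0 (d0 u hu hxu) (d1 u hu hxu) (d0 _ hu' hxu') (d1 _ hu' hxu') (bnd u hu hxu) (bnd _ hu' hxu') ?_ ?_
    · simp only [i0]
    · simp only [i0, i1]
      rw [H.crit hx0 hmin hxu, H.crit hx0 hmin hxu']
  rcases lt_trichotomy (h x0) C with hlt | heq | hgt
  · exfalso
    refine H.zonal_false le_rfl hx0 hmin ?_ C hC (pow_one C) hlt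
    intro e he hxe y
    by_cases hy0 : y = 0
    · rw [hy0, map_zero]
    have hyp : 0 < ‖y‖ := norm_pos_iff.2 hy0
    obtain ⟨u, hu, hxu, t, ht0, -, hyt⟩ := exists_gc le_rfl hx0 (norm_nrm hy0)
    have hru : rf e u = -u := by
      obtain ⟨h1, h2⟩ := decomp2 hx0 he hxe u
      have h3 := perp_zero hx0 he hxe h1 h2
      rw [hxu, zero_smul, sub_zero] at h3
      rw [rf_apply]
      have h4 : u = ⟪e, u⟫ • e := sub_eq_zero.1 h3
      have h5 : u - (2 * ⟪e, u⟫) • e = u - (2 : ℝ) • (⟪e, u⟫ • e) := by rw [smul_smul]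
      rw [h5, ← h4]; module
    have hrx : rf e x0 = x0 := by
      rw [rf_apply, real_inner_comm, hxe]; simp
    have hr : rf e (nrm y) = gc x0 (-u) t := by
      rw [hyt, gc, map_add, map_smul, map_smul, hru, hrx, gc]
    rw [← norm_smul_nrm hy0, map_smul, H.toSH.hom _ hyp, H.toSH.hom _ hyp, hr, hyt, hsymm u hu hxu t ht0]
  · intro x hx
    obtain ⟨u, hu, hxu, t, ht0, -, rfl⟩ := exists_gc le_rfl hx0 hx
    have := ode_unique (g := fun _ => C) (g1 := fun _ => 0) hC.le hB0 (d0 u hu hxu) (d1 u hu hxu)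
      (fun t => hasDerivAt_const t C) (fun t => by
        refine HasDerivAt.congr_deriv (f' := _) (hasDerivAt_const t (0 : ℝ)) ?_
        simp) (bnd u hu hxu) (fun t => by simpa using hB0) (by simp only [i0]; exact heq)
        (by simp only [i0, i1]; exact H.crit hx0 hmin hxu) t ht0
    rw [this, heq]
  · exfalso
    obtain ⟨u, hu, hxu⟩ := exists_perp le_rfl hx0
    have h2 := d1 u hu hxu 0
    have := second_deriv_test (Filter.Eventually.of_forall (d0 u hu hxu)) h2 (Filter.Eventually.of_forall (fun t => by
      simp only [i0]; exact hmin _ (gc_norm hx0 hu hxu t)))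
    simp only [i0, i1, H.crit hx0 hmin hxu] at this
    simp at this
    linarith
end one

theorem Sol.final {n : ℕ} {C : ℝ} {h : Esp n → ℝ} (H : Sol n C h) (hn : 1 ≤ n) :
    ∃ r : ℝ, 0 < r ∧ ∀ x : Esp n, ‖x‖ = 1 → h x = r := by
  have h1 : ‖(EuclideanSpace.single 0 1 : Esp n)‖ = 1 := by simp
  obtain ⟨x0, hx0, hm⟩ := (isCompact_sphere (0 : Esp n) 1).exists_isMinOn ⟨_, show (EuclideanSpace.single 0 1 : Esp n) ∈ _ by simpa using h1⟩
    (f := h) (fun x hx => (H.toSH.cd (unit_ne (by simpa using hx))).continuousAt.continuousWithinAt)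
  have hx0 : ‖x0‖ = 1 := by simpa using hx0
  have hmin : ∀ x : Esp n, ‖x‖ = 1 → h x0 ≤ h x := fun x hx => isMinOn_iff.1 hm x (by simpa using hx)
  have hconst : 0 ≤ h x0 ∧ ∀ x, ‖x‖ = 1 → h x = h x0 := by
    rcases lt_or_ge (h x0) 0 with hneg | hpos
    · exfalso
      have hC := H.C_pos
      refine H.zonal_false hn hx0 hmin (fun e he hxe => H.sym_of_neg hn hx0 hmin hneg he hxe)
        (C ^ ((n : ℝ)⁻¹)) (by positivity) (Real.rpow_inv_natCast_pow hC.le (by omega)) ?_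
      have : 0 < C ^ ((n : ℝ)⁻¹) := by positivity
      linarith
    · refine ⟨hpos, ?_⟩
      rcases hn.lt_or_eq with h2 | h2
      · have := H.part2 h2 (fun x hx => hpos.trans (hmin x hx))
        exact fun x hx => H.const_of_s2 hn this hx0 hx
      · subst h2
        exact H.part5 hx0 hmin
  obtain ⟨h0, hc⟩ := hconst
  refine ⟨h x0, ?_, hc⟩
  rcases h0.lt_or_eq with h2 | h2
  · exact h2
  · exfalso
    have hg := H.crit' hx0 hmin
    rw [← h2, zero_smul] at hg
    obtain ⟨u, hu, hxu⟩ := exists_perp hn hx0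
    have hux : u ≠ x0 := by
      rintro rfl; rw [inner_unit hu] at hxu; norm_num at hxu
    have := H.support hn hx0 hu hux
    rw [hg, inner_zero_left, hc u hu, ← h2] at this
    exact lt_irrefl _ this


/-- isotropic `L_p`-Gaussian–Minkowski problem, `p = 1`.  Let `c > 0`.
If `Mⁿ ⊆ ℝ^{n+1}` is a closed, smooth, strictly convex hypersurface with support function `h`
(no sign assumption on `h`) and Gauss curvature `𝒦` satisfying `e^{|Dh|²/2} 𝒦 = c` on `𝕊ⁿ`,
then `M` is an origin-centred sphere (no assumption on the size of `c`). -/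
theorem statement_6 (n : ℕ) (hn : 1 ≤ n)
    (c : ℝ) (hc : 0 < c)
    (h 𝒦 : Esp n → ℝ)
    (hsm : ContDiffOn ℝ (⊤ : ℕ∞) h {(0 : Esp n)}ᶜ)
    (hhom : PosHom n h)
    (hconv : ∀ x ∈ sphere (0 : Esp n) 1, ∀ v : Esp n,
      ⟪v, x⟫ = 0 → v ≠ 0 → 0 < hessForm n h x v v)
    (hGauss : ∀ x ∈ sphere (0 : Esp n) 1, (𝒦 x)⁻¹ = sigmaElem n n h x)
    (heq : ∀ x ∈ sphere (0 : Esp n) 1,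
      Real.exp (‖sphGrad n h x‖ ^ 2 / 2) * 𝒦 x = c) :
    ∃ r : ℝ, 0 < r ∧ ∀ x ∈ sphere (0 : Esp n) 1, h x = r := by
  obtain ⟨r, hr, hx⟩ := (sol_of_hyp n c hc h 𝒦 hsm hhom hconv hGauss heq).final hn
  exact ⟨r, hr, fun x hx' => hx x (by simpa using hx')⟩
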